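/- arXiv:2603.16234 — 2 statements merged into one kernel-verified Lean document; each statement's English description precedes it below -/
import Mathlib

section
/- Let X and U be irreducible words such that the word X⁻¹UX is freely reduced and contains no (4g−1)-LLFR. Then one of the following holds: (a) there exist b₁⋯b_{4g} ∈ 𝓡 and t₀ ≥ 1 such that either [X⁻¹ ends with the subword b_{4g}b_{4g−1}⋯b_{2g+2}b_{2g+1}, U = (b_{2g+2}⋯b_{4g})^{t₀} b₁ b_{2g+3}⋯b_{4g}, and X begins with b₁b₂⋯b_{2g}], or [X⁻¹ ends with the subword b₂b₃⋯b_{2g}b_{2g+1}, U = b_{2g+2}⋯b_{4g−1} b_{2g+1} (b_{2g+2}⋯b_{4g})^{t₀}, and X begins with b₁b_{4g}b_{4g−1}⋯b_{2g+2}]; or (b) neither the word nf(X⁻¹U)·X nor the word X⁻¹·nf(UX) contains a (4g−1)-LLFR. -/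
namespace SG

/-- A letter of the alphabet `S± = {cᵢ^{±1}}`: `(i, true)` is `c_{i+1}`,
`(i, false)` is `c_{i+1}⁻¹`. -/
abbrev Letter (g : ℕ) := Fin (2*g) × Bool

/-- A word in the alphabet `S±`. -/
abbrev Word (g : ℕ) := List (Letter g)

/-- The surface relator `c₁c₂⋯c_{2g}c₁⁻¹c₂⁻¹⋯c_{2g}⁻¹` in the free group. -/
def relator (g : ℕ) : FreeGroup (Fin (2*g)) :=
  (List.ofFn fun i : Fin (2*g) => FreeGroup.of i).prod *
  (List.ofFn fun i : Fin (2*g) => (FreeGroup.of i)⁻¹).prod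

/-- The surface group with the symmetric presentation. -/
abbrev SurfaceGroup (g : ℕ) :=
  PresentedGroup ({relator g} : Set (FreeGroup (Fin (2*g))))

/-- The generator `c_{i+1}` of the surface group. -/
def gen (g : ℕ) (i : Fin (2*g)) : SurfaceGroup g := PresentedGroup.of i

/-- The inverse of a letter. -/
def invLetter (g : ℕ) (a : Letter g) : Letter g := (a.1, !a.2)

/-- The group element represented by a letter. -/
def evalLetter (g : ℕ) (a : Letter g) : SurfaceGroup g :=
  if a.2 then gen g a.1 else (gen g a.1)⁻¹

/-- The group element represented by a word. -/
def eval (g : ℕ) (W : Word g) : SurfaceGroup g := (W.map (evalLetter g)).prod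

/-- The formal inverse `x_n⁻¹ ⋯ x₁⁻¹` of a word `x₁ ⋯ x_n`. -/
def wordInv (g : ℕ) (W : Word g) : Word g := (W.map (invLetter g)).reverse

/-- Word length of a group element: the least `n` such that the element is a
product of `n` elements of `S ∪ S⁻¹`. -/
noncomputable def len (g : ℕ) (u : SurfaceGroup g) : ℕ :=
  sInf {n | ∃ W : Word g, W.length = n ∧ eval g W = u}

/-- `conjLen g u v` is the minimum of `|x|` over conjugators `x` with `x⁻¹ux = v`. -/
noncomputable def conjLen (g : ℕ) (u v : SurfaceGroup g) : ℕ :=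
  sInf {k | ∃ x : SurfaceGroup g, x⁻¹ * u * x = v ∧ len g x = k}

/-- The conjugator length function: `CL g n` is the least `N` such that any
conjugate `u, v` with `|u| + |v| ≤ n` admit a conjugator of length `≤ N`. -/
noncomputable def CL (g : ℕ) (n : ℕ) : ℕ :=
  sInf {N | ∀ u v : SurfaceGroup g,
    (∃ x : SurfaceGroup g, x⁻¹ * u * x = v) → len g u + len g v ≤ n →
      conjLen g u v ≤ N}

/-- Rank of a letter in the ascending order
`c_{2g} ≺ ⋯ ≺ c₂ ≺ c₁ ≺ c₁⁻¹ ≺ c₂⁻¹ ≺ ⋯ ≺ c_{2g}⁻¹`. -/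
def rank (g : ℕ) (a : Letter g) : ℕ :=
  if a.2 then (2*g - 1) - (a.1 : ℕ) else 2*g + (a.1 : ℕ)

/-- The strict order `≺` on letters. -/
def letterLt (g : ℕ) (a b : Letter g) : Prop := rank g a < rank g b

/-- The length-lexicographical order `≺` on words. -/
def wordLt (g : ℕ) (X Y : Word g) : Prop :=
  X.length < Y.length ∨ (X.length = Y.length ∧ List.Lex (letterLt g) X Y)

/-- A word is irreducible if it is the `≺`-least word representing its element. -/
def IrreducibleWord (g : ℕ) (W : Word g) : Prop :=
  ∀ W' : Word g, eval g W' = eval g W → W' = W ∨ wordLt g W W'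

/-- A word is cyclically irreducible if all its cyclic permutations are irreducible. -/
def CyclicallyIrreducibleWord (g : ℕ) (W : Word g) : Prop :=
  ∀ W' : Word g, List.IsRotated W W' → IrreducibleWord g W'

/-- A word is freely reduced if no letter is followed by its inverse. -/
def FreelyReduced (g : ℕ) (W : Word g) : Prop :=
  List.Chain' (fun a c => c ≠ invLetter g a) W

/-- The normal form of a group element: the `≺`-least word representing it. -/
noncomputable def nf (g : ℕ) (x : SurfaceGroup g) : Word g := by
  classical
  exact if h : ∃ W : Word g, eval g W = x ∧ IrreducibleWord g W then h.choose else []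

/-- The word `R = c₁c₂⋯c_{2g}c₁⁻¹c₂⁻¹⋯c_{2g}⁻¹`. -/
def Rword (g : ℕ) : Word g :=
  (List.ofFn fun i : Fin (2*g) => ((i, true) : Letter g)) ++
  (List.ofFn fun i : Fin (2*g) => ((i, false) : Letter g))

/-- `𝓡`: all cyclic permutations of `R` and of `R⁻¹`. -/
def RSet (g : ℕ) : Set (Word g) :=
  {W | List.IsRotated (Rword g) W ∨ List.IsRotated (wordInv g (Rword g)) W}

/-- `seg g b i k` is the word `b_i b_{i+1} ⋯ b_{i+k-1}`. -/
def seg (g : ℕ) (b : ℕ → Letter g) (i k : ℕ) : Word g :=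
  (List.range k).map fun j => b (i + j)

/-- `dseg g b i k` is the descending word `b_i b_{i-1} ⋯ b_{i-k+1}`
(indices taken modulo `4g`, using periodicity of `b`). -/
def dseg (g : ℕ) (b : ℕ → Letter g) (i k : ℕ) : Word g :=
  (List.range k).map fun j => b (i + 4*g - j)

/-- `b : ℕ → Letter g` is a `4g`-periodic (1-based) enumeration of the letters
`b₁, …, b_{4g}` of some word `b₁⋯b_{4g} ∈ 𝓡`. -/
def RelSeq (g : ℕ) (b : ℕ → Letter g) : Prop :=
  (∀ i, b (i + 4*g) = b i) ∧ seg g b 1 (4*g) ∈ RSet g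

/-- The `t`-th power `W^t` of a word. -/
def wpow (g : ℕ) (W : Word g) (t : ℕ) : Word g := (List.replicate t W).flatten

/-- A `k`-fractional relator: an initial segment of length `k` (with `2 ≤ k ≤ 4g`)
of some word in `𝓡`. -/
def IsFR (g : ℕ) (k : ℕ) (W : Word g) : Prop :=
  2 ≤ k ∧ k ≤ 4*g ∧ ∃ B ∈ RSet g, W = B.take k

/-- `IsLLFROcc g k W P F Q` : the factorization `W = P ++ F ++ Q` exhibits `F`
as a `k`-locally longest fractional relator of `W`. -/
def IsLLFROcc (g : ℕ) (k : ℕ) (W P F Q : Word g) : Prop :=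
  W = P ++ F ++ Q ∧ IsFR g k F ∧
  (∀ a, P.getLast? = some a → ¬ IsFR g (k+1) (a :: F)) ∧
  (∀ a, Q.head? = some a → ¬ IsFR g (k+1) (F ++ [a]))

/-- `W` contains a `k`-LLFR. -/
def HasLLFR (g : ℕ) (k : ℕ) (W : Word g) : Prop :=
  ∃ P F Q, IsLLFROcc g k W P F Q

/-- Length-lexicographical order on pairs of words. -/
def pairLt (g : ℕ) (p q : Word g × Word g) : Prop :=
  wordLt g p.1 q.1 ∨ (p.1 = q.1 ∧ wordLt g p.2 q.2)

/-- A candidate for the reducing-subword pair of `(W₁, W₂)`. -/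
def IsRSCand (g : ℕ) (W₁ W₂ C₁ C₂ : Word g) : Prop :=
  ∃ A B C' : Word g, W₁ = A ++ C₁ ∧ W₂ = C₂ ++ B ∧
    nf g (eval g (W₁ ++ W₂)) = A ++ C' ++ B

/-- `(C₁, C₂)` is the reducing-subword pair `rs(W₁, W₂)`: the `≺`-least candidate. -/
def IsRS (g : ℕ) (W₁ W₂ C₁ C₂ : Word g) : Prop :=
  IsRSCand g W₁ W₂ C₁ C₂ ∧
  ∀ D₁ D₂ : Word g, IsRSCand g W₁ W₂ D₁ D₂ →
    (C₁ = D₁ ∧ C₂ = D₂) ∨ pairLt g (C₁, C₂) (D₁, D₂)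

end SG

namespace SG
namespace Aux

section arith
variable {g : ℕ}

/-- The half turn `2g` in `ZMod (4g)`. -/
def H (g : ℕ) : ZMod (4*g) := ((2*g : ℕ) : ZMod (4*g))

theorem four_g : (4:ZMod (4*g)) * (g : ZMod (4*g)) = 0 := by
  have := ZMod.natCast_self (4*g)
  push_cast at this
  exact this

theorem H_eq : H g = 2 * (g : ZMod (4*g)) := by simp [H]

theorem H_add_H : H g + H g = 0 := by
  rw [H_eq]; linear_combination (four_g (g := g))

theorem neg_H : - H g = H g := by
  linear_combination -(H_add_H (g := g))

theorem nz (k : ℤ) (h0 : 0 < k) (h1 : k < 4 * g) : ((k : ℤ) : ZMod (4*g)) ≠ 0 := by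
  intro h
  rw [ZMod.intCast_zmod_eq_zero_iff_dvd] at h
  have := Int.le_of_dvd h0 h
  push_cast at this
  omega

/-- a sign. -/
def Sg (δ : ZMod (4*g)) : Prop := δ = 1 ∨ δ = -1

theorem Sg.neg {δ : ZMod (4*g)} (h : Sg δ) : Sg (-δ) := by
  rcases h with h | h
  · right; rw [h]
  · left; rw [h]; ring

theorem Sg.sq {δ : ZMod (4*g)} (h : Sg δ) : δ * δ = 1 := by
  rcases h with h | h <;> rw [h] <;> ring

theorem Sg.nz {δ : ZMod (4*g)} (h : Sg δ) (k : ℤ) (h0 : 0 < k) (h1 : k < 4 * g) :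
    ((k : ℤ) : ZMod (4*g)) * δ ≠ 0 := by
  intro hh
  apply Aux.nz k h0 h1
  linear_combination δ * hh - (k : ZMod (4*g)) * h.sq

theorem Sg.H {δ : ZMod (4*g)} (h : Sg δ) : H g = 2 * (g : ZMod (4*g)) * δ := by
  rcases h with h | h
  · rw [h, H_eq]; ring
  · rw [h, H_eq]; linear_combination (four_g (g := g))

/-- the two signs -/
theorem Sg.eq_or {δ τ : ZMod (4*g)} (h : Sg δ) (h' : Sg τ) : τ = δ ∨ τ = -δ := by
  rcases h with h | h <;> rcases h' with h' | h' <;> simp [h, h']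

end arith

section omega
variable {g : ℕ}

/-- The height reached on the tile of step `+1`. -/
def pst : List (ZMod (4*g)) → ℕ
  | [] => 0
  | [_] => 1
  | b :: a :: t => if b = a + 1 then pst (a :: t) + 1
      else if b = a + H g + 2 ∧ pst (a :: t) = 2*g then 2 else 1

/-- The height reached on the tile of step `-1`. -/
def mst : List (ZMod (4*g)) → ℕ
  | [] => 0
  | [_] => 1
  | b :: a :: t => if b = a - 1 then mst (a :: t) + 1 else 1

/-- Validity of a (reversed) word. -/
def Valid : List (ZMod (4*g)) → Prop
  | [] => True
  | [_] => True
  | b :: a :: t => Valid (a :: t) ∧ b ≠ a + H g ∧ ¬ (pst (a :: t) = 2*g ∧ b = a + 1) ∧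
      ¬ (mst (a :: t) = 2*g-1 ∧ b = a - 1)

/-- Last letters. -/
def Inl : List (ZMod (4*g)) → ZMod (4*g) → Prop
  | [], _ => False
  | a :: t, y => y = a ∨ (pst (a :: t) = 2*g ∧ y = a + H g + 1)

/-- ascending run -/
def pr (x : ZMod (4*g)) : ℕ → List (ZMod (4*g)) → List (ZMod (4*g))
  | 0, γ => γ
  | n+1, γ => (x + ((n+1 : ℕ) : ZMod (4*g))) :: pr x n γ

/-- descending run -/
def mr (y : ZMod (4*g)) : ℕ → List (ZMod (4*g)) → List (ZMod (4*g))
  | 0, β => β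
  | n+1, β => (y - ((n+1 : ℕ) : ZMod (4*g))) :: mr y n β

inductive Up : List (ZMod (4*g)) → ZMod (4*g) → List (ZMod (4*g)) → Prop
  | tree {β x} : Valid (x :: β) → Up β x (x :: β)
  | cross {β x γ} : Up β x γ → ¬ Inl β (x - 1) →
      Up (mr (x + H g) (2*g-1) β) x (pr x (2*g-1) γ)

theorem up_iff {ω : List (ZMod (4*g))} {x τ} : Up ω x τ ↔ (Valid (x :: ω) ∧ τ = x :: ω) ∨
    ∃ β γ, Up β x γ ∧ ¬ Inl β (x-1) ∧ ω = mr (x + H g) (2*g-1) β ∧ τ = pr x (2*g-1) γ := by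
  constructor
  · intro h
    cases h with
    | tree h => exact Or.inl ⟨h, rfl⟩
    | cross h h' => exact Or.inr ⟨_, _, h, h', rfl, rfl⟩
  · rintro (⟨h, rfl⟩ | ⟨β, γ, h, h', rfl, rfl⟩)
    · exact .tree h
    · exact .cross h h'

theorem Valid.tail {b : ZMod (4*g)} {t} (h : Valid (b :: t)) : Valid t := by
  cases t with
  | nil => trivial
  | cons a t => exact h.1

theorem pr_length (x : ZMod (4*g)) (n) (γ) : (pr x n γ).length = γ.length + n := by
  induction n with
  | zero => simp [pr]
  | succ n ih => simp [pr, ih]; omega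

theorem mr_length (x : ZMod (4*g)) (n) (γ) : (mr x n γ).length = γ.length + n := by
  induction n with
  | zero => simp [mr]
  | succ n ih => simp [mr, ih]; omega

theorem pr_inj (x : ZMod (4*g)) (n) {γ γ'} (h : pr x n γ = pr x n γ') : γ = γ' := by
  induction n with
  | zero => simpa [pr] using h
  | succ n ih => simp [pr] at h; exact ih h

theorem mr_inj (x : ZMod (4*g)) (n) {γ γ'} (h : mr x n γ = mr x n γ') : γ = γ' := by
  induction n with
  | zero => simpa [mr] using h
  | succ n ih => simp [mr] at h; exact ih h

theorem Up.length {β : List (ZMod (4*g))} {x γ} (hg : 2 ≤ g) (h : Up β x γ) :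
    γ.length = β.length + 1 := by
  induction h with
  | tree => simp
  | cross h _ ih => rw [pr_length, mr_length, ih]; omega

/-- shape of a descending run over a list over which the first letter is fresh -/
theorem mr_facts (hg : 2 ≤ g) {y : ZMod (4*g)} {β} (hv : Valid ((y - 1) :: β))
    (hm : mst ((y-1) :: β) = 1) (n : ℕ) (hn : n + 1 ≤ 2*g-1) :
    Valid (mr y (n+1) β) ∧ mst (mr y (n+1) β) = n+1 ∧ (1 ≤ n → pst (mr y (n+1) β) = 1) := by
  induction n with
  | zero => simpa [mr] using ⟨hv, hm⟩
  | succ n ih =>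
    obtain ⟨h1, h2, h3⟩ := ih (by omega)
    have e : y - ((n+1+1 : ℕ) : ZMod (4*g)) = y - ((n+1 : ℕ) : ZMod (4*g)) - 1 := by
      push_cast; ring
    have hH := H_eq (g := g)
    set a := y - ((n+1 : ℕ) : ZMod (4*g)) with ha
    have e2 : mr y (n+1+1) β = (a - 1) :: a :: mr y n β := by
      rw [ha, ← e]; rfl
    have e3 : mr y (n+1) β = a :: mr y n β := rfl
    rw [e3] at h1 h2 h3
    rw [e2]
    refine ⟨⟨h1, ?_, ?_, ?_⟩, ?_, ?_⟩
    · intro h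
      refine nz (g := g) (2*g+1) (by omega) (by omega) ?_
      push_cast; linear_combination -h - hH
    · rintro ⟨-, h⟩
      refine nz (g := g) 2 (by omega) (by omega) ?_
      push_cast; linear_combination -h
    · rintro ⟨h, -⟩
      omega
    · simp [mst, h2]
    · intro _
      rw [pst, if_neg, if_neg]
      · rintro ⟨h, -⟩
        refine nz (g := g) (2*g+3) (by omega) (by omega) ?_
        push_cast; linear_combination -h - hH
      · intro h
        refine nz (g := g) 2 (by omega) (by omega) ?_
        push_cast; linear_combination -h

/-- level data of the top of an edge at the bottom of a tile -/
def Pl (γ : List (ZMod (4*g))) (x : ZMod (4*g)) : Prop :=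
  (∃ t, γ = x :: t ∧ pst γ = 1) ∨ (∃ t, γ = (x + H g - 1) :: t ∧ pst γ = 2*g)

theorem pr_facts (hg : 2 ≤ g) {x : ZMod (4*g)} {γ} (hv : Valid γ) (hp : Pl γ x)
    (n : ℕ) (hn : n + 1 ≤ 2*g-1) :
    Valid (pr x (n+1) γ) ∧ pst (pr x (n+1) γ) = n+2 := by
  have hH := H_eq (g := g)
  have h4 := four_g (g := g)
  induction n with
  | zero =>
    have e : pr x (0+1) γ = (x+1) :: γ := by simp [pr]
    rw [e]
    rcases hp with ⟨t, rfl, h⟩ | ⟨t, rfl, h⟩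
    · refine ⟨⟨hv, ?_, ?_, ?_⟩, ?_⟩
      · intro h
        refine nz (g := g) (2*g-1) (by omega) (by omega) ?_
        push_cast; linear_combination -h - hH
      · omega
      · rintro ⟨-, h⟩
        refine nz (g := g) 2 (by omega) (by omega) ?_
        push_cast; linear_combination h
      · simp [pst, h]
    · refine ⟨⟨hv, ?_, ?_, ?_⟩, ?_⟩
      · intro h
        refine nz (g := g) 2 (by omega) (by omega) ?_
        push_cast; linear_combination h + 2 * hH + h4
      · rintro ⟨-, h⟩
        refine nz (g := g) (2*g-1) (by omega) (by omega) ?_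
        push_cast; linear_combination -h - hH
      · rintro ⟨-, h⟩
        refine nz (g := g) (2*g-3) (by omega) (by omega) ?_
        push_cast; linear_combination -h - hH
      · rw [pst, if_neg, if_pos]
        · exact ⟨by linear_combination -2*hH - h4, h⟩
        · intro h
          refine nz (g := g) (2*g-1) (by omega) (by omega) ?_
          push_cast; linear_combination -h - hH
  | succ n ih =>
    obtain ⟨h1, h2⟩ := ih (by omega)
    have e : x + ((n+1+1 : ℕ) : ZMod (4*g)) = x + ((n+1 : ℕ) : ZMod (4*g)) + 1 := by
      push_cast; ring
    set a := x + ((n+1 : ℕ) : ZMod (4*g)) with ha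
    have e2 : pr x (n+1+1) γ = (a + 1) :: a :: pr x n γ := by
      rw [ha, ← e]; rfl
    have e3 : pr x (n+1) γ = a :: pr x n γ := rfl
    rw [e3] at h1 h2
    rw [e2]
    refine ⟨⟨h1, ?_, ?_, ?_⟩, ?_⟩
    · intro h
      refine nz (g := g) (2*g-1) (by omega) (by omega) ?_
      push_cast; linear_combination -h - hH
    · omega
    · rintro ⟨-, h⟩
      refine nz (g := g) 2 (by omega) (by omega) ?_
      push_cast; linear_combination h
    · simp [pst, h2]

theorem mr_head (y : ZMod (4*g)) (n : ℕ) (β) :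
    mr y (n+1) β = (y - ((n+1:ℕ):ZMod (4*g))) :: mr y n β := rfl

theorem pr_head (y : ZMod (4*g)) (n : ℕ) (β) :
    pr y (n+1) β = (y + ((n+1:ℕ):ZMod (4*g))) :: pr y n β := rfl

theorem cast_2g1 (hg : 2 ≤ g) : ((2*g-2+1 : ℕ) : ZMod (4*g)) = H g - 1 := by
  have : 2*g-2+1+1 = 2*g := by omega
  have h2 : ((2*g-2+1+1 : ℕ) : ZMod (4*g)) = H g := by rw [this]; rfl
  push_cast at h2 ⊢
  linear_combination h2

theorem mr_full (hg : 2 ≤ g) (x : ZMod (4*g)) (β) :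
    mr (x + H g) (2*g-1) β = (x + 1) :: mr (x + H g) (2*g-2) β := by
  have : 2*g-1 = 2*g-2+1 := by omega
  rw [this, mr_head, cast_2g1 hg]
  congr 1; ring

theorem pr_full (hg : 2 ≤ g) (x : ZMod (4*g)) (β) :
    pr x (2*g-1) β = (x + H g - 1) :: pr x (2*g-2) β := by
  have : 2*g-1 = 2*g-2+1 := by omega
  rw [this, pr_head, cast_2g1 hg]
  congr 1; ring

theorem fresh (hg : 2 ≤ g) {β : List (ZMod (4*g))} {x} (hv : Valid β)
    (h1 : ¬ Inl β (x-1)) (h2 : ¬ Inl β (x + H g)) :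
    Valid ((x + H g - 1) :: β) ∧ mst ((x + H g - 1) :: β) = 1 := by
  have hHH := H_add_H (g := g)
  cases β with
  | nil => simp [Valid, mst]
  | cons a t =>
    simp only [Inl, not_or] at h1 h2
    refine ⟨⟨hv, ?_, ?_, ?_⟩, ?_⟩
    · intro h; apply h1.1; linear_combination h
    · rintro ⟨h, h'⟩; apply h1.2; refine ⟨h, ?_⟩; linear_combination h' - hHH
    · rintro ⟨h, h'⟩; apply h2.1; linear_combination h'
    · rw [mst, if_neg]
      intro h'; apply h2.1; linear_combination h'

theorem up_main (hg : 2 ≤ g) {β : List (ZMod (4*g))} {x γ} (h : Up β x γ) :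
    Valid β ∧ Valid γ ∧ Inl γ x ∧ ¬ Inl β (x + H g) ∧ (¬ Inl β (x-1) → Pl γ x) := by
  have hHH := H_add_H (g := g)
  have hH := H_eq (g := g)
  induction h with
  | @tree β x h =>
    refine ⟨h.tail, h, Or.inl rfl, ?_, ?_⟩
    · cases β with
      | nil => simp [Inl]
      | cons a t =>
        rintro (h' | ⟨h', h''⟩)
        · apply h.2.1; linear_combination h' - hHH
        · apply h.2.2.1; refine ⟨h', ?_⟩; linear_combination h''
    · intro hn
      refine Or.inl ⟨_, rfl, ?_⟩
      cases β with
      | nil => simp [pst]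
      | cons a t =>
        simp only [Inl, not_or] at hn
        rw [pst, if_neg, if_neg]
        · rintro ⟨h', h''⟩; apply hn.2; refine ⟨h'', ?_⟩; linear_combination h'
        · intro h'; apply hn.1; linear_combination h'
  | @cross β x γ h hn ih =>
    obtain ⟨v1, v2, i1, i2, p⟩ := ih
    obtain ⟨f1, f2⟩ := fresh hg v1 hn i2
    have hm := mr_facts hg f1 f2 (2*g-2) (by omega)
    have hp := pr_facts hg v2 (p hn) (2*g-2) (by omega)
    have e : 2*g-2+1 = 2*g-1 := by omega
    rw [e] at hm hp
    have ep : 2*g-2+2 = 2*g := by omega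
    rw [ep] at hp
    refine ⟨hm.1, hp.1, ?_, ?_, ?_⟩
    · have hp2 := hp.2
      rw [pr_full hg] at hp2 ⊢
      exact Or.inr ⟨hp2, by linear_combination -hHH⟩
    · have hm2 := hm.2.2 (by omega)
      rw [mr_full hg] at hm2 ⊢
      rintro (h' | ⟨h', h''⟩)
      · refine nz (g := g) (2*g-1) (by omega) (by omega) ?_
        push_cast; linear_combination h' - hH
      · omega
    · intro _
      have hp2 := hp.2
      rw [pr_full hg] at hp2 ⊢
      exact Or.inr ⟨_, rfl, hp2⟩

theorem cross_ne (hg : 2 ≤ g) {β : List (ZMod (4*g))} {x γ} (h : Up β x γ) (hn : ¬ Inl β (x-1)) :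
    ¬ Valid (x :: mr (x + H g) (2*g-1) β) ∧ ¬ Inl (mr (x + H g) (2*g-1) β) (x - 1) := by
  obtain ⟨v1, v2, i1, i2, p⟩ := up_main hg h
  obtain ⟨f1, f2⟩ := fresh hg v1 hn i2
  have hm := mr_facts hg f1 f2 (2*g-2) (by omega)
  have e : 2*g-2+1 = 2*g-1 := by omega
  rw [e] at hm
  rw [mr_full hg] at hm ⊢
  constructor
  · intro h'
    exact h'.2.2.2 ⟨hm.2.1, by ring⟩
  · rintro (h' | ⟨h', h''⟩)
    · refine nz (g := g) 2 (by omega) (by omega) ?_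
      push_cast; linear_combination -h'
    · have := hm.2.2 (by omega); omega

theorem up_fun (hg : 2 ≤ g) {ω : List (ZMod (4*g))} {x τ τ'} (h : Up ω x τ) (h' : Up ω x τ') :
    τ = τ' := by
  induction h generalizing τ' with
  | tree hv =>
    rcases up_iff.1 h' with ⟨-, h'⟩ | ⟨β, γ, h1, h2, rfl, rfl⟩
    · exact h'.symm
    · exact absurd hv (cross_ne hg h1 h2).1
  | cross hu hn ih =>
    rcases up_iff.1 h' with ⟨h', -⟩ | ⟨β, γ, h1, h2, e, rfl⟩
    · exact absurd h' (cross_ne hg hu hn).1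
    · have := mr_inj _ _ e
      subst this
      rw [ih h1]

theorem up_cofun (hg : 2 ≤ g) {ω ω' : List (ZMod (4*g))} {x τ} (h : Up ω x τ) (h' : Up ω' x τ) :
    ω = ω' := by
  have hH := H_eq (g := g)
  have key : ∀ l l' : List (ZMod (4*g)), x :: l ≠ pr x (2*g-1) l' := by
    intro l l' h
    rw [pr_full hg] at h
    have := (List.cons.inj h).1
    refine nz (g := g) (2*g-1) (by omega) (by omega) ?_
    push_cast; linear_combination -this - hH
  induction h generalizing ω' with
  | tree hv =>
    rcases up_iff.1 h' with ⟨-, h'⟩ | ⟨β, γ, h1, h2, rfl, e⟩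
    · exact (List.cons.inj h').2
    · exact absurd e (key _ _)
  | cross hu hn ih =>
    rcases up_iff.1 h' with ⟨-, h'⟩ | ⟨β, γ, h1, h2, rfl, e⟩
    · exact absurd h'.symm (key _ _)
    · have := pr_inj _ _ e
      subst this
      rw [ih h1 key]

theorem mst_shape (ω : List (ZMod (4*g))) (a t) (h : ω = a :: t) (hv : Valid ω) :
    ∃ (k : ℕ) (β : _), mst ω = k + 1 ∧ ω = mr (a + ((k+1:ℕ) : ZMod (4*g))) (k+1) β ∧
      Valid (((a + (k : ℕ)) : ZMod (4*g)) :: β) ∧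
      ∀ a0 t0, β = a0 :: t0 → a + (k : ℕ) ≠ a0 - 1 := by
  induction ω generalizing a t with
  | nil => simp at h
  | cons b s ih =>
    obtain ⟨rfl, rfl⟩ := List.cons.inj h
    cases s with
    | nil => exact ⟨0, [], by simp [mst], by simp [mr], by simpa using hv, by simp⟩
    | cons c s =>
      by_cases hb : b = c - 1
      · obtain ⟨k, β, h1, h2, h3, h4⟩ := ih c s rfl hv.1
        refine ⟨k+1, β, ?_, ?_, ?_, ?_⟩
        · simp [mst, hb, h1]
        · rw [h2, hb, mr_head _ (k+1)]
          have : c - 1 + ((k + 1 + 1 : ℕ) : ZMod (4*g)) = c + ((k+1 : ℕ) : ZMod (4*g)) := by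
            push_cast; ring
          rw [this]
          congr 1
          push_cast; ring
        · convert h3 using 2
          rw [hb]; push_cast; ring
        · intro a0 t0 h
          have := h4 a0 t0 h
          convert this using 1
          rw [hb]; push_cast; ring
      · refine ⟨0, c :: s, by simp [mst, hb], by simp [mr], by simpa using hv, ?_⟩
        intro a0 t0 h
        obtain ⟨rfl, rfl⟩ := List.cons.inj h
        simpa using hb

theorem pst_shape (ω : List (ZMod (4*g))) (a t) (h : ω = a :: t) (hv : Valid ω) :
    ∃ (k : ℕ) (γ : List (ZMod (4*g))) (x : ZMod (4*g)), pst ω = k + 1 ∧ x + (k:ℕ) = a ∧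
      ω = pr x k γ ∧ Valid γ ∧
      ((∃ β, γ = x :: β ∧ pst γ = 1) ∨ (1 ≤ k ∧ ∃ a0 t0, γ = a0 :: t0 ∧ pst γ = 2*g ∧
        x = a0 + H g + 1)) := by
  induction ω generalizing a t with
  | nil => simp at h
  | cons b s ih =>
    obtain ⟨rfl, rfl⟩ := List.cons.inj h
    cases s with
    | nil => exact ⟨0, [b], b, by simp [pst], by simp, by simp [pr], hv, Or.inl ⟨[], rfl, by simp [pst]⟩⟩
    | cons c s =>
      by_cases hb : b = c + 1
      · obtain ⟨k, γ, x, h1, h2, h3, h3', h4⟩ := ih c s rfl hv.1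
        refine ⟨k+1, γ, x, ?_, ?_, ?_, h3', ?_⟩
        · simp [pst, hb, h1]
        · rw [hb, ← h2]; push_cast; ring
        · rw [h3, hb, pr_head, ← h2]
          congr 1
          push_cast; ring
        · rcases h4 with h | ⟨_, h⟩
          · exact Or.inl h
          · exact Or.inr ⟨by omega, h⟩
      · by_cases hb2 : b = c + H g + 2 ∧ pst (c :: s) = 2*g
        · refine ⟨1, c :: s, b - 1, ?_, by simp, by simp [pr], hv.1, Or.inr ⟨le_rfl, c, s, rfl, hb2.2, ?_⟩⟩
          · rw [pst, if_neg hb, if_pos hb2]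
          · rw [hb2.1]; ring
        · have hp : pst (b :: c :: s) = 1 := by rw [pst, if_neg hb, if_neg hb2]
          exact ⟨0, b :: c :: s, b, hp, by simp, by simp [pr], hv, Or.inl ⟨_, rfl, hp⟩⟩

theorem up_total (hg : 2 ≤ g) (ω : List (ZMod (4*g))) (c) (hv : Valid ω)
    (hc : ¬ Inl ω (c + H g)) : ∃ τ, Up ω c τ := by
  have hHH := H_add_H (g := g)
  have hH := H_eq (g := g)
  induction hn : ω.length using Nat.strong_induction_on generalizing ω with
  | _ n ih =>
  by_cases hv' : Valid (c :: ω)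
  · exact ⟨_, .tree hv'⟩
  cases ω with
  | nil => simp [Valid] at hv'
  | cons a t =>
    simp only [Inl, not_or, not_and] at hc
    have key : mst (a :: t) = 2*g-1 ∧ c = a - 1 := by
      by_contra hcon
      apply hv'
      refine ⟨hv, ?_, ?_, hcon⟩
      · intro h; apply hc.1; rw [h]; linear_combination hHH
      · rintro ⟨h, h'⟩; apply hc.2 h; rw [h']; ring
    obtain ⟨k, β, h1, h2, h3, h4⟩ := mst_shape _ a t rfl hv
    have hk : k + 1 = 2*g-1 := by omega
    have hkc : ((k:ℕ) : ZMod (4*g)) = H g - 2 := by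
      have : ((k + 2 : ℕ) : ZMod (4*g)) = H g := by
        have : k + 2 = 2*g := by omega
        rw [this]; rfl
      push_cast at this
      linear_combination this
    have e : a + ((k+1:ℕ) : ZMod (4*g)) = c + H g := by
      rw [key.2]; push_cast; linear_combination hkc
    have e' : a + ((k:ℕ) : ZMod (4*g)) = c + H g - 1 := by
      rw [key.2]; linear_combination hkc
    rw [e, hk] at h2
    rw [e'] at h3 h4
    have n1 : ¬ Inl β (c - 1) := by
      cases β with
      | nil => simp [Inl]
      | cons a0 t0 =>
        rintro (h | ⟨h, h'⟩)
        · apply h3.2.1; linear_combination h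
        · apply h3.2.2.1; refine ⟨h, ?_⟩; linear_combination h' + hHH
    have n2 : ¬ Inl β (c + H g) := by
      cases β with
      | nil => simp [Inl]
      | cons a0 t0 =>
        rintro (h | ⟨h, h'⟩)
        · apply h4 a0 t0 rfl; rw [h]
        · apply h3.2.1; linear_combination h'
    have hl := mr_length (c + H g) (2*g-1) β
    rw [← h2] at hl
    obtain ⟨γ, hγ⟩ := ih β.length (by omega) β h3.tail n2 rfl
    rw [h2]
    exact ⟨_, .cross hγ n1⟩

theorem down_total (hg : 2 ≤ g) (τ : List (ZMod (4*g))) (c) (hv : Valid τ)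
    (hc : Inl τ c) : ∃ ω, Up ω c τ := by
  have hHH := H_add_H (g := g)
  have hH := H_eq (g := g)
  induction hn : τ.length using Nat.strong_induction_on generalizing τ with
  | _ n ih =>
  cases τ with
  | nil => simp [Inl] at hc
  | cons a t =>
    rcases hc with rfl | ⟨hp, hca⟩
    · exact ⟨t, .tree hv⟩
    obtain ⟨k, γ, x, h1, h2, h3, h3', h4⟩ := pst_shape _ a t rfl hv
    have hk : k = 2*g-1 := by omega
    have hkc : ((k:ℕ) : ZMod (4*g)) = H g - 1 := by
      have : ((k + 1 : ℕ) : ZMod (4*g)) = H g := by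
        have : k + 1 = 2*g := by omega
        rw [this]; rfl
      push_cast at this
      linear_combination this
    have hx : x = c := by rw [hca, ← h2, hkc]; linear_combination -hHH
    subst hx
    have hl := pr_length x k γ
    rw [← h3] at hl
    rw [h3]
    subst hk
    rcases h4 with ⟨β, rfl, h5⟩ | ⟨_, a0, t0, rfl, h5, h6⟩
    · refine ⟨_, .cross (.tree h3') ?_⟩
      cases β with
      | nil => simp [Inl]
      | cons a0 t0 =>
        rintro (h | ⟨h, h'⟩)
        · rw [pst, if_pos (by linear_combination h)] at h5
          obtain ⟨k, _, _, h1, _⟩ := pst_shape _ a0 t0 rfl h3'.tail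
          omega
        · rw [pst] at h5
          split_ifs at h5 with h6 h7
          · omega
          · omega
          · exact h7 ⟨by linear_combination h', h⟩
    · obtain ⟨β, hβ⟩ := ih (a0 :: t0).length (by omega) (a0 :: t0) h3' (Or.inr ⟨h5, h6⟩) rfl
      refine ⟨_, .cross hβ ?_⟩
      rcases up_iff.1 hβ with ⟨-, e⟩ | ⟨β', γ', h7, h8, rfl, -⟩
      · have := (List.cons.inj e).1
        exfalso
        refine nz (g := g) (2*g+1) (by omega) (by omega) ?_
        push_cast; linear_combination -this - hH - h6
      · exact (cross_ne hg h7 h8).2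

end omega
end Aux
end SG

namespace SG
namespace Aux

section runs
variable {g : ℕ}

/-- The run `x, x+τ, …` with `n` letters. -/
def rs (τ : ZMod (4*g)) : ZMod (4*g) → ℕ → List (ZMod (4*g))
  | _, 0 => []
  | x, n+1 => x :: rs τ (x + τ) n

theorem rs_length (τ x : ZMod (4*g)) (n : ℕ) : (rs τ x n).length = n := by
  induction n generalizing x with
  | zero => rfl
  | succ n ih => simp [rs, ih]

theorem rs_add (τ x : ZMod (4*g)) (m n : ℕ) :
    rs τ x (m + n) = rs τ x m ++ rs τ (x + (m : ℕ) * τ) n := by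
  induction m generalizing x with
  | zero => simp [rs]
  | succ m ih =>
    have : m + 1 + n = (m + n) + 1 := by omega
    rw [this, rs, ih, rs, List.cons_append]
    congr 3
    push_cast; ring

theorem rs_split (τ x : ZMod (4*g)) {k : ℕ} (m n : ℕ) (h : k = m + n) :
    rs τ x k = rs τ x m ++ rs τ (x + (m : ℕ) * τ) n := by rw [h, rs_add]

theorem rs_succ (τ x : ZMod (4*g)) (n : ℕ) :
    rs τ x (n + 1) = rs τ x n ++ [x + (n : ℕ) * τ] := by
  rw [rs_add]; rfl

theorem rs_reverse (τ x : ZMod (4*g)) (n : ℕ) :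
    (rs τ x (n+1)).reverse = rs (-τ) (x + (n : ℕ) * τ) (n+1) := by
  induction n generalizing x with
  | zero => simp [rs]
  | succ n ih =>
    rw [rs, List.reverse_cons, ih, rs_succ (-τ) _ (n+1)]
    have e : x + τ + (n:ℕ) * τ = x + ((n+1 : ℕ)) * τ := by push_cast; ring
    rw [e]
    congr 2
    push_cast; ring

theorem rs_full (τ x : ZMod (4*g)) : x + ((4*g : ℕ) : ZMod (4*g)) * τ = x := by
  rw [ZMod.natCast_self]; ring

theorem reverse_mr (y : ZMod (4*g)) (n : ℕ) (β) :
    (mr y n β).reverse = β.reverse ++ rs (-1) (y - 1) n := by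
  induction n with
  | zero => simp [mr, rs]
  | succ n ih =>
    rw [mr, List.reverse_cons, ih, rs_succ, List.append_assoc]
    congr 3
    push_cast; ring

theorem reverse_pr (y : ZMod (4*g)) (n : ℕ) (β) :
    (pr y n β).reverse = β.reverse ++ rs 1 (y + 1) n := by
  induction n with
  | zero => simp [pr, rs]
  | succ n ih =>
    rw [pr, List.reverse_cons, ih, rs_succ, List.append_assoc]
    congr 3
    push_cast; ring

theorem ofFn_eq {α : Type*} (f : ZMod (4*g) → α) (x : ZMod (4*g)) (n : ℕ) :
    List.ofFn (fun i : Fin n => f (x + ((i : ℕ) : ZMod (4*g)))) = (rs 1 x n).map f := by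
  induction n generalizing x with
  | zero => simp [rs]
  | succ n ih =>
    rw [List.ofFn_succ, rs, List.map_cons, ← ih]
    simp only [Fin.val_zero, Nat.cast_zero, add_zero, Fin.val_succ]
    congr 2
    funext i
    congr 1
    push_cast; ring

end runs

section action
variable {g : ℕ}

/-- valid words -/
abbrev Om (g : ℕ) := {l : List (ZMod (4*g)) // Valid l}

/-- neighbours -/
def nb (c : ZMod (4*g)) (ω ω' : List (ZMod (4*g))) : Prop := Up ω c ω' ∨ Up ω' (c + H g) ω

theorem nb_ex (hg : 2 ≤ g) (c : ZMod (4*g)) (ω : Om g) : ∃ ω' : Om g, nb c ω.1 ω'.1 := by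
  by_cases h : Inl ω.1 (c + H g)
  · obtain ⟨τ, ht⟩ := down_total hg ω.1 _ ω.2 h
    exact ⟨⟨τ, (up_main hg ht).1⟩, Or.inr ht⟩
  · obtain ⟨τ, ht⟩ := up_total hg ω.1 _ ω.2 h
    exact ⟨⟨τ, (up_main hg ht).2.1⟩, Or.inl ht⟩

theorem nb_un (hg : 2 ≤ g) {c : ZMod (4*g)} {ω τ τ' : List (ZMod (4*g))}
    (h : nb c ω τ) (h' : nb c ω τ') : τ = τ' := by
  rcases h with h | h <;> rcases h' with h' | h'
  · exact up_fun hg h h'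
  · exact absurd (up_main hg h').2.2.1 (up_main hg h).2.2.2.1
  · exact absurd (up_main hg h).2.2.1 (up_main hg h').2.2.2.1
  · exact up_cofun hg h h'

theorem addHH (c : ZMod (4*g)) : c + H g + H g = c := by
  linear_combination H_add_H (g := g)

theorem nb_symm {c : ZMod (4*g)} {ω τ : List (ZMod (4*g))}
    (h : nb c ω τ) : nb (c + H g) τ ω := by
  unfold nb
  rw [addHH]
  exact Or.symm h

/-- the action of a letter -/
noncomputable def act (hg : 2 ≤ g) (c : ZMod (4*g)) (ω : Om g) : Om g := (nb_ex hg c ω).choose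

theorem act_spec (hg : 2 ≤ g) (c : ZMod (4*g)) (ω : Om g) : nb c ω.1 (act hg c ω).1 :=
  (nb_ex hg c ω).choose_spec

theorem act_eq (hg : 2 ≤ g) {c : ZMod (4*g)} {ω ω' : Om g} (h : nb c ω.1 ω'.1) :
    act hg c ω = ω' := Subtype.ext (nb_un hg (act_spec hg c ω) h)

theorem act_inv (hg : 2 ≤ g) (c : ZMod (4*g)) (ω : Om g) :
    act hg (c + H g) (act hg c ω) = ω := act_eq hg (nb_symm (act_spec hg c ω))

theorem act_inv' (hg : 2 ≤ g) (c : ZMod (4*g)) (ω : Om g) :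
    act hg c (act hg (c + H g) ω) = ω := by
  have := act_inv hg (c + H g) ω
  rwa [addHH] at this

/-- the permutation -/
noncomputable def actP (hg : 2 ≤ g) (c : ZMod (4*g)) : Equiv.Perm (Om g) where
  toFun := act hg c
  invFun := act hg (c + H g)
  left_inv := act_inv hg c
  right_inv := act_inv' hg c

/-- the path from a vertex -/
noncomputable def path (hg : 2 ≤ g) (L : List (ZMod (4*g))) (ω : Om g) : Om g :=
  L.foldl (fun w c => act hg c w) ω

theorem path_append (hg : 2 ≤ g) (L L' : List (ZMod (4*g))) (ω : Om g) :
    path hg (L ++ L') ω = path hg L' (path hg L ω) := by simp [path]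

theorem path_cons (hg : 2 ≤ g) (c) (L' : List (ZMod (4*g))) (ω : Om g) :
    path hg (c :: L') ω = path hg L' (act hg c ω) := by simp [path]

theorem path_nil (hg : 2 ≤ g) (ω : Om g) : path hg [] ω = ω := rfl

theorem tree_nb {b : ZMod (4*g)} {t : List (ZMod (4*g))} (h : Valid (b :: t)) : nb b t (b :: t) :=
  Or.inl (.tree h)

theorem path_pr (hg : 2 ≤ g) {x : ZMod (4*g)} {γ : List (ZMod (4*g))} (hv : Valid γ) (hp : Pl γ x)
    (n : ℕ) (hn : n ≤ 2*g-1) (ρ : Om g) (hρ : ρ.1 = pr x n γ) :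
    path hg (rs 1 (x+1) n) ⟨γ, hv⟩ = ρ := by
  induction n generalizing ρ with
  | zero => exact Subtype.ext hρ.symm
  | succ n ih =>
    have hv1 := (pr_facts hg hv hp n (by omega)).1
    have hv2 : Valid (pr x n γ) := by rw [pr_head] at hv1; exact hv1.tail
    rw [rs_succ, path_append, ih (by omega) ⟨_, hv2⟩ rfl, path_cons, path_nil]
    apply act_eq
    rw [hρ, pr_head]
    have : x + 1 + (n:ℕ) * 1 = x + ((n+1:ℕ) : ZMod (4*g)) := by push_cast; ring
    rw [this]
    exact tree_nb hv1

theorem path_mr (hg : 2 ≤ g) {x : ZMod (4*g)} {β : List (ZMod (4*g))} (hv : Valid β)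
    (hf : Valid ((x + H g - 1) :: β) ∧ mst ((x + H g - 1) :: β) = 1)
    (n : ℕ) (hn : n ≤ 2*g-1) (ρ : Om g) (hρ : ρ.1 = mr (x + H g) n β) :
    path hg (rs 1 (x-(n:ℕ)) n) ρ = ⟨β, hv⟩ := by
  induction n generalizing ρ with
  | zero => exact Subtype.ext hρ
  | succ n ih =>
    have hv1 := (mr_facts hg hf.1 hf.2 n (by omega)).1
    have hv2 : Valid (mr (x + H g) n β) := by rw [mr_head] at hv1; exact hv1.tail
    rw [rs, path_cons]
    have e : x - ((n+1:ℕ):ZMod (4*g)) + 1 = x - (n:ℕ) := by push_cast; ring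
    rw [e]
    apply ih (by omega)
    have : act hg (x - ((n+1:ℕ):ZMod (4*g))) ρ = ⟨_, hv2⟩ := by
      apply act_eq
      right
      rw [hρ, mr_head]
      rw [mr_head] at hv1
      have : x - ((n+1:ℕ):ZMod (4*g)) + H g = x + H g - ((n+1:ℕ):ZMod (4*g)) := by ring
      rw [this]
      exact .tree hv1
    rw [this]

theorem loop (hg : 2 ≤ g) (n : ℕ) : ∀ (ω : Om g) (_ : ω.1.length = n) (x : ZMod (4*g)),
    path hg (rs 1 x (4*g)) ω = ω := by
  induction n using Nat.strong_induction_on with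
  | _ n ih =>
  intro ω hn x
  have hHH := H_add_H (g := g)
  by_cases h1 : Inl ω.1 (x - 1)
  · obtain ⟨β, hβ⟩ := down_total hg ω.1 _ ω.2 h1
    have hl := hβ.length hg
    have hu := up_main hg hβ
    have := ih β.length (by omega) ⟨β, hu.1⟩ rfl (x-1)
    have e1 : rs 1 (x-1) (4*g+1) = (x-1) :: rs 1 x (4*g) := by rw [rs]; congr 2; ring
    rw [rs_succ, rs_full] at e1
    have e2 := congrArg (fun L => path hg L ⟨β, hu.1⟩) e1
    simp only [path_append, path_cons, path_nil, this] at e2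
    have e3 : act hg (x-1) ⟨β, hu.1⟩ = ω := act_eq hg (Or.inl hβ)
    rw [e3] at e2
    exact e2.symm
  by_cases h2 : Inl ω.1 (x + H g)
  · obtain ⟨β, hβ⟩ := down_total hg ω.1 _ ω.2 h2
    have hl := hβ.length hg
    have hu := up_main hg hβ
    have := ih β.length (by omega) ⟨β, hu.1⟩ rfl (x+1)
    have e1 : rs 1 x (4*g+1) = x :: rs 1 (x+1) (4*g) := by rw [rs]
    rw [rs_succ, rs_full] at e1
    have e2 := congrArg (fun L => path hg L ω) e1
    have e3 : act hg x ω = ⟨β, hu.1⟩ := act_eq hg (Or.inr hβ)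
    simp only [path_append, path_cons, path_nil] at e2
    rw [e3, this, ← e3] at e2
    exact (actP hg x).injective e2
  obtain ⟨γ, hγ⟩ := up_total hg ω.1 x ω.2 h2
  obtain ⟨-, v2, -, -, p⟩ := up_main hg hγ
  have hcr := Up.cross hγ h1
  obtain ⟨c1, c2, -⟩ := up_main hg hcr
  have hf := fresh hg ω.2 h1 h2
  have e1 : 1 + (2*g-1) = 2*g := by omega
  rw [rs_split _ _ (2*g) (2*g) (by omega), rs_split _ x 1 (2*g-1) (by omega),
    rs_split _ (x + ((2*g:ℕ):ZMod (4*g)) * 1) 1 (2*g-1) (by omega)]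
  simp only [path_append, rs, path_cons, path_nil]
  have a1 : act hg x ω = ⟨γ, v2⟩ := act_eq hg (Or.inl hγ)
  have a2 := path_pr hg v2 (p h1) (2*g-1) le_rfl ⟨_, c2⟩ rfl
  have a3 : act hg (x + H g) ⟨_, c2⟩ = ⟨_, c1⟩ := act_eq hg (nb_symm (Or.inl hcr))
  have a4 := path_mr hg ω.2 hf (2*g-1) le_rfl ⟨_, c1⟩ rfl
  have e2 : x + ((1:ℕ):ZMod (4*g)) * 1 = x + 1 := by push_cast; ring
  have e3 : x + ((2*g:ℕ):ZMod (4*g)) * 1 = x + H g := by rw [H]; ring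
  have e4 : x + H g + ((1:ℕ):ZMod (4*g)) * 1 = x - ((2*g-1:ℕ):ZMod (4*g)) := by
    have : ((1+(2*g-1) : ℕ):ZMod (4*g)) = H g := by rw [e1]; rfl
    rw [Nat.cast_add] at this
    push_cast at this ⊢
    linear_combination this + hHH
  rw [e2, e3, e4, a1, a2, a3, a4]


/-- The homomorphism image of a letter. -/
noncomputable def opA (hg : 2 ≤ g) (c : ZMod (4*g)) : (Equiv.Perm (Om g))ᵐᵒᵖ :=
  MulOpposite.op (actP hg c)

theorem opA_inv (hg : 2 ≤ g) (c : ZMod (4*g)) : (opA hg c)⁻¹ = opA hg (c + H g) := by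
  unfold opA
  rw [← MulOpposite.op_inv]
  congr 1
  ext1 ω
  rfl

theorem opA_path (hg : 2 ≤ g) (L : List (ZMod (4*g))) (ω : Om g) :
    (L.map (opA hg)).prod.unop ω = path hg L ω := by
  induction L generalizing ω with
  | nil => rfl
  | cons c L ih =>
    rw [path_cons, ← ih]
    rfl

theorem rel_path (hg : 2 ≤ g) (x : ZMod (4*g)) : ((rs 1 x (4*g)).map (opA hg)).prod = 1 := by
  apply MulOpposite.unop_injective
  ext1 ω
  rw [opA_path, loop hg _ ω rfl]
  rfl

theorem relator_one (hg : 2 ≤ g) :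
    ∀ r ∈ ({relator g} : Set (FreeGroup (Fin (2*g)))),
      FreeGroup.lift (fun i : Fin (2*g) => opA hg ((i : ℕ) : ZMod (4*g))) r = 1 := by
  intro r hr
  rw [Set.mem_singleton_iff.1 hr, relator]
  have h := rel_path hg 0
  rw [rs_split _ _ (2*g) (2*g) (by omega), List.map_append, List.prod_append,
    ← ofFn_eq, ← ofFn_eq] at h
  rw [map_mul, map_list_prod, map_list_prod, List.map_ofFn, List.map_ofFn]
  rw [← h]
  congr 3
  · funext i; simp
  · funext i
    simp only [Function.comp, map_inv, FreeGroup.lift_apply_of, opA_inv]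
    congr 1
    rw [H]; ring

/-- The representation on `Om`. -/
noncomputable def Phi (hg : 2 ≤ g) : SurfaceGroup g →* (Equiv.Perm (Om g))ᵐᵒᵖ :=
  PresentedGroup.toGroup (relator_one hg)

theorem Phi_gen (hg : 2 ≤ g) (i : Fin (2*g)) : Phi hg (gen g i) = opA hg ((i : ℕ) : ZMod (4*g)) := by
  simp [Phi, gen]

/-- The label of a letter. -/
def lab (a : Letter g) : ZMod (4*g) := if a.2 then ((a.1 : ℕ) : ZMod (4*g)) else ((a.1 : ℕ) : ZMod (4*g)) + H g

theorem lab_val (a : Letter g) : (lab a).val = if a.2 then (a.1 : ℕ) else (a.1 : ℕ) + 2*g := by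
  obtain ⟨i, b⟩ := a
  have := i.2
  cases b
  · simp only [lab, H]
    rw [if_neg (by simp), if_neg (by simp), ← Nat.cast_add, ZMod.val_natCast, Nat.mod_eq_of_lt (by omega)]
  · simp only [lab]
    rw [if_pos trivial, if_pos trivial, ZMod.val_natCast, Nat.mod_eq_of_lt (by omega)]

theorem lab_inj {a b : Letter g} (h : lab a = lab b) : a = b := by
  have h1 := congrArg ZMod.val h
  rw [lab_val, lab_val] at h1
  obtain ⟨i, s⟩ := a
  obtain ⟨j, t⟩ := b
  have := i.2
  have := j.2
  cases s <;> cases t <;> simp at h1 <;> first | omega | (simp; omega)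

theorem lab_surj (hg : 2 ≤ g) (z : ZMod (4*g)) : ∃ a : Letter g, lab a = z := by
  have : NeZero (4*g) := ⟨by omega⟩
  have hz := z.val_lt
  by_cases h : z.val < 2*g
  · refine ⟨(⟨z.val, h⟩, true), ?_⟩
    simp [lab]
  · refine ⟨(⟨z.val - 2*g, by omega⟩, false), ?_⟩
    simp only [lab, Bool.false_eq_true, if_false, H]
    rw [← Nat.cast_add, Nat.sub_add_cancel (by omega)]
    simp

theorem lab_inv (a : Letter g) : lab (invLetter g a) = lab a + H g := by
  obtain ⟨i, s⟩ := a
  cases s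
  · have := addHH (g := g) ((i:ℕ) : ZMod (4*g))
    simpa only [lab, invLetter, Bool.not_false, if_true, Bool.false_eq_true, if_false] using this.symm
  · simp [lab, invLetter]

/-- A letter with the given label. -/
noncomputable def unlab (hg : 2 ≤ g) (z : ZMod (4*g)) : Letter g := (lab_surj hg z).choose

theorem lab_unlab (hg : 2 ≤ g) (z : ZMod (4*g)) : lab (unlab hg z) = z := (lab_surj hg z).choose_spec

theorem unlab_lab (hg : 2 ≤ g) (a : Letter g) : unlab hg (lab a) = a := lab_inj (lab_unlab hg _)

/-- The group element of a label. -/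
noncomputable def gp (hg : 2 ≤ g) (z : ZMod (4*g)) : SurfaceGroup g := evalLetter g (unlab hg z)

theorem gp_lab (hg : 2 ≤ g) (a : Letter g) : gp hg (lab a) = evalLetter g a := by
  rw [gp, unlab_lab]

theorem gp_inv (hg : 2 ≤ g) (z : ZMod (4*g)) : gp hg (z + H g) = (gp hg z)⁻¹ := by
  obtain ⟨a, rfl⟩ := lab_surj hg z
  rw [← lab_inv, gp_lab, gp_lab]
  obtain ⟨i, s⟩ := a
  cases s <;> simp [evalLetter, invLetter]

theorem Phi_gp (hg : 2 ≤ g) (z : ZMod (4*g)) : Phi hg (gp hg z) = opA hg z := by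
  obtain ⟨a, rfl⟩ := lab_surj hg z
  rw [gp_lab]
  obtain ⟨i, s⟩ := a
  cases s
  · simp [evalLetter, lab, Phi_gen, opA_inv]
  · simp [evalLetter, lab, Phi_gen]

end action

section ev
variable {g : ℕ} {G : Type*} [Group G]

/-- evaluation of a label word -/
def ev (π : ZMod (4*g) → G) (W : List (ZMod (4*g))) : G := (W.map π).prod

theorem ev_append (π : ZMod (4*g) → G) (W W') : ev π (W ++ W') = ev π W * ev π W' := by
  simp [ev]

theorem ev_cons (π : ZMod (4*g) → G) (c W) : ev π (c :: W) = π c * ev π W := by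
  simp [ev]

theorem ev_nil (π : ZMod (4*g) → G) : ev π [] = 1 := by simp [ev]

theorem ev_single (π : ZMod (4*g) → G) (c) : ev π [c] = π c := by simp [ev]

theorem ev_inv (π : ZMod (4*g) → G) (hπ : ∀ c, π (c + H g) = (π c)⁻¹) (W) :
    ev π ((W.map (· + H g)).reverse) = (ev π W)⁻¹ := by
  induction W with
  | nil => simp [ev]
  | cons c W ih => simp only [List.map_cons, List.reverse_cons, ev_append, ih, ev_cons, ev_nil, hπ]; group

/-- The relation between the group and its height function. -/
structure Geo (π : ZMod (4*g) → G) (h : G → ℕ) : Prop where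
  one : h 1 = 0
  step : ∀ v c, h (v * π c) = h v + 1 ∨ h (v * π c) + 1 = h v
  inv : ∀ c, π (c + H g) = (π c)⁻¹
  word : ∀ v, ∃ W, ev π W = v ∧ W.length = h v
  rel : ∀ τ x, Sg τ → ev π (rs τ x (2*g)) = ev π (rs (-τ) (x + H g - τ) (2*g))
  Q : ∀ v a b, h (v * (π a)⁻¹) + 1 = h v → h (v * (π b)⁻¹) + 1 = h v → a ≠ b →
    ∃ τ v0, Sg τ ∧ b = a + τ + H g ∧ v = v0 * ev π (rs τ b (2*g)) ∧ h v = h v0 + 2*g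

end ev

section geo
variable {g : ℕ}

theorem ev_rel (hg : 2 ≤ g) : ev (gp hg) (rs 1 0 (4*g)) = 1 := by
  have h : ((PresentedGroup.mk ({relator g} : Set (FreeGroup (Fin (2*g))))) (relator g)) = 1 :=
    PresentedGroup.one_of_mem rfl
  conv at h => lhs; arg 2; rw [relator]
  rw [map_mul, map_list_prod, map_list_prod, List.map_ofFn, List.map_ofFn] at h
  rw [ev, rs_split _ _ (2*g) (2*g) (by omega), List.map_append, List.prod_append,
    ← ofFn_eq, ← ofFn_eq]
  refine Eq.trans ?_ h
  congr 3
  · funext i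
    have : gp hg (((i:ℕ)) : ZMod (4*g)) = gen g i := by
      have := gp_lab hg (i, true)
      simpa [lab, evalLetter] using this
    simp only [zero_add, this]
    rfl
  · funext i
    have : gp hg (((i:ℕ)) : ZMod (4*g)) = gen g i := by
      have := gp_lab hg (i, true)
      simpa [lab, evalLetter] using this
    have e : (0:ZMod (4*g)) + ((2*g:ℕ):ZMod (4*g)) * 1 + ((i:ℕ):ZMod (4*g)) = ((i:ℕ):ZMod (4*g)) + H g := by rw [H]; ring
    rw [e, gp_inv, this]
    rfl

theorem ev_rel' (hg : 2 ≤ g) (n : ℕ) : ev (gp hg) (rs 1 (n : ZMod (4*g)) (4*g)) = 1 := by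
  induction n with
  | zero => simpa using ev_rel hg
  | succ n ih =>
    have e1 : rs 1 (n:ZMod (4*g)) (4*g+1) = (n:ZMod (4*g)) :: rs 1 ((n+1:ℕ):ZMod (4*g)) (4*g) := by
      rw [rs]; congr 2; push_cast; ring
    rw [rs_succ, rs_full] at e1
    have e2 := congrArg (ev (gp hg)) e1
    rw [ev_append, ih, ev_single, ev_cons] at e2
    simpa using e2

theorem ev_relx (hg : 2 ≤ g) (x : ZMod (4*g)) : ev (gp hg) (rs 1 x (4*g)) = 1 := by
  have : NeZero (4*g) := ⟨by omega⟩
  rw [← ZMod.natCast_zmod_val x]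
  exact ev_rel' hg _

theorem rs_inv (τ x : ZMod (4*g)) (n : ℕ) :
    ((rs τ x (n+1)).map (· + H g)).reverse = rs (-τ) (x + H g + (n:ℕ) * τ) (n+1) := by
  have : (rs τ x (n+1)).map (· + H g) = rs τ (x + H g) (n+1) := by
    generalize n + 1 = m
    induction m generalizing x with
    | zero => simp [rs]
    | succ m ih => simp only [rs, List.map_cons, ih]; congr 2; ring
  rw [this, rs_reverse]

theorem c2g1 (hg : 2 ≤ g) : ((2*g-1 : ℕ) : ZMod (4*g)) = 2*(g:ZMod (4*g)) - 1 := by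
  have : 1 ≤ 2*g := by omega
  push_cast [this]; ring

theorem ev_rel1 (hg : 2 ≤ g) (x : ZMod (4*g)) :
    ev (gp hg) (rs 1 x (2*g)) = ev (gp hg) (rs (-1) (x + H g - 1) (2*g)) := by
  have h := ev_relx hg x
  rw [rs_split _ _ (2*g) (2*g) (by omega), ev_append] at h
  have h2 := ev_inv (gp hg) (gp_inv hg) (rs 1 (x + ((2*g:ℕ):ZMod (4*g)) * 1) (2*g-1+1))
  rw [rs_inv] at h2
  have e : 2*g-1+1 = 2*g := by omega
  rw [e] at h2
  rw [eq_comm, ← eq_inv_iff_mul_eq_one.2 h] at h2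
  rw [h2]
  congr 2
  rw [c2g1 hg, H_eq]; push_cast
  linear_combination four_g (g := g)

theorem ev_rel2 (hg : 2 ≤ g) (τ x : ZMod (4*g)) (hτ : Sg τ) :
    ev (gp hg) (rs τ x (2*g)) = ev (gp hg) (rs (-τ) (x + H g - τ) (2*g)) := by
  rcases hτ with rfl | rfl
  · exact ev_rel1 hg x
  · rw [neg_neg, ev_rel1]
    congr 2
    linear_combination - H_add_H (g := g)

theorem ev_up (hg : 2 ≤ g) {ω τ : List (ZMod (4*g))} {c} (h : Up ω c τ) :
    ev (gp hg) ω.reverse * gp hg c = ev (gp hg) τ.reverse := by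
  induction h with
  | tree h => rw [List.reverse_cons, ev_append, ev_single]
  | @cross β x γ h h' ih =>
    rw [reverse_mr, reverse_pr, ev_append, ev_append, ← ih, mul_assoc, mul_assoc]
    congr 1
    have h1 := ev_rel1 hg x
    have e : 2*g = 2*g-1+1 := by omega
    have h2 : rs 1 x (2*g) = x :: rs 1 (x+1) (2*g-1) := by
      conv_lhs => rw [rs_split _ _ 1 (2*g-1) (by omega)]
      simp [rs]
    have h3 : rs (-1) (x + H g - 1) (2*g) = rs (-1) (x + H g - 1) (2*g-1) ++ [x] := by
      conv_lhs => rw [rs_split _ _ (2*g-1) 1 (by omega)]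
      simp only [rs]
      congr 2
      rw [c2g1 hg, H_eq]; ring
    rw [h2, h3, ev_cons, ev_append, ev_single] at h1
    exact h1.symm

/-- The normal form of an element. -/
noncomputable def NF (hg : 2 ≤ g) (v : SurfaceGroup g) : Om g := (Phi hg v).unop ⟨[], trivial⟩

theorem NF_mul (hg : 2 ≤ g) (v : SurfaceGroup g) (c) : NF hg (v * gp hg c) = act hg c (NF hg v) := by
  simp only [NF, map_mul, Phi_gp]
  rfl

theorem ev_act (hg : 2 ≤ g) (c) (ω : Om g) :
    ev (gp hg) ω.1.reverse * gp hg c = ev (gp hg) (act hg c ω).1.reverse := by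
  rcases act_spec hg c ω with h | h
  · exact ev_up hg h
  · rw [← ev_up hg h, gp_inv]; group

theorem ev_NF (hg : 2 ≤ g) (v : SurfaceGroup g) : ev (gp hg) (NF hg v).1.reverse = v := by
  have key : ∀ W : List (ZMod (4*g)), ev (gp hg) (NF hg (ev (gp hg) W)).1.reverse = ev (gp hg) W := by
    intro W
    induction W using List.reverseRecOn with
    | nil => simp [NF, ev_nil]
    | append_singleton W c ih => rw [ev_append, ev_single, NF_mul, ← ev_act, ih]
  obtain ⟨w, rfl⟩ := PresentedGroup.mk_surjective _ v
  obtain ⟨L, rfl⟩ : ∃ L, FreeGroup.mk L = w := ⟨w.toWord, FreeGroup.mk_toWord⟩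
  have : PresentedGroup.mk {relator g} (FreeGroup.mk L) = ev (gp hg) (L.map lab) := by
    rw [ev, List.map_map]
    induction L with
    | nil => simp [← FreeGroup.one_eq_mk]
    | cons a L ih =>
      have : FreeGroup.mk (a :: L) = FreeGroup.mk [a] * FreeGroup.mk L := by
        rw [FreeGroup.mul_mk]; rfl
      rw [this, map_mul, ih, List.map_cons, List.prod_cons]
      congr 1
      rw [Function.comp, gp_lab]
      obtain ⟨i, s⟩ := a
      cases s
      · simp only [evalLetter, Bool.false_eq_true, if_false, gen]
        rw [PresentedGroup.of, ← map_inv]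
        rfl
      · rfl
  rw [this]
  exact key _

theorem NF_ev (hg : 2 ≤ g) (ω : List (ZMod (4*g))) (hv : Valid ω) :
    NF hg (ev (gp hg) ω.reverse) = ⟨ω, hv⟩ := by
  induction ω with
  | nil => simp [NF, ev_nil]
  | cons a t ih =>
    rw [List.reverse_cons, ev_append, ev_single, NF_mul, ih hv.tail]
    exact act_eq hg (tree_nb hv)

/-- The height. -/
noncomputable def ht (hg : 2 ≤ g) (v : SurfaceGroup g) : ℕ := (NF hg v).1.length

theorem ht_step (hg : 2 ≤ g) (v c) : ht hg (v * gp hg c) = ht hg v + 1 ∨ ht hg (v * gp hg c) + 1 = ht hg v := by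
  unfold ht
  rw [NF_mul]
  rcases act_spec hg c (NF hg v) with h | h
  · exact Or.inl (h.length hg)
  · exact Or.inr (h.length hg).symm

theorem In_Inl (hg : 2 ≤ g) (v a) (h : ht hg (v * (gp hg a)⁻¹) + 1 = ht hg v) : Inl (NF hg v).1 a := by
  unfold ht at h
  rw [← gp_inv, NF_mul] at h
  rcases act_spec hg (a + H g) (NF hg v) with h' | h'
  · have := h'.length hg
    omega
  · rw [addHH] at h'
    exact (up_main hg h').2.2.1

theorem Q_main (hg : 2 ≤ g) (v : SurfaceGroup g) (a t) (he : (NF hg v).1 = a :: t) (hp : pst (a :: t) = 2*g) :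
    ∃ v0, v = v0 * ev (gp hg) (rs 1 (a + H g + 1) (2*g)) ∧ ht hg v = ht hg v0 + 2*g := by
  have hv := (NF hg v).2
  rw [he] at hv
  obtain ⟨ω, hω⟩ := down_total hg (a :: t) (a + H g + 1) hv (Or.inr ⟨hp, rfl⟩)
  rcases up_iff.1 hω with ⟨_, h⟩ | ⟨β, γ, h1, h2, h3, h4⟩
  · exfalso
    have := (List.cons.inj h).1
    refine nz (g := g) (2*g+1) (by omega) (by omega) ?_
    push_cast
    linear_combination -this - H_eq (g := g)
  · have hev := ev_NF hg v
    rw [he, h4, reverse_pr, ev_append, ← ev_up hg h1, mul_assoc, ← ev_cons] at hev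
    refine ⟨ev (gp hg) β.reverse, ?_, ?_⟩
    · rw [← hev]
      congr 2
      conv_rhs => rw [rs_split _ _ 1 (2*g-1) (by omega)]
      simp [rs]
    · unfold ht
      rw [NF_ev hg β (up_main hg h1).1, he, h4, pr_length, h1.length hg]
      simp only
      omega

theorem geo (hg : 2 ≤ g) : Geo (gp hg) (ht hg) where
  one := by simp [ht, NF]
  step := ht_step hg
  inv := gp_inv hg
  word := fun v => ⟨_, ev_NF hg v, by simp [ht]⟩
  rel := fun τ x h => ev_rel2 hg τ x h
  Q := by
    intro v a b ha hb hab
    have ha := In_Inl hg v a ha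
    have hb := In_Inl hg v b hb
    obtain ⟨ω, hω⟩ : ∃ ω, ω = (NF hg v).1 := ⟨_, rfl⟩
    rw [← hω] at ha hb
    cases ω with
    | nil => exact absurd ha (by simp [Inl])
    | cons c t =>
      rcases ha with rfl | ⟨hp, ha⟩
      · rcases hb with rfl | ⟨hp, hb⟩
        · exact absurd rfl hab
        · obtain ⟨v0, h1, h2⟩ := Q_main hg v _ t hω.symm hp
          refine ⟨1, v0, Or.inl rfl, by rw [hb]; ring, ?_, h2⟩
          rw [hb]; exact h1
      · rcases hb with rfl | ⟨hp, hb⟩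
        · obtain ⟨v0, h1, h2⟩ := Q_main hg v _ t hω.symm hp
          refine ⟨-1, v0, Or.inr rfl, by rw [ha]; linear_combination -H_add_H (g := g), ?_, h2⟩
          rw [h1, ev_rel1]
          congr 3
          linear_combination H_add_H (g := g)
        · exact absurd (ha.trans hb.symm) hab

end geo
end Aux
end SG

namespace SG
namespace Aux

section C
variable {g : ℕ}

theorem Sg.nzH {δ : ZMod (4*g)} (hδ : Sg δ) (k : ℤ) (h0 : -(2*g) < k) (h1 : k < 2*g) :
    ((k : ℤ) : ZMod (4*g)) * δ + Aux.H g ≠ 0 := by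
  intro h
  refine hδ.nz (k + 2*g) (by omega) (by omega) ?_
  push_cast
  linear_combination h - hδ.H

theorem Sg.nz' {δ : ZMod (4*g)} (hδ : Sg δ) (k : ℤ) (hk : k ≠ 0) (h0 : -(4*g) < k) (h1 : k < 4*g) :
    ((k : ℤ) : ZMod (4*g)) * δ ≠ 0 := by
  intro h
  rcases lt_or_gt_of_ne hk with hk | hk
  · refine hδ.nz (-k) (by omega) (by omega) ?_
    push_cast
    linear_combination -h
  · exact hδ.nz k hk h1 h

/-- the chain of a peak -/
def CH (δ x : ZMod (4*g)) : ℕ → List (ZMod (4*g))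
  | 0 => rs δ x (2*g)
  | r+1 => CH δ x r ++ rs δ (x + δ) (2*g-1)

theorem rs_cons (hg : 2 ≤ g) (δ x : ZMod (4*g)) : rs δ x (2*g) = x :: rs δ (x + δ) (2*g-1) := by
  conv_lhs => rw [rs_split _ _ 1 (2*g-1) (by omega)]
  simp [rs]

theorem rs_last (hg : 2 ≤ g) {δ : ZMod (4*g)} (x : ZMod (4*g)) (hδ : Sg δ) :
    rs δ x (2*g) = rs δ x (2*g-1) ++ [x + H g - δ] := by
  conv_lhs => rw [rs_split _ _ (2*g-1) 1 (by omega)]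
  simp only [rs]
  congr 2
  rw [c2g1 hg, hδ.H]; ring

theorem CH_tail (hg : 2 ≤ g) (δ x : ZMod (4*g)) (r : ℕ) :
    ∃ P, CH δ x r = P ++ rs δ (x + δ) (2*g-1) := by
  cases r with
  | zero => exact ⟨[x], rs_cons hg δ x⟩
  | succ r => exact ⟨_, rfl⟩

/-- freely reduced label words -/
def FRed (W : List (ZMod (4*g))) : Prop := List.IsChain (fun a c => c ≠ a + H g) W

theorem FRed.mid {P Q : List (ZMod (4*g))} {a c} (h : FRed (P ++ a :: c :: Q)) : c ≠ a + H g := by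
  unfold FRed at h
  rw [List.isChain_append] at h
  exact (List.isChain_cons_cons.1 h.2.1).1

theorem FRed.left {P Q : List (ZMod (4*g))} (h : FRed (P ++ Q)) : FRed P := by
  unfold FRed at *
  rw [List.isChain_append] at h
  exact h.1

theorem FRed.right {P Q : List (ZMod (4*g))} (h : FRed (P ++ Q)) : FRed Q := by
  unfold FRed at *
  rw [List.isChain_append] at h
  exact h.2.1

variable {G : Type*} [Group G] {π : ZMod (4*g) → G} {h : G → ℕ}

/-- incoming letter -/
def In (π : ZMod (4*g) → G) (h : G → ℕ) (v : G) (a : ZMod (4*g)) : Prop :=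
  h (v * (π a)⁻¹) + 1 = h v

theorem Geo.inv' (Γ : Geo π h) (a) : (π (a + H g))⁻¹ = π a := by rw [Γ.inv]; simp

theorem Geo.In_up (Γ : Geo π h) {v a} : In π h (v * π a) a ↔ h (v * π a) = h v + 1 := by
  unfold In; rw [mul_inv_cancel_right]; omega

theorem Geo.In_dn (Γ : Geo π h) {v a} : In π h v (a + H g) ↔ h (v * π a) + 1 = h v := by
  unfold In; rw [Γ.inv']

theorem Geo.dich (Γ : Geo π h) (v a) : In π h (v * π a) a ∨ In π h v (a + H g) := by
  rw [Γ.In_up, Γ.In_dn]; exact Γ.step v a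

theorem Geo.excl (Γ : Geo π h) {v a} (h1 : In π h (v * π a) a) (h2 : In π h v (a + H g)) : False := by
  rw [Γ.In_up] at h1; rw [Γ.In_dn] at h2; omega

theorem Geo.le (Γ : Geo π h) (v : G) (W) : h (v * ev π W) ≤ h v + W.length := by
  induction W generalizing v with
  | nil => simp [ev_nil]
  | cons c W ih =>
    rw [ev_cons, ← mul_assoc]
    have := ih (v * π c)
    have := Γ.step v c
    simp only [List.length_cons]; omega

/-- geodesic from a vertex -/
def GF (π : ZMod (4*g) → G) (h : G → ℕ) (v : G) (W : List (ZMod (4*g))) : Prop :=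
  h (v * ev π W) = h v + W.length

theorem GF.left (Γ : Geo π h) {v W W'} (hh : GF π h v (W ++ W')) : GF π h v W := by
  unfold GF at *
  rw [ev_append, ← mul_assoc, List.length_append] at hh
  have := Γ.le (v * ev π W) W'
  have := Γ.le v W
  omega

theorem GF.right (Γ : Geo π h) {v W W'} (hh : GF π h v (W ++ W')) : GF π h (v * ev π W) W' := by
  have := hh.left Γ
  unfold GF at *
  rw [ev_append, ← mul_assoc, List.length_append] at hh
  omega

/-- geodesic words -/
def Gde (π : ZMod (4*g) → G) (h : G → ℕ) (W : List (ZMod (4*g))) : Prop := h (ev π W) = W.length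

theorem Gde_GF (Γ : Geo π h) {W} : Gde π h W ↔ GF π h 1 W := by
  unfold Gde GF; rw [Γ.one]; simp

theorem Gde.left (Γ : Geo π h) {W W'} (hh : Gde π h (W ++ W')) : Gde π h W := by
  rw [Gde_GF Γ] at *; exact hh.left Γ

theorem Geo.le1 (Γ : Geo π h) (W) : h (ev π W) ≤ W.length := by
  have := Γ.le 1 W
  rwa [one_mul, Γ.one, zero_add] at this

theorem Gde.of_le (Γ : Geo π h) {W : List (ZMod (4*g))} (hh : Gde π h W) {W'} (h' : ev π W' = ev π W) :
    W.length ≤ W'.length := by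
  unfold Gde at hh
  have := Γ.le1 W'
  rw [h', hh] at this; exact this

theorem Gde.right (Γ : Geo π h) {W W'} (hh : Gde π h (W ++ W')) : Gde π h W' := by
  obtain ⟨V, h1, h2⟩ := Γ.word (ev π W')
  have := hh.of_le Γ (W' := W ++ V) (by rw [ev_append, ev_append, h1])
  have := Γ.le1 W'
  unfold Gde
  simp only [List.length_append] at *
  omega

theorem Gde.sub_word (Γ : Geo π h) {W P Q} (hh : Gde π h (P ++ W ++ Q)) : Gde π h W :=
  (hh.left Γ).right Γ

theorem Gde.In (Γ : Geo π h) {W c} (hh : Gde π h (W ++ [c])) : In π h (ev π (W ++ [c])) c := by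
  have h1 := hh.left Γ
  rw [ev_append, ev_single, Γ.In_up]
  unfold Gde at *
  rw [ev_append, ev_single, List.length_append] at hh
  simpa [h1] using hh

theorem Gde.snoc (Γ : Geo π h) {W c} (h1 : Gde π h W) (h2 : Aux.In π h (ev π W * π c) c) :
    Gde π h (W ++ [c]) := by
  rw [Γ.In_up] at h2
  unfold Gde at *
  rw [ev_append, ev_single, List.length_append, h2, h1]; rfl

theorem Gde.FRed (Γ : Geo π h) {W} (hh : Gde π h W) : FRed W := by
  unfold Aux.FRed
  rw [List.isChain_iff_forall_rel_of_append_cons_cons]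
  rintro a c P Q rfl hc
  have := hh.of_le Γ (W' := P ++ Q) (by
    rw [ev_append, ev_append, ev_cons, ev_cons, hc, Γ.inv]; group)
  simp at this

theorem Geo.pair (Γ : Geo π h) {v a b δ} (hδ : Sg δ) (ha : In π h v a) (hb : In π h v b) :
    b = a ∨ b = a + δ + H g ∨ b = a - δ + H g := by
  by_cases hab : a = b
  · exact Or.inl hab.symm
  obtain ⟨τ, v0, h1, h2, -⟩ := Γ.Q v a b ha hb hab
  rcases hδ.eq_or h1 with rfl | rfl
  · exact Or.inr (Or.inl h2)
  · right; right; rw [h2]; ring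

theorem Geo.Qt (Γ : Geo π h) (hg : 2 ≤ g) {v a b δ} (hδ : Sg δ) (ha : In π h v a) (hb : In π h v b)
    (e : b = a + δ + H g) : ∃ v0, v = v0 * ev π (rs δ b (2*g)) ∧ h v = h v0 + 2*g := by
  have hab : a ≠ b := by
    rintro rfl
    exact hδ.nzH 1 (by omega) (by omega) (by push_cast; linear_combination -e)
  obtain ⟨τ, v0, h1, h2, h3⟩ := Γ.Q v a b ha hb hab
  rcases hδ.eq_or h1 with rfl | rfl
  · exact ⟨v0, h3⟩
  · exfalso
    exact hδ.nz' 2 (by omega) (by omega) (by omega) (by push_cast; linear_combination h2 - e)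

/-- A tile with bottom `v`. -/
def Tile (π : ZMod (4*g) → G) (h : G → ℕ) (v : G) (δ x : ZMod (4*g)) : Prop :=
  Sg δ ∧ h (v * ev π (rs δ x (2*g))) = h v + 2*g

theorem Tile.ht (Γ : Geo π h) {v δ x} (t : Tile π h v δ x) (k : ℕ) (hk : k ≤ 2*g) :
    h (v * ev π (rs δ x k)) = h v + k := by
  have h1 : GF π h v (rs δ x (2*g)) := by unfold GF; rw [t.2, rs_length]
  rw [rs_split δ x k (2*g-k) (by omega)] at h1
  have := h1.left Γ
  unfold GF at this
  rwa [rs_length] at this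

theorem Tile.snoc {v : G} {δ x : ZMod (4*g)} (k : ℕ) :
    v * ev π (rs δ x (k+1)) = v * ev π (rs δ x k) * π (x + (k:ℕ) * δ) := by
  rw [rs_succ, ev_append, ev_single, mul_assoc]

theorem Tile.In (Γ : Geo π h) {v δ x} (t : Tile π h v δ x) (k : ℕ) (hk : k + 1 ≤ 2*g) :
    In π h (v * ev π (rs δ x (k+1))) (x + (k:ℕ) * δ) := by
  have h1 := t.ht Γ (k+1) hk
  have h2 := t.ht Γ k (by omega)
  rw [Tile.snoc] at h1 ⊢
  rw [Γ.In_up, h1, h2]; ring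

theorem Tile.swap (Γ : Geo π h) {v δ x} (t : Tile π h v δ x) : Tile π h v (-δ) (x + H g - δ) :=
  ⟨t.1.neg, by rw [← Γ.rel _ _ t.1]; exact t.2⟩

theorem Geo.tile (Γ : Geo π h) (hg : 2 ≤ g) {v a b δ} (hδ : Sg δ) (ha : Aux.In π h v a)
    (hb : Aux.In π h v b) (e : b = a + δ + H g) :
    ∃ v0, v = v0 * ev π (rs δ b (2*g)) ∧ Tile π h v0 δ b := by
  obtain ⟨v0, h1, h2⟩ := Γ.Qt hg hδ ha hb e
  exact ⟨v0, h1, hδ, h1 ▸ h2⟩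

/-- the vertex below in a tile -/
theorem Geo.Qc (Γ : Geo π h) (hg : 2 ≤ g) {v a b δ} (hδ : Sg δ) (ha : Aux.In π h v a)
    (hb : Aux.In π h v b) (e : b = a + δ + H g) : Aux.In π h (v * (π a)⁻¹) (a - δ) := by
  obtain ⟨v0, h1, t⟩ := Γ.tile hg hδ ha hb e
  have hHH := H_add_H (g := g)
  have hl : b + H g - δ = a := by rw [e]; linear_combination hHH
  rw [rs_last hg b hδ, hl, ev_append, ev_single, ← mul_assoc] at h1
  rw [h1, mul_inv_cancel_right]
  have := t.In Γ (2*g-2) (by omega)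
  have e2 : 2*g-2+1 = 2*g-1 := by omega
  rw [e2] at this
  convert this using 1
  have : ((2*g-2 : ℕ):ZMod (4*g)) = 2*(g:ZMod (4*g)) - 2 := by
    have : 2 ≤ 2*g := by omega
    push_cast [this]; ring
  rw [this, e]
  linear_combination hδ.H - hHH

theorem Geo.D2 (Γ : Geo π h) (hg : 2 ≤ g) {v a b δ} (hδ : Sg δ) (ha : Aux.In π h v a)
    (hb : Aux.In π h v b) (e : b = a + 2 * δ) : False := by
  rcases Γ.pair hδ ha hb with h1 | h1 | h1
  · exact hδ.nz' 2 (by omega) (by omega) (by omega) (by push_cast; linear_combination h1 - e)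
  · exact hδ.nzH (-1) (by omega) (by omega) (by push_cast; linear_combination e - h1)
  · exact hδ.nzH (-3) (by omega) (by omega) (by push_cast; linear_combination e - h1)

/-- Uniqueness on the sides of a tile. -/
theorem Tile.uniq (Γ : Geo π h) (hg : 2 ≤ g) {v δ x} (t : Tile π h v δ x) (k : ℕ) (h1 : 1 ≤ k)
    (h2 : k + 2 ≤ 2*g) {c} (hc : Aux.In π h (v * ev π (rs δ x (k+1))) c) : c = x + (k:ℕ) * δ := by
  have ha := t.In Γ k (by omega)
  rcases Γ.pair t.1 ha hc with h3 | h3 | h3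
  · exact h3
  · exfalso
    have hn := t.In Γ (k+1) (by omega)
    rw [Tile.snoc] at hn
    apply Γ.excl hn
    rw [h3] at hc
    convert hc using 1
    push_cast; ring
  · exfalso
    have hq := Γ.Qc hg t.1.neg ha hc (by rw [h3]; ring)
    rw [Tile.snoc, mul_inv_cancel_right] at hq
    obtain ⟨k, rfl⟩ : ∃ k', k = k' + 1 := ⟨k-1, by omega⟩
    have := t.In Γ k (by omega)
    exact Γ.D2 hg t.1 this hq (by push_cast; ring)

/-- down state -/
def Dn (π : ZMod (4*g) → G) (h : G → ℕ) (v : G) (c δ : ZMod (4*g)) : Prop :=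
  Sg δ ∧ In π h v (c + δ + H g) ∧ (∀ e, In π h v e → e = c + δ + H g) ∧
    ¬ In π h (v * (π (c + δ + H g))⁻¹) (c + H g)

/-- state of a word -/
def St (π : ZMod (4*g) → G) (h : G → ℕ) (Y : List (ZMod (4*g))) (c : ZMod (4*g)) : Prop :=
  In π h (ev π Y) c ∨ ∃ δ r, Dn π h (ev π Y) c δ ∧ CH δ (c + H g) r ++ [c] <:+ Y

/-- all states -/
def ASt (π : ZMod (4*g) → G) (h : G → ℕ) (Y : List (ZMod (4*g))) : Prop :=
  ∀ Y' c, Y' ++ [c] <+: Y → St π h (Y' ++ [c]) c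

theorem ASt.left {Y Y' : List (ZMod (4*g))} (hs : ASt π h (Y ++ Y')) : ASt π h Y :=
  fun _ _ hp => hs _ _ (hp.trans (List.prefix_append _ _))

theorem ASt.snoc {Y : List (ZMod (4*g))} {c} (hs : ASt π h Y) (hc : St π h (Y ++ [c]) c) :
    ASt π h (Y ++ [c]) := by
  intro Y' c' hp
  rcases List.prefix_concat_iff.1 hp with h1 | h1
  · obtain ⟨rfl, h2⟩ := List.append_inj' h1 rfl
    obtain rfl := (List.cons.inj h2).1
    exact hc
  · exact hs _ _ h1

theorem Gde.ASt (Γ : Geo π h) {Y} (hY : Gde π h Y) : ASt π h Y := by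
  rintro Y' c ⟨Q, rfl⟩
  exact Or.inl ((hY.left Γ).In Γ)

/-- running back along the side of a tile -/
theorem back (Γ : Geo π h) (hg : 2 ≤ g) {Y v0 δ x} (hf : FRed Y) (hs : ASt π h Y)
    (t : Tile π h v0 δ x) (hev : ev π Y = v0 * ev π (rs δ x (2*g)))
    (hl : ∃ Y', Y = Y' ++ [x + H g - δ]) (k : ℕ) (hk : k + 1 ≤ 2*g-1) :
    ∃ Y', Y = Y' ++ rs δ (x + H g - (k+1:ℕ) * δ) (k+1) := by
  induction k with
  | zero =>
    obtain ⟨Y', h1⟩ := hl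
    exact ⟨Y', by rw [h1]; simp [rs]⟩
  | succ k ih =>
    obtain ⟨Y1, h1⟩ := ih (by omega)
    obtain ⟨m, hm⟩ : ∃ m, 2*g = (m+2) + (k+1) := ⟨2*g-(k+1)-2, by omega⟩
    have hH := t.1.H
    have hmc : H g = ((m:ℕ) + 2 + (k + 1)) * δ := by
      have : ((2*g : ℕ):ZMod (4*g)) = ((m+2+(k+1) : ℕ) : ZMod (4*g)) := by rw [hm]
      rw [hH]
      push_cast at this
      linear_combination δ * this
    have hev1 : ev π Y1 = v0 * ev π (rs δ x (m+1+1)) := by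
      have h2 := hev
      rw [rs_split _ _ _ _ hm, h1, ev_append, ev_append, ← mul_assoc] at h2
      have e : x + H g - (k+1:ℕ) * δ = x + (m+2:ℕ) * δ := by
        push_cast; linear_combination hmc
      rw [e] at h2
      exact mul_right_cancel h2
    have hne : Y1 ≠ [] := by
      rintro rfl
      have := t.ht Γ (m+1+1) (by omega)
      rw [← hev1, ev_nil, Γ.one] at this
      omega
    obtain ⟨Y2, c, rfl⟩ := List.eq_nil_or_concat Y1 |>.resolve_left hne
    simp only [List.concat_eq_append] at *
    have hin : ∀ e, In π h (ev π (Y2 ++ [c])) e → e = x + (m+1:ℕ) * δ := by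
      intro e he
      rw [hev1] at he
      exact t.uniq Γ hg (m+1) (by omega) (by omega) he
    have hcc : c = x + (m+1:ℕ) * δ := by
      rcases hs Y2 c ⟨_, h1.symm⟩ with h2 | ⟨ε, r, ⟨d1, d2, d3, d4⟩, -⟩
      · exact hin _ h2
      · exfalso
        have e1 := hin _ d2
        rcases t.1.eq_or d1 with rfl | rfl
        · apply d4
          rw [e1, hev1, Tile.snoc, mul_inv_cancel_right]
          have := t.In Γ m (by omega)
          convert this using 1
          push_cast at e1
          linear_combination e1
        · rw [h1, rs, List.append_assoc, List.singleton_append] at hf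
          apply hf.mid
          push_cast at e1 ⊢
          linear_combination hmc - e1
    refine ⟨Y2, ?_⟩
    rw [h1, hcc, List.append_assoc, rs.eq_2 _ _ (k+1)]
    have e2 : x + H g - (k+1+1:ℕ) * δ = x + (m+1:ℕ) * δ := by
      push_cast; linear_combination hmc
    rw [e2]
    have e3 : x + H g - (k+1:ℕ) * δ = x + (m+1:ℕ) * δ + δ := by
      push_cast; linear_combination hmc
    rw [e3]; rfl

theorem lemC (Γ : Geo π h) (hg : 2 ≤ g) {x δ} (hδ : Sg δ) (n : ℕ) :
    ∀ Y Y', Y.length = n → FRed Y → ASt π h Y → Y = Y' ++ [x + H g - δ] →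
      In π h (ev π Y) (x + H g - δ) → In π h (ev π Y) x → ∃ r, CH δ x r <:+ Y := by
  have hHH := H_add_H (g := g)
  induction n using Nat.strong_induction_on with
  | _ n ih =>
  intro Y Y' hn hf hs hY i1 i2
  obtain ⟨v0, hev, t⟩ := Γ.tile hg hδ i1 i2 (by linear_combination -hHH)
  obtain ⟨Y1, h1⟩ := back Γ hg hf hs t hev ⟨_, hY⟩ (2*g-2) (by omega)
  have e1 : 2*g-2+1 = 2*g-1 := by omega
  rw [e1] at h1
  have e2 : x + H g - ((2*g-1:ℕ):ZMod (4*g)) * δ = x + δ := by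
    rw [c2g1 hg, hδ.H]; ring
  rw [e2] at h1
  have hev1 : ev π Y1 = v0 * π x := by
    rw [rs_cons hg, h1, ev_append, ev_cons, ← mul_assoc] at hev
    exact mul_right_cancel hev
  have hx := t.In Γ 0 (by omega)
  simp only [rs, ev_single, Nat.cast_zero, zero_mul, add_zero, zero_add] at hx
  rw [← hev1] at hx
  have hne : Y1 ≠ [] := by
    rintro rfl
    unfold In at hx
    rw [ev_nil, Γ.one] at hx
    omega
  obtain ⟨Y2, c, rfl⟩ := List.eq_nil_or_concat Y1 |>.resolve_left hne
  simp only [List.concat_eq_append] at *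
  have hnx : x + δ ≠ c + H g := by
    rw [h1, ← e1, rs, List.append_assoc, List.singleton_append] at hf
    exact hf.mid
  rcases hs Y2 c ⟨_, h1.symm⟩ with h2 | ⟨ε, r, ⟨d1, d2, d3, d4⟩, hch⟩
  · rcases Γ.pair hδ hx h2 with h3 | h3 | h3
    · refine ⟨0, Y2, ?_⟩
      rw [CH, rs_cons hg, h1, h3]; simp
    · exact absurd (by rw [h3]; linear_combination -hHH) hnx
    · have hfl := hf
      rw [h1] at hfl hs
      have hlen : (Y2 ++ [c]).length < n := by
        rw [← hn, h1, List.length_append (bs := rs δ (x + δ) (2*g-1)), rs_length]; omega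
      have hc : c = x + H g - δ := by rw [h3]; ring
      rw [hc] at h2 hfl hs hlen hx h1
      obtain ⟨r, P, hP⟩ := ih _ hlen (Y2 ++ [x + H g - δ]) Y2 rfl hfl.left hs.left rfl h2 hx
      refine ⟨r+1, P, ?_⟩
      rw [h1, CH, ← hP, List.append_assoc]
  · have hxe := d3 _ hx
    rcases hδ.eq_or d1 with rfl | rfl
    · refine ⟨1, ?_⟩
      have hc : c + H g + ε = x := by rw [hxe]; ring
      have hc' : c = x + H g - ε := by linear_combination hc - hHH
      obtain ⟨P, hP⟩ := CH_tail hg ε (c + H g) r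
      obtain ⟨P', hP'⟩ := hch
      refine ⟨P' ++ P, ?_⟩
      rw [CH, CH, h1, ← hP', hP, hc, rs_last hg x hδ, ← hc']
      simp
    · exfalso; apply hnx; linear_combination hxe

theorem CH_short (Γ : Geo π h) (hg : 2 ≤ g) {x δ} (hδ : Sg δ) (r : ℕ) :
    ∃ B, ev π (CH δ x r) = ev π B * π x ∧ B.length + 1 = (CH δ x r).length := by
  have h0 : ev π (rs δ x (2*g)) = ev π (rs (-δ) (x + H g - δ) (2*g-1)) * π x := by
    rw [Γ.rel _ _ hδ, rs_last hg _ hδ.neg, ev_append, ev_single]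
    congr 2
    linear_combination H_add_H (g := g)
  induction r with
  | zero => exact ⟨_, h0, by rw [CH, rs_length, rs_length]; omega⟩
  | succ r ih =>
    obtain ⟨B, h1, h2⟩ := ih
    refine ⟨B ++ rs (-δ) (x + H g - δ) (2*g-1), ?_, ?_⟩
    · rw [CH, ev_append, h1, mul_assoc, ← ev_cons, ← rs_cons hg, h0, ev_append, mul_assoc]
    · rw [CH, List.length_append, List.length_append, rs_length, rs_length]; omega

theorem CH_not (Γ : Geo π h) (hg : 2 ≤ g) {x δ} (hδ : Sg δ) (r : ℕ) :
    ¬ Gde π h (CH δ x r ++ [x + H g]) := by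
  intro hh
  obtain ⟨B, h1, h2⟩ := CH_short Γ hg (x := x) hδ r
  have := hh.of_le Γ (W' := B) (by rw [ev_append, ev_single, h1, Γ.inv]; group)
  rw [List.length_append, List.length_singleton] at this
  omega

theorem run_not (Γ : Geo π h) (hg : 2 ≤ g) {x δ} (hδ : Sg δ) (n : ℕ) (hn : 2*g < n) :
    ¬ Gde π h (rs δ x n) := by
  intro hh
  rw [rs_split δ x (2*g+1) (n-(2*g+1)) (by omega)] at hh
  have := hh.left Γ
  rw [rs_succ] at this
  apply CH_not Γ hg (x := x) hδ 0
  have e : x + ((2*g:ℕ):ZMod (4*g)) * δ = x + H g := by push_cast; linear_combination -hδ.H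
  rw [e] at this
  exact this

/-- strong down state -/
def SD (π : ZMod (4*g) → G) (h : G → ℕ) (Y : List (ZMod (4*g))) (c : ZMod (4*g)) : Prop :=
  ∃ Y0 v0 x δ n, Tile π h v0 δ x ∧ n + 2 ≤ 2*g ∧ Y = Y0 ++ rs δ (x + δ) (4*g-1-(n+1)) ∧
    ev π Y0 = v0 * π x ∧ ev π Y = v0 * ev π (rs (-δ) (x + H g - δ) (n+1)) ∧
    c = x - ((n:ℕ) + 2) * δ

theorem cast_sub (hg : 2 ≤ g) (n : ℕ) (hn : n + 2 ≤ 2*g) :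
    ((4*g-1-(n+1) : ℕ) : ZMod (4*g)) = -((n:ℕ) + 2) := by
  have : ((4*g-1-(n+1) + (n+2) : ℕ) : ZMod (4*g)) = 0 := by
    have : 4*g-1-(n+1) + (n+2) = 4*g := by omega
    rw [this]; exact ZMod.natCast_self _
  rw [Nat.cast_add] at this
  push_cast at this
  linear_combination this

theorem SD.Dn (Γ : Geo π h) (hg : 2 ≤ g) {A U1 U2 c} (hA : Gde π h A) (hU : Gde π h (U1 ++ U2))
    (hf : FRed (A ++ U1)) (hno : ∀ P Q δ x, Sg δ → A ++ U1 ≠ P ++ rs δ x (4*g-1) ++ Q)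
    (hs : SD π h (A ++ U1) c) : ∃ δ, Dn π h (ev π (A ++ U1)) c δ ∧ ∀ c', In π h (ev π (A ++ U1)) c' →
      ∃ Y0 v0 x n, Tile π h v0 δ x ∧ n + 2 ≤ 2*g ∧ A ++ U1 = Y0 ++ rs δ (x + δ) (4*g-1-(n+1)) ∧
    ev π Y0 = v0 * π x ∧ ev π (A ++ U1) = v0 * ev π (rs (-δ) (x + H g - δ) (n+1)) ∧
    c = x - ((n:ℕ) + 2) * δ ∧ c' = c + δ + H g := by
  have hHH := H_add_H (g := g)
  obtain ⟨Y0, v0, x, δ, n, t, hn, hY, hev0, hev, hc⟩ := hs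
  have hδ := t.1
  suffices hd : Aux.Dn π h (ev π (A ++ U1)) c δ by
    exact ⟨δ, hd, fun c' hc' => ⟨Y0, v0, x, n, t, hn, hY, hev0, hev, hc, hd.2.2.1 c' hc'⟩⟩
  have t' := t.swap Γ
  have hη : c + δ + H g = (x + H g - δ) + (n:ℕ) * (-δ) := by rw [hc]; ring
  have hin := t'.In Γ n (by omega)
  rw [← hη, ← hev] at hin
  rcases Nat.eq_zero_or_pos n with rfl | hpos
  · have e1 : 4*g-1-(0+1) = 4*g-2 := by omega
    rw [e1] at hY
    have hin0 : In π h (v0 * π x) x := by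
      have := t.In Γ 0 (by omega)
      simpa [rs, ev_single] using this
    have hne : Y0 ≠ [] := by
      rintro rfl
      rw [ev_nil] at hev0
      unfold In at hin0
      rw [← hev0, Γ.one] at hin0
      omega
    obtain ⟨Y1, c', rfl⟩ := List.eq_nil_or_concat Y0 |>.resolve_left hne
    simp only [List.concat_eq_append] at *
    have hc'x : c' ≠ x := by
      rintro rfl
      apply hno Y1 [] δ c' hδ
      rw [hY, List.append_nil, List.append_assoc]
      congr 1
      conv_rhs => rw [rs_split _ _ 1 (4*g-2) (by omega)]
      simp [rs]
    have hup : In π h (v0 * π x) c' := by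
      rw [← hev0]
      rcases List.append_eq_append_iff.1 hY with ⟨a, h1, h2⟩ | ⟨a, h1, h2⟩
      · exfalso
        rw [h2] at hU
        exact run_not Γ hg hδ (4*g-2) (by omega) (hU.sub_word Γ)
      · rw [h1] at hA
        exact (hA.left Γ).In Γ
    have hback : x + δ ≠ c' + H g := by
      have e2 : 4*g-2 = 4*g-3+1 := by omega
      rw [hY, e2, rs, List.append_assoc, List.singleton_append] at hf
      exact hf.mid
    have hv0 : In π h v0 (x + δ) := by
      rcases Γ.pair hδ hin0 hup with h3 | h3 | h3
      · exact absurd h3 hc'x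
      · exact absurd (by rw [h3]; linear_combination -hHH) hback
      · have := Γ.Qc hg hδ.neg hin0 hup (by rw [h3]; ring)
        rw [mul_inv_cancel_right] at this
        convert this using 1
        ring
    have hno2 : ¬ In π h v0 (c + H g) := by
      intro h4
      rcases Γ.pair hδ hv0 h4 with h5 | h5 | h5
      · exact hδ.nzH (-3) (by omega) (by omega) (by
          rw [hc] at h5; push_cast at h5 ⊢; linear_combination h5)
      · exact hδ.nz' (-4) (by omega) (by omega) (by omega) (by
          rw [hc] at h5; push_cast at h5 ⊢; linear_combination h5)
      · exact hδ.nz' (-2) (by omega) (by omega) (by omega) (by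
          rw [hc] at h5; push_cast at h5 ⊢; linear_combination h5)
    have hev' : ev π (A ++ U1) = v0 * π (c + δ + H g) := by
      rw [hev, hη]
      simp [rs, ev_single]
    refine ⟨hδ, hin, ?_, ?_⟩
    · intro e he
      rcases Γ.pair hδ hin he with h3 | h3 | h3
      · exact h3
      · exfalso
        apply hno2
        have := Γ.Qc hg hδ hin he h3
        rw [hev', mul_inv_cancel_right] at this
        convert this using 1
        ring
      · exfalso
        have := Γ.Qc hg hδ.neg hin he (by rw [h3]; ring)
        rw [hev', mul_inv_cancel_right] at this
        apply Γ.excl hin0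
        convert this using 1
        rw [hc]; push_cast; ring
    · rw [hev', mul_inv_cancel_right]
      exact hno2
  · refine ⟨hδ, hin, ?_, ?_⟩
    · intro e he
      rw [hev] at he
      rw [hη]
      exact t'.uniq Γ hg n hpos hn he
    · intro h3
      rw [hev, Tile.snoc, hη, mul_inv_cancel_right] at h3
      obtain ⟨n, rfl⟩ : ∃ k, n = k + 1 := ⟨n-1, by omega⟩
      have h4 := t'.In Γ n (by omega)
      refine Γ.D2 hg hδ h3 h4 ?_
      push_cast at hη ⊢
      linear_combination -hη

/-- The structure lemma. -/
theorem struct (Γ : Geo π h) (hg : 2 ≤ g) {A} (hA : Gde π h A) (U1 : List (ZMod (4*g))) :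
    ∀ U2, Gde π h (U1 ++ U2) → FRed (A ++ U1) →
      (∀ P Q δ x, Sg δ → A ++ U1 ≠ P ++ rs δ x (4*g-1) ++ Q) →
      ASt π h (A ++ U1) ∧ (A ++ U1 = [] ∨ ∃ Y c, A ++ U1 = Y ++ [c] ∧
        (In π h (ev π (A ++ U1)) c ∨ SD π h (A ++ U1) c)) := by
  have hHH := H_add_H (g := g)
  induction U1 using List.reverseRecOn with
  | nil =>
    intro U2 hU hf hno
    rw [List.append_nil]
    refine ⟨hA.ASt Γ, ?_⟩
    rcases List.eq_nil_or_concat A with h1 | ⟨Y, c, h1⟩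
    · exact Or.inl h1
    · right
      rw [List.concat_eq_append] at h1
      exact ⟨Y, c, h1, Or.inl (h1 ▸ (h1 ▸ hA : Gde π h (Y ++ [c])).In Γ)⟩
  | append_singleton U1 c ih =>
    intro U2 hU hf hno
    rw [← List.append_assoc] at hf hno ⊢
    rw [List.append_assoc] at hU
    have hno' : ∀ P Q δ x, Sg δ → A ++ U1 ≠ P ++ rs δ x (4*g-1) ++ Q := by
      intro P Q δ x hδ h1
      exact hno P (Q ++ [c]) δ x hδ (by rw [h1]; simp)
    obtain ⟨ih1, ih2⟩ := ih _ hU hf.left hno'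
    have hevc : ev π (A ++ U1 ++ [c]) = ev π (A ++ U1) * π c := by rw [ev_append, ev_single]
    rcases Γ.dich (ev π (A ++ U1)) c with hup | hdn
    · rw [← hevc] at hup
      exact ⟨ih1.snoc (Or.inl hup), Or.inr ⟨_, c, rfl, Or.inl hup⟩⟩
    suffices hsd : SD π h (A ++ U1 ++ [c]) c ∧ ∀ δ, Sg δ → Dn π h (ev π (A ++ U1 ++ [c])) c δ →
        ∃ r, CH δ (c + H g) r ++ [c] <:+ A ++ U1 ++ [c] by
      refine ⟨ih1.snoc (Or.inr ?_), Or.inr ⟨_, c, rfl, Or.inr hsd.1⟩⟩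
      have h1 := hsd.1
      rw [List.append_assoc] at h1
      obtain ⟨δ, hd, -⟩ := h1.Dn Γ hg hA (U1 := U1 ++ [c]) (U2 := U2) (by simpa using hU) (by simpa using hf)
        (by simpa using hno)
      rw [← List.append_assoc] at hd
      obtain ⟨r, hr⟩ := hsd.2 δ hd.1 hd
      exact ⟨δ, r, hd, hr⟩
    -- the sign is determined by the state
    have hsign : ∀ δ ε, Sg δ → Dn π h (ev π (A ++ U1 ++ [c])) c ε →
        In π h (ev π (A ++ U1 ++ [c])) (c + δ + H g) → ε = δ := by
      intro δ ε hδ hε h1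
      have := hε.2.2.1 _ h1
      linear_combination -this
    rcases ih2 with h0 | ⟨Y, c0, hY, hst⟩
    · exfalso
      rw [h0, ev_nil] at hdn
      unfold In at hdn
      rw [Γ.one] at hdn
      omega
    rcases hst with hup | hsd
    · -- a new peak
      have hcc : c ≠ c0 + H g := by
        rw [hY, List.append_assoc, List.singleton_append] at hf
        exact hf.mid
      obtain ⟨δ, hδ, e1⟩ : ∃ δ, Sg δ ∧ c + H g = c0 + δ + H g := by
        rcases Γ.pair (δ := 1) (Or.inl rfl) hup hdn with h1 | h1 | h1
        · exact absurd (by rw [← h1]; linear_combination -hHH) hcc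
        · exact ⟨1, Or.inl rfl, h1⟩
        · exact ⟨-1, Or.inr rfl, by rw [h1]; ring⟩
      obtain ⟨x, hx⟩ : ∃ x, x = c + H g := ⟨_, rfl⟩
      have hc : c = x + H g := by rw [hx]; linear_combination -hHH
      have hc0 : c0 = x + H g - δ := by rw [hx]; linear_combination -e1 - hHH
      rw [← hx] at hdn
      obtain ⟨r, hr⟩ := lemC Γ hg hδ _ (A ++ U1) Y rfl hf.left ih1 (hc0 ▸ hY) (hc0 ▸ hup) hdn
      obtain ⟨v0, hv0, t⟩ := Γ.tile hg hδ hup hdn (by rw [← e1, ← hx])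
      have hevn : ev π (A ++ U1 ++ [c]) = v0 * ev π (rs (-δ) (x + H g - δ) (2*g-2+1)) := by
        have e2 : 2*g-2+1 = 2*g-1 := by omega
        have e3 : x + H g - δ + H g - -δ = x := by linear_combination hHH
        rw [hevc, hv0, Γ.rel _ _ hδ, rs_last hg _ hδ.neg, ev_append, ev_single, e3, hc, Γ.inv, e2]
        group
      have hcast : ((2*g-2 : ℕ):ZMod (4*g)) = 2*(g:ZMod (4*g)) - 2 := by
        have : 2 ≤ 2*g := by omega
        push_cast [this]; ring
      refine ⟨?_, ?_⟩
      · obtain ⟨P', hP'⟩ := hr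
        obtain ⟨P, hP⟩ := CH_tail hg δ x r
        rw [hP, ← List.append_assoc] at hP'
        refine ⟨P' ++ P, v0, x, δ, 2*g-2, t, by omega, ?_, ?_, hevn, ?_⟩
        · have e4 : 4*g-1-(2*g-2+1) = 2*g := by omega
          rw [e4, rs_last hg _ hδ, ← hP', hc, List.append_assoc]
          congr 3
          ring
        · rw [← hP', rs_cons hg, ev_append, ev_cons, ← mul_assoc] at hv0
          exact mul_right_cancel hv0
        · rw [hcast, hc, hδ.H]
          linear_combination δ * four_g (g := g)
      · intro ε hε hd
        have hin := (t.swap Γ).In Γ (2*g-2) (by omega)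
        rw [← hevn, hcast] at hin
        have := hsign δ ε hδ hd (by
          convert hin using 1
          rw [hc]; linear_combination hHH - hδ.H)
        subst this
        refine ⟨r, ?_⟩
        rw [← hx]
        obtain ⟨P', hP'⟩ := hr
        exact ⟨P', by rw [← hP', List.append_assoc]⟩
    · -- going on downwards
      obtain ⟨δ, hd, hd2⟩ := hsd.Dn Γ hg hA hU hf.left hno'
      obtain ⟨Y0, v0, x, n, t, hn, hY0, hev0, hev, hc0, hce⟩ := hd2 _ hdn
      have hδ := hd.1
      have hc : c = x - ((n:ℕ) + 1) * δ := by linear_combination hce + hc0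
      have hlast : A ++ U1 ++ [c] = Y0 ++ rs δ (x + δ) (4*g-1-n) := by
        have e2 : 4*g-1-n = 4*g-1-(n+1)+1 := by omega
        rw [e2, rs_succ, hY0, List.append_assoc, cast_sub hg n hn, hc]
        congr 3
        ring
      rcases Nat.eq_zero_or_pos n with rfl | hpos
      · exact absurd (by simpa using hlast) (hno Y0 [] δ (x + δ) hδ)
      obtain ⟨n, rfl⟩ : ∃ k, n = k + 1 := ⟨n-1, by omega⟩
      have hevn : ev π (A ++ U1 ++ [c]) = v0 * ev π (rs (-δ) (x + H g - δ) (n+1)) := by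
        rw [hevc, hev, Tile.snoc]
        have e3 : x + H g - δ + ((n+1:ℕ):ZMod (4*g)) * -δ = c + H g := by
          rw [hc]; push_cast; ring
        rw [e3, Γ.inv]; group
      refine ⟨⟨Y0, v0, x, δ, n, t, by omega, hlast, hev0, hevn, by rw [hc]; push_cast; ring⟩, ?_⟩
      intro ε hε hd'
      have hin := (t.swap Γ).In Γ n (by omega)
      rw [← hevn] at hin
      have := hsign δ ε hδ hd' (by
        convert hin using 1
        rw [hc]; push_cast; ring)
      subst this
      refine ⟨0, Y0 ++ rs ε (x + ε) (2*g-3-n), ?_⟩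
      have h2 : ((2*g-3-n : ℕ) : ZMod (4*g)) = H g - 3 - (n:ℕ) := by
        have : ((2*g-3-n + (n+3) : ℕ) : ZMod (4*g)) = H g := by
          have : 2*g-3-n + (n+3) = 2*g := by omega
          rw [this]; rfl
        rw [Nat.cast_add] at this
        push_cast at this
        linear_combination this
      rw [hlast, rs_split (k := 4*g-1-(n+1)) ε (x+ε) (2*g-3-n) (2*g+1) (by omega), rs_succ, CH, h2, List.append_assoc]
      have e4 : x + ε + (H g - 3 - (n:ℕ)) * ε = c + H g := by
        rw [hc]; push_cast
        rcases hε with rfl | rfl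
        · ring
        · linear_combination -hHH
      have e5 : c + H g + ((2*g:ℕ):ZMod (4*g)) * ε = c := by
        push_cast
        linear_combination hHH - hε.H
      rw [e4, e5]

end C
end Aux
end SG

namespace SG
namespace Aux

section D

theorem straddle {α : Type*} {A U P R Q : List α} (h : A ++ U = P ++ R ++ Q) :
    (∃ Q', A = P ++ R ++ Q') ∨ (∃ P', P = A ++ P' ∧ U = P' ++ R ++ Q) ∨
    ∃ R1 R2, R1 ≠ [] ∧ R2 ≠ [] ∧ R = R1 ++ R2 ∧ A = P ++ R1 ∧ U = R2 ++ Q := by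
  rcases List.append_eq_append_iff.1 h with ⟨a, h1, h2⟩ | ⟨a, h1, h2⟩
  · rcases List.append_eq_append_iff.1 h1 with ⟨d, h3, h4⟩ | ⟨d, h3, h4⟩
    · by_cases hd : d = []
      · subst hd
        right; left; exact ⟨[], by simpa using h3.symm, by rw [h2, h4]; simp⟩
      by_cases ha : a = []
      · subst ha
        left; exact ⟨[], by simpa using h1.symm⟩
      right; right
      exact ⟨d, a, hd, ha, h4, h3, h2⟩
    · right; left
      exact ⟨d, h3, by rw [h2, h4]⟩
  · left; exact ⟨a, h1⟩

variable {g : ℕ}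

theorem rs_pre {δ z : ZMod (4*g)} {N : ℕ} {R1 R2} (h : rs δ z N = R1 ++ R2) :
    R1 = rs δ z R1.length ∧ R2 = rs δ (z + (R1.length : ℕ) * δ) (N - R1.length) ∧
      R1.length + R2.length = N := by
  have hl := congrArg List.length h
  rw [rs_length, List.length_append] at hl
  rw [rs_split δ z R1.length (N - R1.length) (by omega)] at h
  obtain ⟨h1, h2⟩ := List.append_inj h (by rw [rs_length])
  exact ⟨h1.symm, h2.symm, hl.symm⟩

theorem straddle_rs {A U P Q : List (ZMod (4*g))} {δ z N} (h : A ++ U = P ++ rs δ z N ++ Q) :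
    (∃ Q', A = P ++ rs δ z N ++ Q') ∨ (∃ P', P = A ++ P' ∧ U = P' ++ rs δ z N ++ Q) ∨
    ∃ m k, 0 < m ∧ 0 < k ∧ m + k = N ∧ A = P ++ rs δ z m ∧ U = rs δ (z + (m:ℕ) * δ) k ++ Q := by
  rcases straddle h with h1 | h1 | ⟨R1, R2, n1, n2, h1, h2, h3⟩
  · exact Or.inl h1
  · exact Or.inr (Or.inl h1)
  · right; right
    obtain ⟨e1, e2, e3⟩ := rs_pre h1
    refine ⟨R1.length, R2.length, List.length_pos_of_ne_nil n1, List.length_pos_of_ne_nil n2, e3, ?_, ?_⟩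
    · rw [← e1]; exact h2
    · have : R2.length = N - R1.length := by omega
      rw [this, ← e2]; exact h3

theorem CH_head (δ x : ZMod (4*g)) (r : ℕ) : ∃ Q, CH δ x r = rs δ x (2*g) ++ Q := by
  induction r with
  | zero => exact ⟨[], by simp [CH]⟩
  | succ r ih =>
    obtain ⟨Q, h⟩ := ih
    exact ⟨Q ++ rs δ (x + δ) (2*g-1), by rw [CH, h]; simp⟩

theorem CH_pow (hg : 2 ≤ g) (δ x : ZMod (4*g)) (r : ℕ) :
    CH δ x r = x :: (List.replicate (r+1) (rs δ (x + δ) (2*g-1))).flatten := by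
  induction r with
  | zero => simp [CH, rs_cons hg]
  | succ r ih =>
    rw [CH, ih, List.replicate_succ' (n := r+1)]
    simp

theorem CH_pre (hg : 2 ≤ g) (δ x : ZMod (4*g)) (r : ℕ) : ∀ R1 R2, CH δ x r = R1 ++ R2 → R1 ≠ [] →
    R1 = [x] ∨ ∃ (m : ℕ) (R' : List (ZMod (4*g))) (p : ZMod (4*g)), m + 2 ≤ 2*g ∧
      R1 = R' ++ [p, x + (m+1:ℕ) * δ] ∧ (p = x + (m:ℕ) * δ ∨ (m = 0 ∧ p = x + (2*g-1:ℕ) * δ)) := by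
  induction r with
  | zero =>
    intro R1 R2 h h0
    rw [CH] at h
    obtain ⟨e1, e2, e3⟩ := rs_pre h
    have := List.length_pos_of_ne_nil h0
    rcases Nat.lt_or_ge R1.length 2 with h1 | h1
    · left
      have : R1.length = 1 := by omega
      rw [e1, this]; simp [rs]
    · right
      obtain ⟨m, hm⟩ : ∃ m, R1.length = m + 1 + 1 := ⟨R1.length - 2, by omega⟩
      refine ⟨m, rs δ x m, x + (m:ℕ) * δ, by omega, ?_, Or.inl rfl⟩
      rw [e1, hm, rs_succ, rs_succ]; simp
  | succ r ih =>
    intro R1 R2 h h0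
    rw [CH] at h
    rcases List.append_eq_append_iff.1 h with ⟨a, h1, h2⟩ | ⟨a, h1, h2⟩
    · obtain ⟨e1, e2, e3⟩ := rs_pre h2
      rcases Nat.lt_or_ge a.length 2 with h3 | h3
      · rcases Nat.lt_or_ge a.length 1 with h4 | h4
        · have : a = [] := List.length_eq_zero_iff.1 (by omega)
          rw [this, List.append_nil] at h1
          exact ih R1 [] (by rw [h1, List.append_nil]) h0
        · right
          obtain ⟨P, hP⟩ := CH_tail hg δ x r
          have h5 : a.length = 1 := by omega
          obtain ⟨k, hk⟩ : ∃ k, 2*g-1 = k+1 := ⟨2*g-2, by omega⟩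
          rw [h1, e1, h5, hP, hk, rs_succ]
          refine ⟨0, P ++ rs δ (x + δ) k, x + δ + (k:ℕ) * δ, by omega, by simp [rs], Or.inr ⟨rfl, ?_⟩⟩
          push_cast; ring
      · right
        obtain ⟨m, hm⟩ : ∃ m, a.length = m + 1 + 1 := ⟨a.length - 2, by omega⟩
        refine ⟨m+1, CH δ x r ++ rs δ (x + δ) m, x + δ + (m:ℕ) * δ, by omega, ?_, Or.inl ?_⟩
        · rw [h1, e1, hm, rs_succ, rs_succ]
          simp only [List.append_assoc, List.singleton_append]
          congr 4
          push_cast; ring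
        · push_cast; ring
    · exact ih R1 a h1 h0

/-- goodness of half relators -/
structure GdP (Gd : ZMod (4*g) → ZMod (4*g) → Prop) : Prop where
  g1 : ∀ x ε, Sg ε → Gd x ε → ¬ Gd (x + H g - ε) (-ε)
  g2 : ∀ x ε, Sg ε → Gd x ε → Gd (x - ε) (-ε)

variable {G : Type*} [Group G] {π : ZMod (4*g) → G} {h : G → ℕ}
  {Gd : ZMod (4*g) → ZMod (4*g) → Prop}

/-- fine words -/
def Fine (π : ZMod (4*g) → G) (h : G → ℕ) (Gd : ZMod (4*g) → ZMod (4*g) → Prop)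
    (W : List (ZMod (4*g))) : Prop :=
  Gde π h W ∧ ∀ P Q δ x, Sg δ → W = P ++ rs δ x (2*g) ++ Q → Gd x δ

theorem Fine.CH {W P Q δ x r} (hW : Fine π h Gd W) (hδ : Sg δ) (e : W = P ++ CH δ x r ++ Q) :
    Gd x δ := by
  obtain ⟨Q', hQ⟩ := CH_head δ x r
  exact hW.2 P (Q' ++ Q) δ x hδ (by rw [e, hQ]; simp)

/-- a bad half relator has to straddle -/
theorem bad {A U P Q : List (ZMod (4*g))} {δ z} (hA : Fine π h Gd A) (hU : Fine π h Gd U)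
    (hδ : Sg δ) (hb : ¬ Gd z δ) (e : A ++ U = P ++ rs δ z (2*g) ++ Q) :
    ∃ m : ℕ, m + 2 ≤ 2*g ∧ ∃ P', A = P' ++ [z + (m:ℕ) * δ] := by
  rcases straddle_rs e with ⟨Q', h1⟩ | ⟨P', -, h1⟩ | ⟨m, k, h1, h2, h3, h4, h5⟩
  · exact absurd (hA.2 _ _ _ _ hδ h1) hb
  · exact absurd (hU.2 _ _ _ _ hδ h1) hb
  · obtain ⟨m, rfl⟩ : ∃ m', m = m' + 1 := ⟨m - 1, by omega⟩
    refine ⟨m, by omega, P ++ rs δ z m, ?_⟩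
    rw [h4, rs_succ]; simp

theorem last_inj {P P' : List (ZMod (4*g))} {a b} (h : P ++ [a] = P' ++ [b]) : P = P' ∧ a = b := by
  obtain ⟨h1, h2⟩ := List.append_inj' h rfl
  exact ⟨h1, (List.cons.inj h2).1⟩

theorem last_inj2 {P P' : List (ZMod (4*g))} {a b c d} (h : P ++ [a, c] = P' ++ [b, d]) :
    P = P' ∧ a = b ∧ c = d := by
  obtain ⟨h1, h2⟩ := List.append_inj' h rfl
  simp at h2
  exact ⟨h1, h2⟩

/-- matching back -/
theorem matchb (Γ : Geo π h) (hg : 2 ≤ g) {W Z : List (ZMod (4*g))} {σ y : ZMod (4*g)} {n : ℕ}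
    (hσ : Sg σ) (hf : FRed (W ++ [y + (n+1:ℕ) * σ])) (hs : ASt π h W)
    (hV : Gde π h (Z ++ rs σ (y + σ) n)) (hev : ev π W = ev π (Z ++ rs σ (y + σ) n)) (k : ℕ) :
    ∀ j, j + 1 + k = n → ∃ Y, W ++ [y + (n+1:ℕ) * σ] = Y ++ rs σ (y + (j+2:ℕ) * σ) (k+1) ∧
      ev π Y = ev π (Z ++ rs σ (y + σ) (j+1)) := by
  have hHH := H_add_H (g := g)
  induction k with
  | zero =>
    intro j hj
    refine ⟨W, ?_, ?_⟩
    · have : j + 2 = n + 1 := by omega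
      rw [this]; simp [rs]
    · rw [hev]; simp at hj; rw [hj]
  | succ k ih =>
    intro j hj
    obtain ⟨Y, h1, h2⟩ := ih (j+1) (by omega)
    have hV1 : ∀ i ≤ n, Gde π h (Z ++ rs σ (y + σ) i) := by
      intro i hi
      rw [rs_split _ _ i (n-i) (by omega), ← List.append_assoc] at hV
      exact hV.left Γ
    have hI : ∀ i, i + 1 ≤ n → In π h (ev π (Z ++ rs σ (y + σ) (i+1))) (y + (i+1:ℕ) * σ) := by
      intro i hi
      have := hV1 (i+1) hi
      rw [rs_succ, ← List.append_assoc] at this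
      have := this.In Γ
      rw [List.append_assoc, ← rs_succ] at this
      convert this using 1
      push_cast; ring
    have hb : ev π (Z ++ rs σ (y + σ) (j+1+1)) * (π (y + (j+1+1:ℕ) * σ))⁻¹ =
        ev π (Z ++ rs σ (y + σ) (j+1)) := by
      rw [rs_succ, ← List.append_assoc, ev_append, ev_single]
      have : y + σ + (j+1:ℕ) * σ = y + (j+1+1:ℕ) * σ := by push_cast; ring
      rw [this, mul_inv_cancel_right]
    have hne : Y ≠ [] := by
      rintro rfl
      have := hI (j+1) (by omega)
      rw [← h2] at this
      unfold In at this
      rw [ev_nil, Γ.one] at this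
      omega
    obtain ⟨Y2, c, rfl⟩ := List.eq_nil_or_concat Y |>.resolve_left hne
    simp only [List.concat_eq_append] at *
    have hnb : y + (j+3:ℕ) * σ ≠ c + H g := by
      rw [h1, rs, List.append_assoc, List.singleton_append] at hf
      exact hf.mid
    have hpre : Y2 ++ [c] <+: W := by
      rw [rs_succ, ← List.append_assoc] at h1
      exact ⟨_, (last_inj h1).1.symm⟩
    have i1 := hI (j+1) (by omega)
    have i0 := hI j (by omega)
    have hc : c = y + (j+2:ℕ) * σ := by
      rw [← h2] at i1 hb
      rcases hs Y2 c hpre with h3 | ⟨ε, r, ⟨d1, d2, d3, d4⟩, -⟩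
      · rcases Γ.pair hσ i1 h3 with h4 | h4 | h4
        · exact h4
        · exfalso; apply hnb; rw [h4]; push_cast; linear_combination -hHH
        · exfalso
          have := Γ.Qc hg hσ.neg i1 h3 (by rw [h4]; ring)
          rw [hb] at this
          exact Γ.D2 hg hσ i0 this (by push_cast; ring)
      · exfalso
        have e1 := d3 _ i1
        rcases hσ.eq_or d1 with rfl | rfl
        · apply d4
          rw [← e1, hb]
          convert i0 using 1
          push_cast at e1 ⊢
          linear_combination -e1
        · apply hnb
          push_cast at e1 ⊢
          linear_combination e1
    refine ⟨Y2, ?_, ?_⟩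
    · have e : y + (j+1+2:ℕ) * σ = y + (j+2:ℕ) * σ + σ := by push_cast; ring
      rw [h1, rs.eq_2 _ _ (k+1), hc, List.append_assoc, e]; rfl
    · rw [ev_append, ev_single] at h2
      rw [← hb, ← h2]
      have : j + 1 + 1 = j + 2 := rfl
      rw [hc, this, mul_inv_cancel_right]

end D
end Aux
end SG

namespace SG
namespace Aux

section E
variable {g : ℕ}
variable {G : Type*} [Group G] {π : ZMod (4*g) → G} {h : G → ℕ}
  {Gd : ZMod (4*g) → ZMod (4*g) → Prop}

theorem Gde.In' (Γ : Geo π h) {W P : List (ZMod (4*g))} {c} (hW : Gde π h W) (e : W = P ++ [c]) :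
    Aux.In π h (ev π W) c := by
  subst e; exact hW.In Γ

theorem Fine.left (Γ : Geo π h) {W W'} (hW : Fine π h Gd (W ++ W')) : Fine π h Gd W :=
  ⟨hW.1.left Γ, fun P Q δ x hδ e => hW.2 P (Q ++ W') δ x hδ (by rw [e]; simp)⟩

/-- two geodesic-like words ending at the same vertex with different last letters -/
theorem bigon (Γ : Geo π h) (hg : 2 ≤ g) {σ b : ZMod (4*g)} (hσ : Sg σ) {V : List (ZMod (4*g))} {V' W W'}
    (hV : Fine π h Gd V) (e1 : V = V' ++ [b]) (hf : FRed W) (hs : ASt π h W)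
    (e2 : W = W' ++ [b - σ + H g]) (hev : ev π W = ev π V) (hup : In π h (ev π W) (b - σ + H g)) :
    Gd (b - σ + H g) (-σ) ∧ ∃ r, CH σ b r <:+ W := by
  have hHH := H_add_H (g := g)
  have ib := hV.1.In' Γ e1
  constructor
  · have hb : b - σ + H g + H g - -σ = b := by linear_combination hHH
    obtain ⟨r, P, hP⟩ := lemC Γ hg (x := b - σ + H g) hσ.neg _ V V' rfl (hV.1.FRed Γ) (hV.1.ASt Γ)
      (by rw [hb]; exact e1) (by rw [hb]; exact ib) (by rw [← hev]; exact hup)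
    exact hV.CH (P := P) (Q := []) hσ.neg (by rw [hP]; simp)
  · have hb : b + H g - σ = b - σ + H g := by ring
    exact lemC Γ hg (x := b) hσ _ W W' rfl hf hs (by rw [hb]; exact e2) (by rw [hb]; exact hup)
      (by rw [hev]; exact ib)

theorem core' (Γ : Geo π h) (hg : 2 ≤ g) (hGd : GdP Gd) {A U Z A1 : List (ZMod (4*g))}
    {σ y l : ZMod (4*g)} {n : ℕ} (hσ : Sg σ)
    (hA : Fine π h Gd A) (hU : Fine π h Gd U) (hV : Fine π h Gd (Z ++ rs σ (y + σ) n))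
    (hev : ev π (A ++ U) = ev π (Z ++ rs σ (y + σ) n))
    (hn : (n = 2*g-1 ∧ l = y) ∨ (n = 2*g ∧ l = y + σ))
    (hl : A = A1 ++ [l + σ, l]) (hf : FRed (A ++ U ++ [y + (n+1:ℕ) * σ]))
    (hZ : ∀ Z', Z ≠ Z' ++ [y])
    (hno : ∀ P Q δ x, Sg δ → A ++ U ≠ P ++ rs δ x (4*g-1) ++ Q)
    (hY : ∀ Y, A ++ U = Y ++ rs σ (y + σ) n → ∃ Y', Y = Y' ++ [y]) :
    n = 2*g-1 ∧ ∃ r, U = (List.replicate (r+1) (rs σ (y + σ) (2*g-1))).flatten ++ [y + H g] ++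
      rs σ (y + 2 * σ) (2*g-2) := by
  have hHH := H_add_H (g := g)
  have hs : ASt π h (A ++ U) := (struct Γ hg hA.1 U [] (by simpa using hU.1) hf.left hno).1
  have hn0 : 2*g-1 ≤ n := by omega
  obtain ⟨Y, h1, h2⟩ := matchb Γ hg hσ hf hs hV.1 hev (n-1) 0 (by omega)
  have e1 : n - 1 + 1 = n := by omega
  have e2 : y + (0+2:ℕ) * σ = y + 2 * σ := by push_cast; ring
  have e3 : rs σ (y + σ) (0 + 1) = [y + σ] := by simp [rs]
  have hl' : A = (A1 ++ [l + σ]) ++ [l] := by rw [hl]; simp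
  rw [e1, e2] at h1
  rw [e3] at h2
  have hVb : Fine π h Gd (Z ++ [y + σ]) := by
    rw [rs_split _ _ 1 (n-1) (by omega), ← List.append_assoc] at hV
    have := hV.left Γ
    simpa [rs] using this
  have ib := hVb.1.In Γ
  have hne : Y ≠ [] := by
    rintro rfl
    rw [← h2] at ib
    unfold In at ib
    rw [ev_nil, Γ.one] at ib
    omega
  obtain ⟨Y2, c, rfl⟩ := List.eq_nil_or_concat Y |>.resolve_left hne
  simp only [List.concat_eq_append] at *
  have hnb : y + 2 * σ ≠ c + H g := by
    rw [h1, ← e1, rs, List.append_assoc, List.singleton_append] at hf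
    exact hf.mid
  have hW : A ++ U = Y2 ++ [c] ++ rs σ (y + 2 * σ) (n-1) := by
    rw [← e1, rs_succ, ← List.append_assoc] at h1
    exact (last_inj h1).1
  have hfY : FRed (Y2 ++ [c]) := by rw [hW] at hf; exact hf.left.left
  have hsY : ASt π h (Y2 ++ [c]) := by rw [hW] at hs; exact hs.left
  have hchg : y + σ - σ + H g = y + H g := by ring
  rcases hs Y2 c ⟨_, hW.symm⟩ with h3 | ⟨ε, r, ⟨d1, d2, d3, d4⟩, hch⟩
  · rcases Γ.pair hσ (h2 ▸ ib) h3 with h4 | h4 | h4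
    · -- (ii)
      have hW2 : A ++ U = Y2 ++ rs σ (y + σ) n := by
        rw [hW, h4, ← e1, rs, List.append_assoc, e1]
        have : y + σ + σ = y + 2 * σ := by ring
        rw [this]; rfl
      obtain ⟨Y3, rfl⟩ := hY Y2 hW2
      have hW3 : A ++ U = Y3 ++ rs σ y (n+1) ++ [] := by
        rw [hW2, rs, List.append_nil, List.append_assoc]; rfl
      have hevZ : ev π (Y3 ++ [y]) = ev π Z := by
        rw [ev_append, ev_append (W := Z), h4] at h2
        exact mul_right_cancel h2
      rcases hn with ⟨hn, rfl⟩ | ⟨hn, rfl⟩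
      · -- n = 2g-1
        have hn1 : n + 1 = 2*g := by omega
        rw [hn1] at hW3
        -- the reversed run gives a contradiction
        have key : Gd l σ → ∀ P Q, A ++ U ≠ P ++ rs (-σ) (l + H g - σ) (2*g) ++ Q := by
          intro hg1 P Q hPQ
          obtain ⟨m, hm, P', hP'⟩ := bad hA hU hσ.neg (hGd.g1 _ _ hσ hg1) hPQ
          have := (last_inj (hl'.symm.trans hP')).2
          exact hσ.nzH (-((m:ℤ)+1)) (by omega) (by omega) (by push_cast; linear_combination -this)
        rcases hs Y3 l ⟨_, hW2.symm⟩ with h5 | ⟨ε, r, ⟨d1, d2, d3, d4⟩, hch⟩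
        · have hne : Z ≠ [] := by
            rintro rfl
            rw [hevZ, ev_nil] at h5
            unfold In at h5
            rw [Γ.one] at h5
            omega
          obtain ⟨Z', β, rfl⟩ := List.eq_nil_or_concat Z |>.resolve_left hne
          simp only [List.concat_eq_append] at *
          have hVZ : Fine π h Gd (Z' ++ [β]) := hV.left Γ
          have h6 := hVZ.1.In Γ
          rw [← hevZ] at h6
          rcases Γ.pair hσ h5 h6 with h7 | h7 | h7
          · exact absurd (by rw [h7]) (hZ Z')
          · exfalso
            have := hV.1.FRed Γ
            rw [← e1, rs, List.append_assoc, List.singleton_append] at this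
            apply this.mid
            rw [h7]; linear_combination -hHH
          · exfalso
            have hβ : β - -σ + H g = l := by rw [h7]; linear_combination hHH
            obtain ⟨q1, r, P, hP⟩ := bigon Γ hg (σ := -σ) (b := β) hσ.neg hVZ rfl hfY.left hsY.left
              (W' := Y3) (by rw [hβ]) hevZ (by rw [hβ]; exact h5)
            rw [hβ, neg_neg] at q1
            obtain ⟨Q, hQ⟩ := CH_head (-σ) β r
            have hβ2 : l + H g - σ = β := by rw [h7]; ring
            refine key q1 P (Q ++ rs σ (l + σ) n) ?_
            rw [hW2, ← hP, hQ, hβ2]; simp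
        · exfalso
          have q1 : Gd l σ := by
            have hW4 : A ++ U = Y3 ++ [l] ++ rs σ (l + σ) n := by rw [hW2]
            rcases straddle hW4 with ⟨Q', h6⟩ | ⟨P', h5, h6⟩ | ⟨R1, R2, q1, q2, q3, q4, q5⟩
            · rw [h6] at hA
              have := d3 _ ((hA.1.left Γ).In Γ)
              exact absurd (by push_cast; linear_combination -this) (d1.nzH 1 (by omega) (by omega))
            · refine hU.2 P' [] σ l hσ ?_
              rw [h6, ← hn1, rs]; simp
            · have := congrArg List.length q3
              have := List.length_pos_of_ne_nil q1
              have := List.length_pos_of_ne_nil q2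
              simp at *
              omega
          rcases hσ.eq_or d1 with rfl | rfl
          · rw [hevZ] at d2
            rw [ev_append, ev_single] at ib
            exact Γ.excl ib d2
          · obtain ⟨P, hP⟩ := CH_tail hg (-σ) (l + H g) r
            obtain ⟨P', hP'⟩ := hch
            refine key q1 (P' ++ P) (rs σ (l + σ) n) ?_
            have e5 : l + H g - σ + H g - -σ = l := by linear_combination hHH
            have e6 : l + H g + -σ = l + H g - σ := by ring
            rw [hW2, ← hP', hP, rs_last hg _ hσ.neg, e5, e6]; simp
      · -- n = 2g
        exfalso
        rw [hn] at hW3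
        rcases straddle_rs hW3 with ⟨Q', h1⟩ | ⟨P', -, h1⟩ | ⟨m, k, h1, h2, h3, h4, h5⟩
        · rw [h1] at hA
          exact run_not Γ hg hσ _ (by omega) (hA.1.sub_word Γ)
        · rw [h1] at hU
          exact run_not Γ hg hσ _ (by omega) (hU.1.sub_word Γ)
        · obtain ⟨m, rfl⟩ : ∃ m', m = m' + 1 := ⟨m - 1, by omega⟩
          have h6 := h4
          rw [rs_succ, ← List.append_assoc] at h6
          have h7 := (last_inj (hl'.symm.trans h6)).2
          by_cases hm : m = 1
          · subst hm
            have h9 : A = Y3 ++ [y, y + σ] := by rw [h4]; simp [rs]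
            have h8 := (last_inj2 (hl.symm.trans h9)).2.1
            exact hσ.nz' 2 (by omega) (by omega) (by omega) (by push_cast; linear_combination h8)
          · exact hσ.nz' ((m:ℤ)-1) (by omega) (by omega) (by omega)
              (by push_cast; linear_combination -h7)
    · exact absurd (by rw [h4]; linear_combination -hHH) hnb
    · -- (i)
      exfalso
      have hc : c = y + σ - σ + H g := h4
      rw [hc] at h3 hsY hfY h2 hW
      obtain ⟨q1, r, P, hP⟩ := bigon Γ hg (σ := σ) (b := y + σ) hσ hVb rfl hfY hsY rfl h2 h3
      have q2 : ¬ Gd (y + σ) σ := by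
        intro q2
        apply hGd.g1 _ _ hσ q2
        convert q1 using 1
        ring
      rcases hn with ⟨hn, rfl⟩ | ⟨hn, rfl⟩
      · obtain ⟨Q, hQ⟩ := CH_head σ (l + σ) r
        obtain ⟨m, hm, P', hP'⟩ := bad (P := P) (Q := Q ++ rs σ (l + 2 * σ) (n-1)) hA hU hσ q2 (by
          rw [hW, ← hP, hQ]; simp)
        have := (last_inj (hl'.symm.trans hP')).2
        exact hσ.nz' ((m:ℤ)+1) (by omega) (by omega) (by omega) (by push_cast; linear_combination -this)
      · exact q2 (hV.2 Z [] _ _ hσ (by rw [hn]; simp))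
  · have e5 := d3 _ (h2 ▸ ib)
    rcases hσ.eq_or d1 with rfl | rfl
    · have hc : c = y + H g := by linear_combination -e5 - hHH
      have hc' : c + H g = y := by rw [hc]; linear_combination hHH
      obtain ⟨P, hP⟩ := hch
      rw [hc'] at hP
      rw [← hP] at hW
      have hng : ¬ Gde π h (CH ε y r ++ [c]) := by rw [hc]; exact CH_not Γ hg hσ r
      rcases straddle hW with ⟨Q', h6⟩ | ⟨P', h5, h6⟩ | ⟨R1, R2, q1, q2, q3, q4, q5⟩
      · exfalso
        rw [h6] at hA
        exact hng (hA.1.sub_word Γ)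
      · exfalso
        rw [h6] at hU
        exact hng (hU.1.sub_word Γ)
      · obtain ⟨R3, c', rfl⟩ := List.eq_nil_or_concat R2 |>.resolve_left q2
        rw [List.concat_eq_append, ← List.append_assoc] at q3
        obtain ⟨q6, rfl⟩ := last_inj q3
        rcases CH_pre hg ε y r R1 R3 q6 q1 with q7 | ⟨m, R', p, hm, q7, q8⟩
        · subst q7
          have q9 := (last_inj (hl'.symm.trans q4)).2
          rcases hn with ⟨hn, rfl⟩ | ⟨hn, rfl⟩
          · refine ⟨hn, r, ?_⟩
            rw [CH_pow hg, List.singleton_append] at q6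
            have e6 : n - 1 = 2*g-2 := by omega
            rw [q5, ← (List.cons.inj q6).2, List.concat_eq_append, hc, e6]
          · exact absurd (by push_cast; linear_combination q9)
              (hσ.nz' 1 (by omega) (by omega) (by omega))
        · exfalso
          rw [q7, ← List.append_assoc] at q4
          obtain ⟨-, q9, q10⟩ := last_inj2 (hl.symm.trans q4)
          rcases hn with ⟨hn, rfl⟩ | ⟨hn, rfl⟩
          · exact hσ.nz' ((m:ℤ)+1) (by omega) (by omega) (by omega)
              (by push_cast at q10 ⊢; linear_combination -q10)
          · have hm0 : m = 0 := by
              by_contra hm0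
              exact hσ.nz' (m:ℤ) (by omega) (by omega) (by omega)
                (by push_cast at q10 ⊢; linear_combination -q10)
            subst hm0
            rcases q8 with q8 | ⟨-, q8⟩
            · exact hσ.nz' 2 (by omega) (by omega) (by omega)
                (by rw [q8] at q9; push_cast at q9 ⊢; linear_combination q9)
            · rw [q8, c2g1 hg] at q9
              exact hσ.nz' (2*g-3) (by omega) (by omega) (by omega)
                (by push_cast; linear_combination -q9)
    · exact absurd (by linear_combination e5) hnb

end E
end Aux
end SG

namespace SG
namespace Aux

section F
variable {g : ℕ}
variable {G : Type*} [Group G] {π : ZMod (4*g) → G} {h : G → ℕ}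
  {Gd : ZMod (4*g) → ZMod (4*g) → Prop}

/-- the inverse of a label word -/
def zinv (W : List (ZMod (4*g))) : List (ZMod (4*g)) := (W.map (· + H g)).reverse

theorem zinv_append (W W' : List (ZMod (4*g))) : zinv (W ++ W') = zinv W' ++ zinv W := by
  simp [zinv]

theorem zinv_zinv (W : List (ZMod (4*g))) : zinv (zinv W) = W := by
  have : ((· + H g) ∘ (· + H g) : ZMod (4*g) → ZMod (4*g)) = id := by
    funext c; exact addHH c
  simp [zinv, List.map_reverse, List.map_map, this]

theorem zinv_rs (τ x : ZMod (4*g)) (n : ℕ) :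
    zinv (rs τ x (n+1)) = rs (-τ) (x + H g + (n:ℕ) * τ) (n+1) := rs_inv τ x n

theorem zinv_cons (a : ZMod (4*g)) (W) : zinv (a :: W) = zinv W ++ [a + H g] := by
  simp [zinv]

/-- locally longest (4g-1)-runs -/
def LL (W : List (ZMod (4*g))) : Prop :=
  ∃ P Q ε x, Sg ε ∧ W = P ++ rs ε x (4*g-1) ++ Q ∧ (∀ P', P ≠ P' ++ [x - ε]) ∧
    (∀ Q', Q ≠ (x - ε) :: Q')

theorem cast4 (hg : 2 ≤ g) : ((4*g-1 : ℕ) : ZMod (4*g)) = -1 := by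
  have : ((4*g-1+1 : ℕ) : ZMod (4*g)) = 0 := by
    have e : 4*g-1+1 = 4*g := by omega
    rw [e]; exact ZMod.natCast_self _
  rw [Nat.cast_add] at this
  push_cast at this
  linear_combination this

theorem full4 (Γ : Geo π h) (hg : 2 ≤ g) (hGd : GdP Gd) {A U P Q : List (ZMod (4*g))} {δ z}
    (hA : Fine π h Gd A) (hU : Fine π h Gd U) (hδ : Sg δ) : A ++ U ≠ P ++ rs δ z (4*g) ++ Q := by
  intro e
  rcases straddle_rs e with ⟨Q', h1⟩ | ⟨P', -, h1⟩ | ⟨m, k, h1, h2, h3, h4, h5⟩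
  · rw [h1] at hA
    exact run_not Γ hg hδ _ (by omega) (hA.1.sub_word Γ)
  · rw [h1] at hU
    exact run_not Γ hg hδ _ (by omega) (hU.1.sub_word Γ)
  · have hm : m ≤ 2*g := by
      by_contra hc
      rw [h4] at hA
      exact run_not Γ hg hδ m (by omega) (hA.1.right Γ)
    have hk : k ≤ 2*g := by
      by_contra hc
      rw [h5] at hU
      exact run_not Γ hg hδ k (by omega) (hU.1.left Γ)
    have hm : m = 2*g := by omega
    have hk : k = 2*g := by omega
    subst hm
    subst hk
    have q1 := hA.2 P [] δ z hδ (by rw [h4]; simp)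
    have q2 := hU.2 [] Q δ _ hδ (by rw [h5]; rfl)
    refine hGd.g1 _ _ hδ q2 ?_
    convert hGd.g2 _ _ hδ q1 using 1
    push_cast
    linear_combination H_add_H (g := g) - hδ.H

theorem noRun (Γ : Geo π h) (hg : 2 ≤ g) (hGd : GdP Gd) {A U X Z A1 X1 : List (ZMod (4*g))}
    {σ y l : ZMod (4*g)} {n : ℕ} (hσ : Sg σ) (hn : 1 ≤ n)
    (hA : Fine π h Gd A) (hU : Fine π h Gd U) (hV : Fine π h Gd (Z ++ rs σ (y + σ) n))
    (hev : ev π (A ++ U) = ev π (Z ++ rs σ (y + σ) n))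
    (hl : A = A1 ++ [l + σ, l]) (hly : l = y + (n+1:ℕ) * σ + H g)
    (hX : X = (y + (n+1:ℕ) * σ) :: X1)
    (hLL : ¬ LL (A ++ U ++ X)) {P Q : List (ZMod (4*g))} {δ z : ZMod (4*g)} (hδ : Sg δ)
    (e : A ++ U = P ++ rs δ z (4*g-1) ++ Q) : False := by
  have hHH := H_add_H (g := g)
  have e4 : 4*g = 4*g-1+1 := by omega
  have e5 : z + ((4*g-1 : ℕ) : ZMod (4*g)) * δ = z - δ := by rw [cast4 hg]; ring
  have hP : ∀ P', P ≠ P' ++ [z - δ] := by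
    rintro P' rfl
    apply full4 Γ hg hGd hA hU hδ (P := P') (Q := Q) (z := z - δ)
    rw [e, rs_split δ (z - δ) 1 (4*g-1) (by omega)]; simp [rs]
  by_cases hQ : ∃ Q', Q ++ X = (z - δ) :: Q'
  swap
  · apply hLL
    refine ⟨P, Q ++ X, δ, z, hδ, by rw [e]; simp, hP, ?_⟩
    intro Q' h1
    exact hQ ⟨Q', h1⟩
  obtain ⟨Q', hQ'⟩ := hQ
  rcases Q with _ | ⟨q, Q⟩
  swap
  · obtain ⟨rfl, -⟩ := List.cons.inj hQ'
    apply full4 Γ hg hGd hA hU hδ (P := P) (Q := Q) (z := z)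
    rw [e, rs_split δ z (4*g-1) 1 e4, e5]; simp [rs]
  rw [List.nil_append, hX] at hQ'
  have hy := (List.cons.inj hQ').1
  have hlz : l = z - δ + H g := by rw [hly, hy]
  rcases straddle_rs e with ⟨Q', h1⟩ | ⟨P', -, h1⟩ | ⟨m, k, h1, h2, h3, h4, h5⟩
  · rw [h1] at hA
    exact run_not Γ hg hδ _ (by omega) (hA.1.sub_word Γ)
  · rw [h1] at hU
    exact run_not Γ hg hδ _ (by omega) (hU.1.sub_word Γ)
  · have hm : m ≤ 2*g := by
      by_contra hc
      rw [h4] at hA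
      exact run_not Γ hg hδ m (by omega) (hA.1.right Γ)
    have hk : k ≤ 2*g := by
      by_contra hc
      rw [h5] at hU
      exact run_not Γ hg hδ k (by omega) (hU.1.left Γ)
    obtain ⟨m, rfl⟩ : ∃ m', m = m' + 1 + 1 := ⟨m - 2, by omega⟩
    have h6 : A = (P ++ rs δ z m) ++ [z + (m:ℕ) * δ, z + (m+1:ℕ) * δ] := by
      rw [h4, rs_succ, rs_succ]; simp
    obtain ⟨-, q1, q2⟩ := last_inj2 (hl.symm.trans h6)
    have hm2 : m + 1 + 1 = 2*g := by
      by_contra hc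
      exact hδ.nzH (-((m:ℤ)+2)) (by omega) (by omega) (by
        push_cast at q2 ⊢; linear_combination q2 - hlz)
    have hσδ : σ = -δ := by push_cast at q2 q1; linear_combination q1 - q2
    subst hσδ
    have hk2 : k = 2*g-1 := by omega
    subst hk2
    rw [hm2] at h4 h5
    -- the other geodesic
    have hfl : P ++ rs (-δ) (z + H g - δ) (2*g) =
        (P ++ [l]) ++ rs (-δ) (l - δ) (2*g-1) := by
      have : z + H g - δ = l := by rw [hlz]; ring
      rw [this, rs_cons hg]; simp [sub_eq_add_neg]
    have hevA : ev π A = ev π ((P ++ [l]) ++ rs (-δ) (l - δ) (2*g-1)) := by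
      rw [h4, ev_append, Γ.rel _ _ hδ, ← ev_append, hfl]
    have hgd : Gde π h ((P ++ [l]) ++ rs (-δ) (l - δ) (2*g-1)) := by
      have h7 := hA.1
      unfold Gde at h7 ⊢
      rw [← hevA, h7, ← hfl, h4]; simp [rs_length]
    have hin := (hgd.left Γ).In Γ
    have hevl : ev π (A ++ U) = ev π (P ++ [l]) := by
      have h8 := ev_inv π Γ.inv (rs δ (z + (2*g:ℕ) * δ) (2*g-2+1))
      have e6 : 2*g-2+1 = 2*g-1 := by omega
      rw [rs_inv, e6] at h8
      have e7 : z + (2*g:ℕ) * δ + H g + (2*g-2:ℕ) * δ = l - δ := by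
        have : ((2*g-2 : ℕ):ZMod (4*g)) = 2*(g:ZMod (4*g)) - 2 := by
          have : 2 ≤ 2*g := by omega
          push_cast [this]; ring
        rw [this, hlz]; push_cast; linear_combination δ * four_g (g := g)
      rw [e7] at h8
      rw [ev_append, hevA, h5, List.append_nil, ev_append, h8]; group
    rw [← hevl, hev] at hin
    have hVl : Z ++ rs (-δ) (y + -δ) n = (Z ++ rs (-δ) (y + -δ) (n-1)) ++ [l + H g - -δ] := by
      obtain ⟨n, rfl⟩ : ∃ k, n = k+1 := ⟨n-1, by omega⟩
      rw [rs_succ, ← List.append_assoc]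
      congr 2
      rw [hly]; push_cast; linear_combination -hHH
    obtain ⟨r, P', hP'⟩ := lemC Γ hg (x := l) hδ.neg _ _ _ rfl (hV.1.FRed Γ) (hV.1.ASt Γ) hVl
      (hV.1.In' Γ hVl) hin
    have g1 : Gd l (-δ) := hV.CH (P := P') (Q := []) hσ (by rw [hP']; simp)
    have g2 : Gd z δ := hA.2 P [] δ z hδ (by rw [h4]; simp)
    apply hGd.g1 _ _ hσ g1
    convert g2 using 1
    · rw [hlz]; linear_combination hHH
    · ring

theorem core (Γ : Geo π h) (hg : 2 ≤ g) (hGd : GdP Gd) {A U V X : List (ZMod (4*g))}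
    (hA : Fine π h Gd A) (hU : Fine π h Gd U) (hV : Fine π h Gd V) (hX : Fine π h Gd X)
    (hXA : A = zinv X) (hev : ev π V = ev π (A ++ U)) (hf : FRed (A ++ U ++ X))
    (hLL : ¬ LL (A ++ U ++ X)) (hLV : LL (V ++ X)) :
    ∃ σ y r Q, Sg σ ∧ X = rs σ (y + H g) (2*g) ++ Q ∧
      U = (List.replicate (r+1) (rs σ (y + σ) (2*g-1))).flatten ++ [y + H g] ++
        rs σ (y + 2 * σ) (2*g-2) := by
  have hHH := H_add_H (g := g)
  obtain ⟨P, Q, σ, x, hσ, e, hP, hQ⟩ := hLV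
  rcases straddle_rs e with ⟨Q', h1⟩ | ⟨P', -, h1⟩ | ⟨n, k, h1, h2, h3, h4, h5⟩
  · rw [h1] at hV
    exact absurd (hV.1.sub_word Γ) (run_not Γ hg hσ _ (by omega))
  · rw [h1] at hX
    exact absurd (hX.1.sub_word Γ) (run_not Γ hg hσ _ (by omega))
  · have hm : n ≤ 2*g := by
      by_contra hc
      rw [h4] at hV
      exact run_not Γ hg hσ n (by omega) (hV.1.right Γ)
    have hk : k ≤ 2*g := by
      by_contra hc
      rw [h5] at hX
      exact run_not Γ hg hσ k (by omega) (hX.1.left Γ)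
    obtain ⟨y, rfl⟩ : ∃ y, x = y + σ := ⟨x - σ, by ring⟩
    rw [add_sub_cancel_right] at hP hQ
    have ez : y + σ + (n:ℕ) * σ = y + (n+1:ℕ) * σ := by push_cast; ring
    rw [ez] at h5
    obtain ⟨l, hl⟩ : ∃ l, l = y + (n+1:ℕ) * σ + H g := ⟨_, rfl⟩
    obtain ⟨k', hk'⟩ : ∃ k', k = k' + 1 + 1 := ⟨k - 2, by omega⟩
    obtain ⟨X1, hX1⟩ : ∃ X1, X = (y + (n+1:ℕ) * σ) :: X1 := by
      rw [h5, hk', rs]; exact ⟨_, rfl⟩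
    obtain ⟨A1, hA1⟩ : ∃ A1, A = A1 ++ [l + σ, l] := by
      rw [hXA, h5, hk', rs, rs, zinv_append, zinv_cons, zinv_cons, ← hl]
      have : y + (n+1:ℕ) * σ + σ + H g = l + σ := by rw [hl]; ring
      rw [this]
      exact ⟨zinv Q ++ zinv (rs σ (y + (n+1:ℕ) * σ + σ + σ) k'), by simp⟩
    subst h4
    have hno : ∀ P Q δ x, Sg δ → A ++ U ≠ P ++ rs δ x (4*g-1) ++ Q := by
      intro P' Q' δ z hδ h6
      exact noRun Γ hg hGd hσ h1 hA hU hV hev.symm hA1 hl hX1 hLL hδ h6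
    obtain ⟨hn, r, hr⟩ := core' Γ hg hGd (l := l) (A1 := A1) hσ hA hU hV hev.symm (by
      have : n = 2*g-1 ∨ n = 2*g := by omega
      rcases this with rfl | rfl
      · left
        refine ⟨rfl, ?_⟩
        have e6 : 2*g-1+1 = 2*g := by omega
        rw [hl, e6]; push_cast; linear_combination hHH - hσ.H
      · right
        refine ⟨rfl, ?_⟩
        rw [hl]; push_cast; linear_combination hHH - hσ.H) hA1 (by
      rw [hX1] at hf
      have : A ++ U ++ (y + (n+1:ℕ) * σ) :: X1 = (A ++ U ++ [y + (n+1:ℕ) * σ]) ++ X1 := by simp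
      rw [this] at hf
      exact hf.left) hP hno (by
      intro Y hY
      by_contra hc
      push Not at hc
      apply hLL
      refine ⟨Y, Q, σ, y + σ, hσ, ?_, ?_, ?_⟩
      · rw [hY, h5, ← h3, rs_split σ (y + σ) n k rfl, ez]; simp
      · rw [add_sub_cancel_right]; exact hc
      · rw [add_sub_cancel_right]; exact hQ)
    refine ⟨σ, y, r, Q, hσ, ?_, hr⟩
    have e6 : n + 1 = 2*g := by omega
    have e7 : k = 2*g := by omega
    rw [h5, e6, e7]
    congr 2
    push_cast; linear_combination -hσ.H

end F
end Aux
end SG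

namespace SG
namespace Aux

section Gpart
variable {g : ℕ}

/-- rank of a label -/
noncomputable def zr (hg : 2 ≤ g) (z : ZMod (4*g)) : ℕ := rank g (unlab hg z)

theorem rank_inv (hg : 2 ≤ g) (a : Letter g) : rank g (invLetter g a) + rank g a = 4*g-1 := by
  obtain ⟨i, s⟩ := a
  have := i.2
  cases s <;> simp [rank, invLetter] <;> omega

theorem rank_inj (hg : 2 ≤ g) {a b : Letter g} (h : rank g a = rank g b) : a = b := by
  obtain ⟨i, s⟩ := a
  obtain ⟨j, t⟩ := b
  have := i.2
  have := j.2
  cases s <;> cases t <;> simp [rank] at h ⊢ <;> omega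

theorem zr_inv (hg : 2 ≤ g) (z : ZMod (4*g)) : zr hg (z + H g) + zr hg z = 4*g-1 := by
  obtain ⟨a, rfl⟩ := lab_surj hg z
  rw [← lab_inv, zr, zr, unlab_lab, unlab_lab, rank_inv hg]

/-- goodness -/
def gd (hg : 2 ≤ g) (x ε : ZMod (4*g)) : Prop := zr hg x < zr hg (x + H g - ε)

theorem gdP (hg : 2 ≤ g) : GdP (gd hg) where
  g1 := by
    intro x ε hε h1 h2
    unfold gd at h1 h2
    have e : x + H g - ε + H g - -ε = x := by linear_combination H_add_H (g := g)
    rw [e] at h2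
    omega
  g2 := by
    intro x ε hε h1
    unfold gd at h1 ⊢
    have e : x - ε + H g - -ε = x + H g := by ring
    have e2 : x + H g - ε = x - ε + H g := by ring
    rw [e]
    rw [e2] at h1
    have := zr_inv hg x
    have := zr_inv hg (x - ε)
    omega

theorem eval_eq (hg : 2 ≤ g) (W : Word g) : eval g W = ev (gp hg) (W.map lab) := by
  unfold eval ev
  rw [List.map_map]
  congr 2
  funext a
  exact (gp_lab hg a).symm

theorem map_lab_inj {W W' : Word g} (h : W.map lab = W'.map lab) : W = W' :=
  List.map_injective_iff.2 (fun _ _ => lab_inj) h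

theorem map_unlab (hg : 2 ≤ g) (W : List (ZMod (4*g))) : (W.map (unlab hg)).map lab = W := by
  rw [List.map_map]
  have : (lab ∘ unlab hg : ZMod (4*g) → ZMod (4*g)) = id := funext (lab_unlab hg)
  rw [this, List.map_id]

theorem map_wordInv (W : Word g) : (wordInv g W).map lab = zinv (W.map lab) := by
  unfold wordInv zinv
  rw [List.map_reverse, List.map_map, List.map_map]
  congr 2
  funext a
  exact lab_inv a

theorem lex_first {α : Type*} {r : α → α → Prop} (hr : ∀ a, ¬ r a a) {P A B : List α} {a b : α}
    (hab : a ≠ b) (h : List.Lex r (P ++ a :: A) (P ++ b :: B)) : r a b := by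
  induction P with
  | nil =>
    cases h with
    | cons _ => exact absurd rfl hab
    | rel h => exact h
  | cons p P ih =>
    cases h with
    | cons h => exact ih h
    | rel h => exact absurd h (hr _)

theorem irr_fine (hg : 2 ≤ g) {W : Word g} (hW : IrreducibleWord g W) :
    Fine (gp hg) (ht hg) (gd hg) (W.map lab) := by
  have Γ := geo hg
  have key : ∀ W' : List (ZMod (4*g)), ev (gp hg) W' = ev (gp hg) (W.map lab) →
      W.map lab = W' ∨ wordLt g W (W'.map (unlab hg)) := by
    intro W' h
    rcases hW (W'.map (unlab hg)) (by rw [eval_eq hg, eval_eq hg, map_unlab, h]) with h1 | h1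
    · left; rw [← h1, map_unlab]
    · exact Or.inr h1
  refine ⟨?_, ?_⟩
  · obtain ⟨W', h1, h2⟩ := Γ.word (ev (gp hg) (W.map lab))
    have h3 := Γ.le1 (W.map lab)
    unfold Gde
    rcases key W' h1 with h4 | h4 | ⟨h4, -⟩
    · rw [← h2, ← h4]
    · simp at *; omega
    · simp at *; omega
  · intro P Q δ x hδ e
    rcases key (P ++ rs (-δ) (x + H g - δ) (2*g) ++ Q) (by
      rw [e, ev_append, ev_append, ev_append, ev_append, Γ.rel _ _ hδ]) with h4 | h4 | ⟨-, h4⟩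
    · exfalso
      rw [e, rs_cons hg, rs_cons hg] at h4
      simp at h4
      exact hδ.nzH (-1) (by omega) (by omega) (by push_cast; linear_combination -h4.1)
    · exfalso
      have := congrArg List.length e
      simp [rs_length] at *
      omega
    · have hWu : W = (P ++ rs δ x (2*g) ++ Q).map (unlab hg) := map_lab_inj (by rw [map_unlab, e])
      rw [hWu, rs_cons hg, rs_cons hg] at h4
      simp only [List.map_append, List.map_cons, List.append_assoc, List.cons_append] at h4
      refine lex_first (r := letterLt g) (fun a h => lt_irrefl _ h) ?_ h4
      intro h5
      have h6 := congrArg lab h5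
      rw [lab_unlab, lab_unlab] at h6
      exact hδ.nzH (-1) (by omega) (by omega) (by push_cast; linear_combination -h6)

theorem ht_inv (hg : 2 ≤ g) {W : List (ZMod (4*g))} (hW : Gde (gp hg) (ht hg) W) :
    Gde (gp hg) (ht hg) (zinv W) := by
  have Γ := geo hg
  obtain ⟨W', h1, h2⟩ := Γ.word (ev (gp hg) (zinv W))
  have h3 := hW.of_le Γ (W' := zinv W') (by
    rw [zinv, ev_inv _ Γ.inv, h1, zinv, ev_inv _ Γ.inv, inv_inv])
  have h4 := Γ.le1 (zinv W)
  unfold Gde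
  simp [zinv] at *
  omega

theorem fine_inv (hg : 2 ≤ g) {W : List (ZMod (4*g))} (hW : Fine (gp hg) (ht hg) (gd hg) W) :
    Fine (gp hg) (ht hg) (gd hg) (zinv W) := by
  refine ⟨ht_inv hg hW.1, ?_⟩
  intro P Q δ x hδ e
  have h1 := congrArg zinv e
  have e2 : 2*g = 2*g-1+1 := by omega
  have e3 : rs δ x (2*g) = rs δ x (2*g-1+1) := by rw [← e2]
  rw [zinv_zinv, zinv_append, zinv_append, e3, zinv_rs, ← e2, ← List.append_assoc] at h1
  have h2 := (gdP hg).g2 _ _ hδ.neg (hW.2 _ _ _ _ hδ.neg h1)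
  convert h2 using 1
  · rw [c2g1 hg]; linear_combination -hδ.H - H_add_H (g := g)+ 2 * hδ.H
  · ring

/-- existence of minimal words -/
theorem lexmin (hg : 2 ≤ g) (n : ℕ) : ∀ S : Set (Word g), S.Nonempty → (∀ W ∈ S, W.length = n) →
    ∃ W ∈ S, ∀ W' ∈ S, W' = W ∨ List.Lex (letterLt g) W W' := by
  induction n with
  | zero =>
    rintro S ⟨W, hW⟩ hS
    refine ⟨W, hW, fun W' hW' => Or.inl ?_⟩
    rw [List.length_eq_zero_iff.1 (hS _ hW), List.length_eq_zero_iff.1 (hS _ hW')]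
  | succ n ih =>
    rintro S ⟨W, hW⟩ hS
    have hex : ∃ k, ∃ a T, a :: T ∈ S ∧ rank g a = k := by
      cases W with
      | nil => have := hS _ hW; simp at this
      | cons a T => exact ⟨_, a, T, hW, rfl⟩
    classical
    obtain ⟨a, T, hT, hr⟩ := Nat.find_spec hex
    obtain ⟨T0, h0, h1⟩ := ih {T | a :: T ∈ S} ⟨T, hT⟩ (by
      intro T hT
      have := hS _ hT
      simpa using this)
    refine ⟨a :: T0, h0, ?_⟩
    intro W' hW'
    cases W' with
    | nil => have := hS _ hW'; simp at this
    | cons b T' =>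
      by_cases hab : b = a
      · subst hab
        rcases h1 T' hW' with h2 | h2
        · left; rw [h2]
        · right; exact List.Lex.cons h2
      · right
        apply List.Lex.rel
        have h3 := Nat.find_min' hex ⟨b, T', hW', rfl⟩
        have h4 : rank g a ≠ rank g b := fun h => hab (rank_inj hg h).symm
        unfold letterLt
        omega

theorem nf_ex (hg : 2 ≤ g) (x : SurfaceGroup g) : ∃ W : Word g, eval g W = x ∧ IrreducibleWord g W := by
  have Γ := geo hg
  have hex : ∃ n, ∃ W : Word g, eval g W = x ∧ W.length = n := by
    obtain ⟨W, h1, -⟩ := Γ.word x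
    exact ⟨_, W.map (unlab hg), by rw [eval_eq hg, map_unlab, h1], rfl⟩
  classical
  obtain ⟨W, h1, h2⟩ := Nat.find_spec hex
  obtain ⟨W0, ⟨h3, h4⟩, h5⟩ := lexmin hg (Nat.find hex) {W | eval g W = x ∧ W.length = Nat.find hex}
    ⟨W, h1, h2⟩ (fun W h => h.2)
  refine ⟨W0, h3, ?_⟩
  intro W' hW'
  rw [h3] at hW'
  have h6 := Nat.find_min' hex ⟨W', hW', rfl⟩
  rcases Nat.lt_or_eq_of_le h6 with h7 | h7
  · right; left; omega
  · rcases h5 W' ⟨hW', h7.symm⟩ with h8 | h8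
    · exact Or.inl h8
    · right; right; exact ⟨by omega, h8⟩

theorem nf_spec (hg : 2 ≤ g) (x : SurfaceGroup g) : eval g (nf g x) = x ∧ IrreducibleWord g (nf g x) := by
  have h := nf_ex hg x
  unfold nf
  rw [dif_pos h]
  exact h.choose_spec

end Gpart
end Aux
end SG

namespace SG
namespace Aux

section Hpart
variable {g : ℕ}

theorem rs_range (τ x : ZMod (4*g)) (n : ℕ) :
    rs τ x n = (List.range n).map (fun j : ℕ => x + (j : ZMod (4*g)) * τ) := by
  induction n with
  | zero => rfl
  | succ n ih => rw [rs_succ, List.range_succ, List.map_append, ih]; rfl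

theorem rot1 (τ x : ZMod (4*g)) (k : ℕ) (hk : 0 < k) (h : (k : ZMod (4*g)) * τ = 0) :
    (rs τ x k).rotate 1 = rs τ (x + τ) k := by
  obtain ⟨m, rfl⟩ : ∃ m, k = m + 1 := ⟨k - 1, by omega⟩
  rw [rs_succ τ (x + τ), rs, List.rotate_cons_succ, List.rotate_zero]
  congr 2
  push_cast at h
  linear_combination -h

theorem rotn (τ x : ZMod (4*g)) (k : ℕ) (hk : 0 < k) (h : (k : ZMod (4*g)) * τ = 0) (n : ℕ) :
    (rs τ x k).rotate n = rs τ (x + (n : ZMod (4*g)) * τ) k := by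
  induction n with
  | zero => simp
  | succ n ih =>
    rw [← List.rotate_rotate, ih, rot1 _ _ _ hk h]
    congr 1
    push_cast; ring

theorem isRot (hg : 2 ≤ g) (τ x : ZMod (4*g)) (hτ : Sg τ) (W : List (ZMod (4*g))) :
    List.IsRotated (rs τ x (4*g)) W ↔ ∃ y, W = rs τ y (4*g) := by
  have h0 : ((4*g : ℕ) : ZMod (4*g)) * τ = 0 := by rw [ZMod.natCast_self]; ring
  constructor
  · rintro ⟨n, rfl⟩
    exact ⟨_, rotn τ x _ (by omega) h0 n⟩
  · rintro ⟨y, rfl⟩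
    haveI : NeZero (4*g) := ⟨by omega⟩
    refine ⟨((y - x) * τ).val, ?_⟩
    rw [rotn τ x _ (by omega) h0]
    congr 1
    rw [ZMod.natCast_zmod_val]
    linear_combination (y - x) * hτ.sq

theorem Rword_lab (hg : 2 ≤ g) : (Rword g).map lab = rs 1 0 (4*g) := by
  rw [rs_split 1 0 (2*g) (2*g) (by omega)]
  unfold Rword
  rw [List.map_append]
  congr 1
  · rw [← List.map_id (rs 1 0 (2*g)), ← ofFn_eq, List.map_ofFn]
    congr 1
    funext i
    simp [lab]
  · rw [← List.map_id (rs 1 _ (2*g)), ← ofFn_eq, List.map_ofFn]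
    congr 1
    funext i
    simp [lab, H]; ring

theorem isRot_map (hg : 2 ≤ g) (W W' : Word g) :
    List.IsRotated W W' ↔ List.IsRotated (W.map lab) (W'.map lab) := by
  constructor
  · rintro ⟨n, rfl⟩
    exact ⟨n, (List.map_rotate _ _ _).symm⟩
  · rintro ⟨n, h⟩
    refine ⟨n, map_lab_inj ?_⟩
    rw [List.map_rotate, h]

theorem mem_RSet (hg : 2 ≤ g) (W : Word g) :
    W ∈ RSet g ↔ ∃ ε x, Sg ε ∧ W.map lab = rs ε x (4*g) := by
  have e4 : 4*g = 4*g-1+1 := by omega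
  have e : ∀ x : ZMod (4*g), rs 1 x (4*g) = rs 1 x (4*g-1+1) := by intro x; rw [← e4]
  have h1 : Sg (1 : ZMod (4*g)) := Or.inl rfl
  unfold RSet
  rw [Set.mem_setOf_eq, isRot_map hg, isRot_map hg, map_wordInv, Rword_lab hg, isRot hg _ _ h1,
    e, zinv_rs, ← e4, isRot hg _ _ h1.neg]
  constructor
  · rintro (⟨y, h⟩ | ⟨y, h⟩)
    · exact ⟨1, y, h1, h⟩
    · exact ⟨-1, y, h1.neg, h⟩
  · rintro ⟨ε, x, rfl | rfl, h⟩
    · exact Or.inl ⟨x, h⟩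
    · exact Or.inr ⟨x, h⟩

theorem rs_take (τ x : ZMod (4*g)) (m k : ℕ) (h : k ≤ m) : (rs τ x m).take k = rs τ x k := by
  rw [rs_split τ x k (m - k) (by omega)]
  exact List.take_left' (rs_length _ _ _)

theorem isFR_iff (hg : 2 ≤ g) (k : ℕ) (hk : 2 ≤ k) (hk' : k ≤ 4*g) (W : Word g) :
    IsFR g k W ↔ ∃ ε x, Sg ε ∧ W.map lab = rs ε x k := by
  constructor
  · rintro ⟨-, -, B, hB, rfl⟩
    obtain ⟨ε, x, hε, h⟩ := (mem_RSet hg B).1 hB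
    refine ⟨ε, x, hε, ?_⟩
    rw [List.map_take, h, rs_take _ _ _ _ hk']
  · rintro ⟨ε, x, hε, h⟩
    refine ⟨hk, hk', (rs ε x (4*g)).map (unlab hg), (mem_RSet hg _).2 ⟨ε, x, hε, map_unlab hg _⟩, ?_⟩
    apply map_lab_inj
    rw [List.map_take, map_unlab, rs_take _ _ _ _ hk', h]

theorem rs_inj {ε ε' x x' : ZMod (4*g)} {k : ℕ} (hk : 2 ≤ k) (h : rs ε x k = rs ε' x' k) :
    x = x' ∧ ε = ε' := by
  obtain ⟨m, rfl⟩ : ∃ m, k = m + 2 := ⟨k - 2, by omega⟩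
  simp only [rs, List.cons.injEq] at h
  obtain ⟨rfl, h, -⟩ := h
  exact ⟨rfl, by linear_combination h⟩

theorem left_iff (hg : 2 ≤ g) {ε x a : ZMod (4*g)} (hε : Sg ε) :
    (∃ ε' x', Sg ε' ∧ a :: rs ε x (4*g-1) = rs ε' x' (4*g-1+1)) ↔ a = x - ε := by
  constructor
  · rintro ⟨ε', x', -, h⟩
    rw [rs, List.cons.injEq] at h
    obtain ⟨h1, h2⟩ := h
    obtain ⟨h3, h4⟩ := rs_inj (by omega) h2
    rw [h1, h3, h4]; ring
  · rintro rfl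
    refine ⟨ε, x - ε, hε, ?_⟩
    rw [rs, sub_add_cancel]

theorem right_iff (hg : 2 ≤ g) {ε x a : ZMod (4*g)} (hε : Sg ε) :
    (∃ ε' x', Sg ε' ∧ rs ε x (4*g-1) ++ [a] = rs ε' x' (4*g-1+1)) ↔ a = x - ε := by
  constructor
  · rintro ⟨ε', x', -, h⟩
    rw [rs_succ] at h
    obtain ⟨h1, h2⟩ := List.append_inj h (by simp [rs_length])
    obtain ⟨h3, h4⟩ := rs_inj (by omega) h1
    simp only [List.cons.injEq, and_true] at h2
    rw [h2, cast4 hg, h3, h4]; ring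
  · rintro rfl
    refine ⟨ε, x, hε, ?_⟩
    rw [rs_succ, cast4 hg]
    congr 2; ring

theorem hasLLFR_iff (hg : 2 ≤ g) (W : Word g) : HasLLFR g (4*g-1) W ↔ LL (W.map lab) := by
  constructor
  · rintro ⟨P, F, Q, rfl, hF, hl, hr⟩
    obtain ⟨ε, x, hε, h⟩ := (isFR_iff hg _ (by omega) (by omega) _).1 hF
    refine ⟨P.map lab, Q.map lab, ε, x, hε, by rw [List.map_append, List.map_append, h], ?_, ?_⟩
    · intro P' e
      have e2 : P = (P'.map (unlab hg)) ++ [unlab hg (x - ε)] := map_lab_inj (by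
        rw [e, List.map_append, map_unlab]; simp [lab_unlab])
      apply hl (unlab hg (x - ε)) (by rw [e2]; simp)
      rw [isFR_iff hg _ (by omega) (by omega), List.map_cons, h, lab_unlab, left_iff hg hε]
    · intro Q' e
      have e2 : Q = unlab hg (x - ε) :: (Q'.map (unlab hg)) := map_lab_inj (by
        rw [e, List.map_cons, map_unlab]; simp [lab_unlab])
      apply hr (unlab hg (x - ε)) (by rw [e2]; simp)
      rw [isFR_iff hg _ (by omega) (by omega), List.map_append, h, List.map_cons, lab_unlab,
        List.map_nil, right_iff hg hε]
  · rintro ⟨P, Q, ε, x, hε, e, hl, hr⟩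
    have hF : ((rs ε x (4*g-1)).map (unlab hg)).map lab = rs ε x (4*g-1) := map_unlab hg _
    refine ⟨P.map (unlab hg), (rs ε x (4*g-1)).map (unlab hg), Q.map (unlab hg), ?_, ?_, ?_, ?_⟩
    · apply map_lab_inj
      rw [e, List.map_append, List.map_append, map_unlab, map_unlab, map_unlab]
    · rw [isFR_iff hg _ (by omega) (by omega)]
      exact ⟨ε, x, hε, hF⟩
    · intro a ha h
      rw [isFR_iff hg _ (by omega) (by omega), List.map_cons, hF, left_iff hg hε] at h
      obtain ⟨P', hP'⟩ := List.getLast?_eq_some_iff.1 ha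
      apply hl (P'.map lab)
      rw [← map_unlab hg P, hP', List.map_append, ← h]; rfl
    · intro a ha h
      rw [isFR_iff hg _ (by omega) (by omega), List.map_append, hF, List.map_cons, List.map_nil,
        right_iff hg hε] at h
      obtain ⟨Q', hQ'⟩ := List.head?_eq_some_iff.1 ha
      apply hr (Q'.map lab)
      rw [← map_unlab hg Q, hQ', List.map_cons, ← h]

theorem LL_zinv (hg : 2 ≤ g) {W : List (ZMod (4*g))} (h : LL W) : LL (zinv W) := by
  obtain ⟨P, Q, ε, x, hε, rfl, hl, hr⟩ := h
  have e4 : 4*g-1 = 4*g-2+1 := by omega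
  have c : ((4*g-2 : ℕ) : ZMod (4*g)) = -2 := by
    have h1 : ((4*g-2+1 : ℕ) : ZMod (4*g)) = -1 := by
      rw [show 4*g-2+1 = 4*g-1 by omega]; exact cast4 hg
    rw [Nat.cast_add] at h1
    push_cast at h1
    linear_combination h1
  refine ⟨zinv Q, zinv P, -ε, x + H g + ((4*g-2 : ℕ) : ZMod (4*g)) * ε, hε.neg, ?_, ?_, ?_⟩
  · have e : rs ε x (4*g-1) = rs ε x (4*g-2+1) := by rw [← e4]
    rw [zinv_append, zinv_append, e, zinv_rs, ← e4, List.append_assoc]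
  · intro P' h
    have h2 := congrArg zinv h
    rw [zinv_zinv, zinv_append] at h2
    apply hr (zinv P')
    rw [h2, c]
    simp [zinv]
    linear_combination H_add_H (g := g)
  · intro Q' h
    have h2 := congrArg zinv h
    rw [zinv_zinv, zinv_cons] at h2
    apply hl (zinv Q')
    rw [h2, c]
    congr 2
    linear_combination H_add_H (g := g)

theorem FRed_zinv {W : List (ZMod (4*g))} (h : FRed W) : FRed (zinv W) := by
  unfold FRed zinv at *
  rw [List.isChain_reverse, List.isChain_map]
  refine h.imp ?_
  intro a c hac h
  apply hac
  linear_combination -h - H_add_H (g := g)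

theorem fr_FRed {W : Word g} (h : FreelyReduced g W) : FRed (W.map lab) := by
  unfold FRed FreelyReduced at *
  rw [List.isChain_map]
  refine List.IsChain.imp ?_ h
  intro a c hac h
  exact hac (lab_inj (by rw [lab_inv, h]))

/-- the relator sequence -/
noncomputable def bq (hg : 2 ≤ g) (w ε : ZMod (4*g)) (j : ℕ) : Letter g :=
  unlab hg (w + (j : ZMod (4*g)) * ε)

theorem seg_lab (hg : 2 ≤ g) (w ε : ZMod (4*g)) (i k : ℕ) :
    (seg g (bq hg w ε) i k).map lab = rs ε (w + (i : ZMod (4*g)) * ε) k := by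
  rw [rs_range, seg, List.map_map]
  apply List.map_congr_left
  intro j _
  simp only [Function.comp, bq, lab_unlab]
  push_cast; ring

theorem dseg_lab (hg : 2 ≤ g) (w ε : ZMod (4*g)) (i k : ℕ) (hk : k ≤ i + 4*g) :
    (dseg g (bq hg w ε) i k).map lab = rs (-ε) (w + (i : ZMod (4*g)) * ε) k := by
  rw [rs_range, dseg, List.map_map]
  apply List.map_congr_left
  intro j hj
  rw [List.mem_range] at hj
  simp only [Function.comp, bq, lab_unlab]
  rw [Nat.cast_sub (by omega)]
  push_cast
  linear_combination ε * four_g (g := g)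

theorem bq_rel (hg : 2 ≤ g) (w ε : ZMod (4*g)) (hε : Sg ε) : RelSeq g (bq hg w ε) := by
  refine ⟨?_, ?_⟩
  · intro i
    unfold bq
    congr 1
    push_cast
    linear_combination ε * four_g (g := g)
  · rw [mem_RSet hg]
    exact ⟨ε, _, hε, seg_lab hg _ _ _ _⟩

theorem wpow_lab (W : Word g) (t : ℕ) :
    (wpow g W t).map lab = (List.replicate t (W.map lab)).flatten := by
  unfold wpow
  rw [List.map_flatten, List.map_replicate]

theorem bq_lab (hg : 2 ≤ g) (w ε : ZMod (4*g)) (j : ℕ) :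
    lab (bq hg w ε j) = w + (j : ZMod (4*g)) * ε := lab_unlab hg _

theorem zinv_rep (W : List (ZMod (4*g))) (t : ℕ) :
    zinv (List.replicate t W).flatten = (List.replicate t (zinv W)).flatten := by
  induction t with
  | zero => rfl
  | succ t ih =>
    rw [List.replicate_succ', List.flatten_append, zinv_append, ih, List.replicate_succ]
    simp

theorem zinv_rs' (τ x : ZMod (4*g)) {n : ℕ} (hn : 0 < n) :
    zinv (rs τ x n) = rs (-τ) (x + H g + ((n : ZMod (4*g)) - 1) * τ) n := by
  obtain ⟨m, rfl⟩ : ∃ m, n = m + 1 := ⟨n - 1, by omega⟩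
  rw [zinv_rs]
  congr 1
  push_cast; ring

theorem c2g2 (hg : 2 ≤ g) : ((2*g-2 : ℕ) : ZMod (4*g)) = 2*(g:ZMod (4*g)) - 2 := by
  rw [Nat.cast_sub (by omega)]; push_cast; ring

theorem part1 (hg : 2 ≤ g) {X U : Word g} (hX : IrreducibleWord g X) (hU : IrreducibleWord g U)
    (hfr : FreelyReduced g (wordInv g X ++ U ++ X))
    (hno : ¬ HasLLFR g (4*g-1) (wordInv g X ++ U ++ X))
    (hL : HasLLFR g (4*g-1) (nf g (eval g (wordInv g X ++ U)) ++ X)) :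
    ∃ b : ℕ → Letter g, RelSeq g b ∧ ∃ t₀ : ℕ, 1 ≤ t₀ ∧
      ((∃ P : Word g, wordInv g X = P ++ dseg g b (4*g) (2*g)) ∧
        U = wpow g (seg g b (2*g+2) (2*g-1)) t₀ ++ [b 1] ++ seg g b (2*g+3) (2*g-2) ∧
        (∃ Q : Word g, X = seg g b 1 (2*g) ++ Q)) := by
  obtain ⟨hV1, hV2⟩ := nf_spec hg (eval g (wordInv g X ++ U))
  generalize nf g (eval g (wordInv g X ++ U)) = V at *
  rw [hasLLFR_iff hg] at hno hL
  have hf := fr_FRed hfr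
  rw [eval_eq hg, eval_eq hg] at hV1
  simp only [List.map_append, map_wordInv] at *
  have fX := irr_fine hg hX
  obtain ⟨σ, y, r, Q, hσ, eX, eU⟩ := core (geo hg) hg (gdP hg) (fine_inv hg fX) (irr_fine hg hU)
    (irr_fine hg hV2) fX rfl hV1 hf hno hL
  have hH := hσ.H
  have h4 := four_g (g := g)
  refine ⟨bq hg (y + H g - σ) σ, bq_rel hg _ _ hσ, r+1, by omega, ⟨(zinv Q).map (unlab hg), ?_⟩, ?_,
    ⟨Q.map (unlab hg), ?_⟩⟩
  · apply map_lab_inj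
    rw [map_wordInv, List.map_append, map_unlab, dseg_lab hg _ _ _ _ (by omega), eX, zinv_append,
      zinv_rs' _ _ (by omega)]
    congr 2
    push_cast
    linear_combination H_add_H (g := g) - hH - σ * h4
  · apply map_lab_inj
    rw [eU, List.map_append, List.map_append, wpow_lab, seg_lab, seg_lab, List.map_cons, List.map_nil,
      bq_lab]
    have e1 : y + H g - σ + ((2*g+2 : ℕ) : ZMod (4*g)) * σ = y + σ := by
      push_cast; linear_combination H_add_H (g := g) - hH
    have e2 : y + H g - σ + ((1 : ℕ) : ZMod (4*g)) * σ = y + H g := by push_cast; ring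
    have e3 : y + H g - σ + ((2*g+3 : ℕ) : ZMod (4*g)) * σ = y + 2*σ := by
      push_cast; linear_combination H_add_H (g := g) - hH
    rw [e1, e2, e3]
  · apply map_lab_inj
    rw [eX, List.map_append, map_unlab, seg_lab]
    congr 2
    push_cast; ring

theorem part2 (hg : 2 ≤ g) {X U : Word g} (hX : IrreducibleWord g X) (hU : IrreducibleWord g U)
    (hfr : FreelyReduced g (wordInv g X ++ U ++ X))
    (hno : ¬ HasLLFR g (4*g-1) (wordInv g X ++ U ++ X))
    (hL : HasLLFR g (4*g-1) (wordInv g X ++ nf g (eval g (U ++ X)))) :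
    ∃ b : ℕ → Letter g, RelSeq g b ∧ ∃ t₀ : ℕ, 1 ≤ t₀ ∧
      ((∃ P : Word g, wordInv g X = P ++ seg g b 2 (2*g)) ∧
        U = seg g b (2*g+2) (2*g-2) ++ [b (2*g+1)] ++
              wpow g (seg g b (2*g+2) (2*g-1)) t₀ ∧
        (∃ Q : Word g, X = [b 1] ++ dseg g b (4*g) (2*g-1) ++ Q)) := by
  obtain ⟨hV1, hV2⟩ := nf_spec hg (eval g (U ++ X))
  generalize nf g (eval g (U ++ X)) = V at *
  rw [hasLLFR_iff hg] at hno hL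
  have hf := fr_FRed hfr
  rw [eval_eq hg, eval_eq hg] at hV1
  simp only [List.map_append, map_wordInv] at *
  have fX := irr_fine hg hX
  have ez : zinv (X.map lab) ++ zinv (U.map lab) ++ X.map lab =
      zinv (zinv (X.map lab) ++ U.map lab ++ X.map lab) := by
    rw [zinv_append, zinv_append, zinv_zinv, List.append_assoc]
  have hev : ev (gp hg) (zinv (V.map lab)) = ev (gp hg) (zinv (X.map lab) ++ zinv (U.map lab)) := by
    rw [← zinv_append, zinv, zinv, ev_inv _ (geo hg).inv, ev_inv _ (geo hg).inv, hV1]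
  obtain ⟨σ, y, r, Q, hσ, eX, eU⟩ := core (geo hg) hg (gdP hg) (fine_inv hg fX)
    (fine_inv hg (irr_fine hg hU)) (fine_inv hg (irr_fine hg hV2)) fX rfl hev
    (by rw [ez]; exact FRed_zinv hf)
    (by
      rw [ez]; intro h
      apply hno
      have := LL_zinv hg h
      rwa [zinv_zinv] at this)
    (by
      have := LL_zinv hg hL
      rwa [zinv_append, zinv_zinv] at this)
  have eU2 := congrArg zinv eU
  rw [zinv_zinv, zinv_append, zinv_append, zinv_rep, zinv_rs' _ _ (by omega),
    zinv_rs' _ _ (by omega), c2g1 hg, c2g2 hg] at eU2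
  have hH := hσ.H
  have h4 := four_g (g := g)
  have hHH := H_add_H (g := g)
  refine ⟨bq hg (y + H g + σ) (-σ), bq_rel hg _ _ hσ.neg, r+1, by omega,
    ⟨(zinv Q).map (unlab hg), ?_⟩, ?_, ⟨Q.map (unlab hg), ?_⟩⟩
  · apply map_lab_inj
    rw [map_wordInv, List.map_append, map_unlab, seg_lab, eX, zinv_append,
      zinv_rs' _ _ (by omega)]
    congr 2
    push_cast
    linear_combination hHH - hH
  · apply map_lab_inj
    rw [eU2, List.map_append, List.map_append, wpow_lab, seg_lab, seg_lab, List.map_cons, List.map_nil,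
      bq_lab]
    have e1 : y + H g + σ + ((2*g+2 : ℕ) : ZMod (4*g)) * -σ = y - σ := by
      push_cast; linear_combination hH
    have e2 : y + H g + σ + ((2*g+1 : ℕ) : ZMod (4*g)) * -σ = y := by
      push_cast; linear_combination hH
    have e3 : y + 2*σ + H g + (2*(g:ZMod (4*g)) - 2 - 1) * σ = y - σ := by
      linear_combination hHH - hH
    have e4 : y + σ + H g + (2*(g:ZMod (4*g)) - 1 - 1) * σ = y - σ := by
      linear_combination hHH - hH
    have e5 : zinv [y + H g] = [y] := by simp [zinv, addHH]
    rw [e1, e2, e3, e4, e5, List.append_assoc]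
  · apply map_lab_inj
    rw [eX, List.map_append, List.map_append, map_unlab, dseg_lab hg _ _ _ _ (by omega), rs_cons hg,
      List.map_cons, List.map_nil, bq_lab, neg_neg]
    have e1 : y + H g + σ + ((1 : ℕ) : ZMod (4*g)) * -σ = y + H g := by push_cast; ring
    have e2 : y + H g + σ + ((4*g : ℕ) : ZMod (4*g)) * -σ = y + H g + σ := by
      push_cast; linear_combination -σ * h4
    rw [e1, e2]
    rfl

end Hpart
end Aux
end SG

/-- If `X⁻¹UX` is freely reduced with no `(4g−1)`-LLFR, then either
(a) the explicit configuration `W₁` or its symmetric version `W₂` occurs, or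
(b) neither `nf(X⁻¹U)·X` nor `X⁻¹·nf(UX)` contains a `(4g−1)`-LLFR. -/
theorem conjugate_reduction_dichotomy (g : ℕ) (hg : 2 ≤ g) (X U : SG.Word g)
    (hX : SG.IrreducibleWord g X) (hU : SG.IrreducibleWord g U)
    (hfr : SG.FreelyReduced g (SG.wordInv g X ++ U ++ X))
    (hno : ¬ SG.HasLLFR g (4*g-1) (SG.wordInv g X ++ U ++ X)) :
    (∃ b : ℕ → SG.Letter g, SG.RelSeq g b ∧ ∃ t₀ : ℕ, 1 ≤ t₀ ∧
      (((∃ P : SG.Word g, SG.wordInv g X = P ++ SG.dseg g b (4*g) (2*g)) ∧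
        U = SG.wpow g (SG.seg g b (2*g+2) (2*g-1)) t₀ ++ [b 1] ++
              SG.seg g b (2*g+3) (2*g-2) ∧
        (∃ Q : SG.Word g, X = SG.seg g b 1 (2*g) ++ Q)) ∨
       ((∃ P : SG.Word g, SG.wordInv g X = P ++ SG.seg g b 2 (2*g)) ∧
        U = SG.seg g b (2*g+2) (2*g-2) ++ [b (2*g+1)] ++
              SG.wpow g (SG.seg g b (2*g+2) (2*g-1)) t₀ ∧
        (∃ Q : SG.Word g, X = [b 1] ++ SG.dseg g b (4*g) (2*g-1) ++ Q)))) ∨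
    (¬ SG.HasLLFR g (4*g-1) (SG.nf g (SG.eval g (SG.wordInv g X ++ U)) ++ X) ∧
     ¬ SG.HasLLFR g (4*g-1) (SG.wordInv g X ++ SG.nf g (SG.eval g (U ++ X)))) := by
  classical
  by_cases h1 : SG.HasLLFR g (4*g-1) (SG.nf g (SG.eval g (SG.wordInv g X ++ U)) ++ X)
  · obtain ⟨b, hb, t, ht, h⟩ := SG.Aux.part1 hg hX hU hfr hno h1
    exact Or.inl ⟨b, hb, t, ht, Or.inl h⟩
  · by_cases h2 : SG.HasLLFR g (4*g-1) (SG.wordInv g X ++ SG.nf g (SG.eval g (U ++ X)))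
    · obtain ⟨b, hb, t, ht, h⟩ := SG.Aux.part2 hg hX hU hfr hno h2
      exact Or.inl ⟨b, hb, t, ht, Or.inr h⟩
    · exact Or.inr ⟨h1, h2⟩
end

section
/- Let X and U be irreducible words such that the word X⁻¹UX is freely reduced. Suppose U is cyclically irreducible and U is not of the form (b₁⋯b_{2g−1})^t for any b₁⋯b_{4g} ∈ 𝓡 and any t ≥ 1. If the word X⁻¹UX contains a (4g−1)-LLFR, then there exist irreducible words Y and V such that: (a) V is a cyclic permutation of the word U; (b) the words X⁻¹UX and Y⁻¹VY represent the same element of G; (c) the word Y⁻¹VY is freely reduced and contains no (4g−1)-LLFR. -/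
namespace SGAux
open SG

variable {g : ℕ}

theorem eval_append (A B : Word g) : eval g (A ++ B) = eval g A * eval g B := by
  simp [eval]

theorem evalLetter_inv (a : Letter g) : evalLetter g (invLetter g a) = (evalLetter g a)⁻¹ := by
  rcases a with ⟨i, b⟩
  cases b <;> simp [evalLetter, invLetter]

theorem inv_inv_letter (a : Letter g) : invLetter g (invLetter g a) = a := by
  rcases a with ⟨i, b⟩
  simp [invLetter]

theorem eval_wordInv (A : Word g) : eval g (wordInv g A) = (eval g A)⁻¹ := by
  induction A with
  | nil => simp [eval, wordInv]
  | cons a A ih =>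
    have h1 : wordInv g (a :: A) = wordInv g A ++ [invLetter g a] := by simp [wordInv]
    have h2 : a :: A = [a] ++ A := rfl
    rw [h1, eval_append, ih, h2, eval_append, mul_inv_rev]
    simp [eval, evalLetter_inv]

theorem wordInv_append (A B : Word g) :
    wordInv g (A ++ B) = wordInv g B ++ wordInv g A := by
  simp [wordInv]

theorem wordInv_wordInv (A : Word g) : wordInv g (wordInv g A) = A := by
  simp [wordInv, Function.comp_def, inv_inv_letter]

theorem length_wordInv (A : Word g) : (wordInv g A).length = A.length := by
  simp [wordInv]

theorem isRotated_append_comm (A B : Word g) : List.IsRotated (A ++ B) (B ++ A) :=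
  List.isRotated_append

theorem wordInv_rot {A B : Word g} (h : List.IsRotated A B) :
    List.IsRotated (wordInv g A) (wordInv g B) := by
  unfold wordInv
  exact (h.map _).reverse

theorem RSet_rot {A B : Word g} (hA : A ∈ RSet g) (h : List.IsRotated A B) : B ∈ RSet g := by
  rcases hA with h1 | h1
  · exact Or.inl (h1.trans h)
  · exact Or.inr (h1.trans h)

theorem RSet_inv {A : Word g} (hA : A ∈ RSet g) : wordInv g A ∈ RSet g := by
  rcases hA with h1 | h1
  · exact Or.inr (wordInv_rot h1)
  · left
    have := wordInv_rot h1
    rwa [wordInv_wordInv] at this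

theorem Rword_length : (Rword g).length = 4 * g := by
  simp [Rword]; omega

theorem RSet_length {A : Word g} (hA : A ∈ RSet g) : A.length = 4 * g := by
  rcases hA with h1 | h1
  · rw [← h1.perm.length_eq, Rword_length]
  · rw [← h1.perm.length_eq, length_wordInv, Rword_length]

theorem Rword_nodup : (Rword g).Nodup := by
  unfold Rword
  rw [List.nodup_append]
  refine ⟨?_, ?_, ?_⟩
  · rw [List.nodup_ofFn]; intro i j h; simpa using h
  · rw [List.nodup_ofFn]; intro i j h; simpa using h
  · intro a ha b hb hab
    simp only [List.mem_ofFn] at ha hb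
    obtain ⟨i, rfl⟩ := ha
    obtain ⟨j, rfl⟩ := hb
    simp at hab

theorem invLetter_injective : Function.Injective (invLetter g) := by
  intro a b h
  rw [← inv_inv_letter a, h, inv_inv_letter]

theorem RSet_nodup {A : Word g} (hA : A ∈ RSet g) : A.Nodup := by
  rcases hA with h1 | h1
  · exact h1.nodup_iff.1 Rword_nodup
  · refine h1.nodup_iff.1 ?_
    unfold wordInv
    rw [List.nodup_reverse]
    exact Rword_nodup.map invLetter_injective

theorem eval_Rword : eval g (Rword g) = 1 := by
  have h : PresentedGroup.mk ({relator g} : Set (FreeGroup (Fin (2*g)))) (relator g) = 1 :=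
    PresentedGroup.one_of_mem (by simp)
  have hr : relator g = (List.ofFn fun i : Fin (2*g) => FreeGroup.of i).prod *
      (List.ofFn fun i : Fin (2*g) => (FreeGroup.of i)⁻¹).prod := rfl
  rw [← h]
  refine Eq.trans ?_ (congrArg (PresentedGroup.mk ({relator g} : Set _)) hr).symm
  unfold Rword
  rw [eval_append, map_mul, map_list_prod, map_list_prod]
  simp [eval, List.map_ofFn, Function.comp_def, evalLetter, gen, PresentedGroup.of]

theorem eval_rot {A B : Word g} (h : List.IsRotated A B) (hA : eval g A = 1) :
    eval g B = 1 := by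
  obtain ⟨n, hn, rfl⟩ := List.isRotated_iff_mod.1 h
  rw [List.rotate_eq_drop_append_take hn, eval_append]
  rw [← List.take_append_drop n A, eval_append] at hA
  exact mul_eq_one_comm.1 hA

theorem RSet_eval {A : Word g} (hA : A ∈ RSet g) : eval g A = 1 := by
  rcases hA with h1 | h1
  · exact eval_rot h1 eval_Rword
  · exact eval_rot h1 (by rw [eval_wordInv, eval_Rword, inv_one])

/-- The second half of the word is the letterwise inverse of its first half. -/
def Half (g : ℕ) (B : Word g) : Prop :=
  ∃ A : Word g, A.length = 2 * g ∧ B = A ++ A.map (invLetter g)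

theorem Half_rot1 {B : Word g} (h : Half g B) : Half g (B.rotate 1) := by
  obtain ⟨A, hA, rfl⟩ := h
  cases A with
  | nil => exact ⟨[], hA, by simp⟩
  | cons a A =>
    refine ⟨A ++ [invLetter g a], by simpa using hA, ?_⟩
    simp [inv_inv_letter]

theorem Half_rot {B C : Word g} (h : Half g B) (hr : List.IsRotated B C) : Half g C := by
  obtain ⟨n, rfl⟩ := hr
  induction n with
  | zero => simpa using h
  | succ n ih =>
    rw [← List.rotate_rotate]
    exact Half_rot1 ih

theorem Half_Rword : Half g (Rword g) :=
  ⟨List.ofFn fun i : Fin (2*g) => ((i, true) : Letter g), by simp, by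
    simp [Rword, List.map_ofFn, Function.comp_def, invLetter]⟩

theorem RSet_half {A : Word g} (hA : A ∈ RSet g) : Half g A := by
  rcases hA with h1 | h1
  · exact Half_rot Half_Rword h1
  · refine Half_rot ?_ h1
    obtain ⟨A, hA, h⟩ := Half_Rword (g := g)
    refine ⟨A.reverse, by simpa using hA, ?_⟩
    rw [h]
    simp [wordInv, Function.comp_def, inv_inv_letter]

/-- A prefix of a relator. -/
def FRw (g : ℕ) (W : Word g) : Prop := ∃ T : Word g, W ++ T ∈ RSet g

theorem FRw_of_IsFR {k : ℕ} {W : Word g} (h : IsFR g k W) : FRw g W ∧ W.length = k := by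
  obtain ⟨_, hk, B, hB, rfl⟩ := h
  refine ⟨⟨B.drop k, by simpa using hB⟩, ?_⟩
  simp [RSet_length hB, hk]

theorem FRw_sub {P M Q : Word g} (h : FRw g (P ++ M ++ Q)) : FRw g M := by
  obtain ⟨T, hT⟩ := h
  refine ⟨Q ++ T ++ P, RSet_rot hT ?_⟩
  have := isRotated_append_comm P (M ++ Q ++ T)
  simpa [List.append_assoc] using this

theorem FRw_inv {W : Word g} (h : FRw g W) : FRw g (wordInv g W) := by
  obtain ⟨T, hT⟩ := h
  refine ⟨wordInv g T, RSet_rot (RSet_inv hT) ?_⟩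
  rw [wordInv_append]
  exact isRotated_append_comm _ _

/-- A fractional relator of length `k` equals a word of length `4g - k`. -/
theorem FRw_compl {W : Word g} (h : FRw g W) :
    ∃ w : Word g, eval g W = eval g w ∧ w.length + W.length = 4 * g := by
  obtain ⟨T, hT⟩ := h
  refine ⟨wordInv g T, ?_, ?_⟩
  · rw [eval_wordInv]
    have := RSet_eval hT
    rw [eval_append] at this
    exact eq_inv_of_mul_eq_one_left this
  · have := RSet_length hT
    rw [length_wordInv]
    simp at this
    omega

theorem irr_length {W W' : Word g} (h : IrreducibleWord g W) (he : eval g W' = eval g W) :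
    W.length ≤ W'.length := by
  rcases h W' he with rfl | h | h
  · exact le_rfl
  · exact h.le
  · exact h.1.le

theorem irr_sub {W P F Q w : Word g} (h : IrreducibleWord g W) (hW : W = P ++ F ++ Q)
    (he : eval g F = eval g w) : F.length ≤ w.length := by
  have := irr_length (W' := P ++ w ++ Q) h (by rw [hW]; simp only [eval_append, he])
  rw [hW] at this
  simp at this
  omega

theorem irr_FRw {W P F Q : Word g} (h : IrreducibleWord g W) (hW : W = P ++ F ++ Q)
    (hF : FRw g F) : F.length ≤ 2 * g := by
  obtain ⟨w, he, hl⟩ := FRw_compl hF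
  have := irr_sub h hW he
  omega

theorem irr_subinv {W P F Q w : Word g} (h : IrreducibleWord g W)
    (hW : wordInv g W = P ++ F ++ Q)
    (he : eval g F = eval g w) : F.length ≤ w.length := by
  have h1 : W = wordInv g Q ++ wordInv g F ++ wordInv g P := by
    rw [← wordInv_wordInv W, hW]
    simp only [wordInv_append, List.append_assoc]
  have := irr_sub (w := wordInv g w) h h1 (by rw [eval_wordInv, eval_wordInv, he])
  simpa [length_wordInv] using this

theorem irr_FRw_inv {W P F Q : Word g} (h : IrreducibleWord g W)
    (hW : wordInv g W = P ++ F ++ Q) (hF : FRw g F) : F.length ≤ 2 * g := by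
  obtain ⟨w, he, hl⟩ := FRw_compl hF
  have := irr_subinv h hW he
  omega

theorem FRw_seg {W : Word g} (hg : 2 ≤ g) (h : FRw g W) :
    ∃ b : ℕ → Letter g, RelSeq g b ∧ W = seg g b 1 W.length := by
  obtain ⟨T, hT⟩ := h
  have hlen := RSet_length hT
  let d : Letter g := (⟨0, by omega⟩, true)
  let b : ℕ → Letter g := fun i => (W ++ T).getD ((i + (4 * g - 1)) % (4 * g)) d
  have key : ∀ k ≤ 4 * g, seg g b 1 k = (W ++ T).take k := by
    intro k hk
    apply List.ext_getElem
    · rw [List.length_take, hlen]; simp [seg, hk]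
    · intro j h1 h2
      have hj : j < k := by simpa [seg] using h1
      have hm : (1 + j + (4 * g - 1)) % (4 * g) = j := by
        have : 1 + j + (4 * g - 1) = j + 4 * g := by omega
        rw [this, Nat.add_mod_right, Nat.mod_eq_of_lt (by omega)]
      simp only [seg, b, List.getElem_map, List.getElem_range, hm, List.getElem_take]
      rw [List.getD_eq_getElem _ _ (by omega)]
  refine ⟨b, ⟨?_, ?_⟩, ?_⟩
  · intro i
    have : i + 4 * g + (4 * g - 1) = i + (4 * g - 1) + 4 * g := by omega
    simp only [b, this, Nat.add_mod_right]
  · rw [key _ le_rfl, ← hlen, List.take_length]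
    exact hT
  · rw [key _ (by rw [← hlen]; simp)]
    simp

/-- In a relator, a letter and its inverse are at distance `2g`. -/
theorem FRw_gap {a : Letter g} {M : Word g} (hg : 2 ≤ g)
    (h : FRw g ([a] ++ M ++ [invLetter g a])) : M.length + 1 = 2 * g := by
  obtain ⟨T, hT⟩ := h
  obtain ⟨A, hA, hAe⟩ := RSet_half hT
  have hlen := RSet_length hT
  have hnd := RSet_nodup hT
  cases A with
  | nil => simp at hA; omega
  | cons a' A =>
    have haa : a = a' := by
      have := congrArg List.head? hAe
      simpa using this
    subst haa
    have hl : 2 * g < ([a] ++ M ++ [invLetter g a] ++ T).length := by omega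
    have hl' : M.length + 1 < ([a] ++ M ++ [invLetter g a] ++ T).length := by simp
    have h1 : ([a] ++ M ++ [invLetter g a] ++ T)[2 * g]'hl = invLetter g a := by
      simp only [hAe]
      rw [List.getElem_append_right (by omega)]
      simp [hA]
    have h2 : ([a] ++ M ++ [invLetter g a] ++ T)[M.length + 1]'hl' = invLetter g a := by
      simp
    exact (hnd.getElem_inj_iff).1 (h2.trans h1.symm)

/-- Position of a subword in a product of three words. -/
theorem split3 {α : Type*} {A V C P F Q : List α} (h : A ++ V ++ C = P ++ F ++ Q) :
    (∃ S T, A = S ++ F ++ T) ∨ (∃ S T, V = S ++ F ++ T) ∨ (∃ S T, C = S ++ F ++ T) ∨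
    (∃ S f1 f2 T, A = S ++ f1 ∧ V = f2 ++ T ∧ F = f1 ++ f2) ∨
    (∃ S f1 f2 T, V = S ++ f1 ∧ C = f2 ++ T ∧ F = f1 ++ f2) ∨
    (∃ S f1 f2 T, A = S ++ f1 ∧ C = f2 ++ T ∧ F = f1 ++ V ++ f2 ∧ f1 ≠ [] ∧ f2 ≠ []) := by
  rw [List.append_assoc P F Q] at h
  rcases List.append_eq_append_iff.1 h with ⟨D, hP, hC⟩ | ⟨D, hAV, hFQ⟩
  · exact Or.inr (Or.inr (Or.inl ⟨D, Q, by simp [hC]⟩))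
  rcases List.append_eq_append_iff.1 hFQ with ⟨E, hD, hQ⟩ | ⟨E, hF, hC⟩
  · subst hD
    rcases List.append_eq_append_iff.1 hAV with ⟨K, hP, hV⟩ | ⟨K, hA, hFE⟩
    · exact Or.inr (Or.inl ⟨K, E, by simp [hV]⟩)
    · rcases List.append_eq_append_iff.1 hFE with ⟨L, hK, hE⟩ | ⟨L, hK, hE⟩
      · exact Or.inl ⟨P, L, by simp [hA, hK]⟩
      · exact Or.inr (Or.inr (Or.inr (Or.inl ⟨P, K, L, E, hA, hE, hK⟩)))
  · rcases List.append_eq_append_iff.1 hAV with ⟨K, hP, hV⟩ | ⟨K, hA, hD⟩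
    · exact Or.inr (Or.inr (Or.inr (Or.inr (Or.inl ⟨K, D, E, Q, hV, hC, hF⟩))))
    · by_cases hK : K = []
      · subst hK
        exact Or.inr (Or.inr (Or.inr (Or.inr (Or.inl
          ⟨[], D, E, Q, by simpa using hD.symm, hC, hF⟩))))
      · by_cases hE : E = []
        · subst hE
          exact Or.inr (Or.inr (Or.inr (Or.inl
            ⟨P, K, V, [], hA, by simp, by rw [hF, hD]; simp⟩)))
        · exact Or.inr (Or.inr (Or.inr (Or.inr (Or.inr
            ⟨P, K, E, Q, hA, hC, by rw [hF, hD], hK, hE⟩))))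

theorem not_reduced {W : Word g} (h : ¬ FreelyReduced g W) :
    ∃ P a Q, W = P ++ [a, invLetter g a] ++ Q := by
  unfold FreelyReduced at h
  induction W with
  | nil => exact absurd List.isChain_nil h
  | cons a W ih =>
    cases W with
    | nil => exact absurd (List.isChain_singleton _) h
    | cons c W =>
      by_cases hc : c = invLetter g a
      · exact ⟨[], a, W, by simp [hc]⟩
      · have h' : ¬ List.Chain' (fun a c => c ≠ invLetter g a) (c :: W) := by
          intro h2
          exact h (List.isChain_cons_cons.2 ⟨hc, h2⟩)
        obtain ⟨P, x, Q, e⟩ := ih h'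
        exact ⟨a :: P, x, Q, by rw [e]; simp⟩

theorem reduced_sub {P Q : Word g} {a : Letter g}
    (h : FreelyReduced g (P ++ [a, invLetter g a] ++ Q)) : False := by
  unfold FreelyReduced at h
  have h1 : List.IsChain (fun a c => c ≠ invLetter g a) [a, invLetter g a] :=
    List.IsChain.infix h ⟨P, Q, rfl⟩
  simp at h1

theorem eval_cancel (a : Letter g) : eval g [a, invLetter g a] = eval g [] := by
  simp [eval, evalLetter_inv]

/-- Every element has a least representative. -/
theorem exists_irr (W : Word g) : ∃ W', eval g W' = eval g W ∧ IrreducibleWord g W' := by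
  classical
  let Pn : ℕ → Prop := fun n => ∃ Z : Word g, eval g Z = eval g W ∧ Z.length = n
  have hP : ∃ n, Pn n := ⟨_, W, rfl, rfl⟩
  let S : Set (Word g) := {Z | eval g Z = eval g W ∧ Z.length = Nat.find hP}
  have hfin : S.Finite := (List.finite_length_eq (Letter g) (Nat.find hP)).subset
    (fun Z hZ => hZ.2)
  have hne : S.Nonempty := Nat.find_spec hP
  have rank_inj : ∀ a b : Letter g, rank g a = rank g b → a = b := by
    rintro ⟨i, x⟩ ⟨j, y⟩ h
    have hi := i.2
    have hj := j.2
    cases x <;> cases y <;> simp [rank] at h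
    · simp [Fin.ext_iff, h]
    · omega
    · omega
    · simp [Fin.ext_iff]; omega
  obtain ⟨Z, hZ, hmin⟩ := Set.exists_min_image S (fun Z => Z.map (rank g)) hfin hne
  refine ⟨Z, hZ.1, ?_⟩
  intro W' hW'
  have hle : Nat.find hP ≤ W'.length := Nat.find_min' hP ⟨W', hW'.trans hZ.1, rfl⟩
  rcases hle.lt_or_eq with hlt | heq
  · right; left; rw [hZ.2]; exact hlt
  · have h1 := hmin W' ⟨hW'.trans hZ.1, heq.symm⟩
    rcases h1.lt_or_eq with hlt | he
    · right; right
      refine ⟨hZ.2.trans heq, ?_⟩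
      have : List.Lex (· < ·) (Z.map (rank g)) (W'.map (rank g)) := hlt
      clear * - this rank_inj
      induction Z generalizing W' with
      | nil =>
        cases W' with
        | nil => simp at this
        | cons a W' => exact List.Lex.nil
      | cons z Z ih =>
        cases W' with
        | nil => simp at this
        | cons a W' =>
          simp only [List.map_cons] at this
          generalize hz : rank g z = rz at this
          generalize ha : rank g a = ra at this
          cases this with
          | rel h => exact List.Lex.rel (by unfold letterLt; omega)
          | cons h =>
            rw [rank_inj z a (by omega)]
            exact List.Lex.cons (ih _ h)
    · left
      exact (List.map_injective_iff.2 (fun a b h => rank_inj a b h) he).symm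

theorem eval_conj (Y V : Word g) :
    eval g (wordInv g Y ++ V ++ Y) = (eval g Y)⁻¹ * eval g V * eval g Y := by
  rw [eval_append, eval_append, eval_wordInv]

/-- Shortening a conjugator on its left end. -/
theorem shrink_left {Y V S f1 f2 T w : Word g} (hY : wordInv g Y = S ++ f1)
    (hV : V = f2 ++ T) (he : eval g (f1 ++ f2) = eval g w) (hlt : w.length < f1.length) :
    ∃ Y' V' : Word g, List.IsRotated V V' ∧
      eval g (wordInv g Y' ++ V' ++ Y') = eval g (wordInv g Y ++ V ++ Y) ∧
      Y'.length < Y.length := by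
  have hY' : Y = wordInv g f1 ++ wordInv g S := by
    rw [← wordInv_append, ← hY, wordInv_wordInv]
  refine ⟨wordInv g w ++ wordInv g S, T ++ f2, ?_, ?_, ?_⟩
  · rw [hV]; exact isRotated_append_comm _ _
  · rw [eval_conj, eval_conj, hY', hV]
    simp only [eval_append, eval_wordInv, ← he]
    group
  · rw [hY']
    simp only [List.length_append, length_wordInv]
    omega

/-- Shortening a conjugator on its right end. -/
theorem shrink_right {Y V S f1 f2 T w : Word g} (hV : V = S ++ f1)
    (hY : Y = f2 ++ T) (he : eval g (f1 ++ f2) = eval g w) (hlt : w.length < f2.length) :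
    ∃ Y' V' : Word g, List.IsRotated V V' ∧
      eval g (wordInv g Y' ++ V' ++ Y') = eval g (wordInv g Y ++ V ++ Y) ∧
      Y'.length < Y.length := by
  refine ⟨w ++ T, f1 ++ S, ?_, ?_, ?_⟩
  · rw [hV]; exact isRotated_append_comm _ _
  · rw [eval_conj, eval_conj, hY, hV]
    simp only [eval_append, ← he]
    group
  · rw [hY]
    simp only [List.length_append]
    omega

/-- A long fractional relator in `Y⁻¹VY` either allows shortening or covers `V`. -/
theorem long_FR {Y V P F Q : Word g} (hg : 2 ≤ g) (hY : IrreducibleWord g Y)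
    (hV : IrreducibleWord g V) (hF : FRw g F) (hl : F.length = 4 * g - 1)
    (h : wordInv g Y ++ V ++ Y = P ++ F ++ Q) :
    (∃ S f1 f2 T, wordInv g Y = S ++ f1 ∧ V = f2 ++ T ∧ F = f1 ++ f2 ∧
      2 * g - 1 ≤ f1.length ∧ 2 * g - 1 ≤ f2.length) ∨
    (∃ S f1 f2 T, V = S ++ f1 ∧ Y = f2 ++ T ∧ F = f1 ++ f2 ∧
      2 * g - 1 ≤ f1.length ∧ 2 * g - 1 ≤ f2.length) ∨
    (∃ S f1 f2 T, wordInv g Y = S ++ f1 ∧ Y = f2 ++ T ∧ F = f1 ++ V ++ f2 ∧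
      f1 ≠ [] ∧ f2 ≠ []) := by
  rcases split3 h with ⟨S, T, h⟩ | ⟨S, T, h⟩ | ⟨S, T, h⟩ | ⟨S, f1, f2, T, h1, h2, h3⟩ |
    ⟨S, f1, f2, T, h1, h2, h3⟩ | h
  · have := irr_FRw_inv hY h hF; omega
  · have := irr_FRw hV h hF; omega
  · have := irr_FRw hY h hF; omega
  · have a1 : FRw g f1 := FRw_sub (P := []) (Q := f2) (by simpa [← h3] using hF)
    have a2 : FRw g f2 := FRw_sub (P := f1) (Q := []) (by simpa [← h3] using hF)
    have b1 := irr_FRw_inv (Q := []) hY (by simpa using h1) a1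
    have b2 := irr_FRw (P := []) hV (by simpa using h2) a2
    have := congrArg List.length h3
    rw [List.length_append] at this
    exact Or.inl ⟨S, f1, f2, T, h1, h2, h3, by omega, by omega⟩
  · have a1 : FRw g f1 := FRw_sub (P := []) (Q := f2) (by simpa [← h3] using hF)
    have a2 : FRw g f2 := FRw_sub (P := f1) (Q := []) (by simpa [← h3] using hF)
    have b1 := irr_FRw (Q := []) hV (by simpa using h1) a1
    have b2 := irr_FRw (P := []) hY (by simpa using h2) a2
    have := congrArg List.length h3
    rw [List.length_append] at this
    exact Or.inr (Or.inl ⟨S, f1, f2, T, h1, h2, h3, by omega, by omega⟩)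
  · exact Or.inr (Or.inr h)

/-- If `U` has length `2g-1` and `X⁻¹UX` contains a long fractional relator, then `U` is itself
a fractional relator. -/
theorem short_U {X U P F Q : Word g} (hg : 2 ≤ g) (hX : IrreducibleWord g X)
    (hU : IrreducibleWord g U) (hF : FRw g F) (hl : F.length = 4 * g - 1)
    (h : wordInv g X ++ U ++ X = P ++ F ++ Q) (hUl : U.length = 2 * g - 1) : FRw g U := by
  rcases long_FR hg hX hU hF hl h with ⟨S, f1, f2, T, h1, h2, h3, h4, h5⟩ |
    ⟨S, f1, f2, T, h1, h2, h3, h4, h5⟩ | ⟨S, f1, f2, T, h1, h2, h3, h4, h5⟩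
  · have : T = [] := by
      have := congrArg List.length h2
      rw [List.length_append] at this
      exact List.length_eq_zero_iff.1 (by omega)
    rw [h2, this, List.append_nil]
    exact FRw_sub (P := f1) (Q := []) (by simpa [← h3] using hF)
  · have : S = [] := by
      have := congrArg List.length h1
      rw [List.length_append] at this
      exact List.length_eq_zero_iff.1 (by omega)
    rw [h1, this, List.nil_append]
    exact FRw_sub (P := []) (Q := f2) (by simpa [← h3] using hF)
  · exact FRw_sub (P := f1) (Q := f2) (by simpa [← h3] using hF)

/-- If a fractional relator covers all of `V` inside `Y⁻¹VY`, then `|V| = 2g-1`. -/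
theorem cover_length {Y V S f1 f2 T : Word g} (hg : 2 ≤ g) (h1 : wordInv g Y = S ++ f1)
    (h2 : Y = f2 ++ T) (hF : FRw g (f1 ++ V ++ f2)) (hf1 : f1 ≠ []) (hf2 : f2 ≠ []) :
    V.length + 1 = 2 * g := by
  cases f2 with
  | nil => exact absurd rfl hf2
  | cons y f2 =>
    obtain ⟨f, z, rfl⟩ : ∃ f z, f1 = f ++ [z] :=
      ⟨f1.dropLast, f1.getLast hf1, (List.dropLast_append_getLast hf1).symm⟩
    have hz : z = invLetter g y := by
      rw [h2] at h1
      have := congrArg List.getLast? h1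
      simp [wordInv] at this
      exact this.symm
    subst hz
    apply FRw_gap (a := invLetter g y) hg
    rw [inv_inv_letter]
    exact FRw_sub (P := f) (Q := f2) (by simpa using hF)

end SGAux

open SG SGAux

/-- If `U` is cyclically irreducible, not of the form
`(b₁⋯b_{2g−1})^t`, and `X⁻¹UX` (freely reduced) contains a `(4g−1)`-LLFR, then
there are irreducible `Y, V` with `V` a cyclic permutation of `U`,
`X⁻¹UX = Y⁻¹VY` in `G`, and `Y⁻¹VY` freely reduced without `(4g−1)`-LLFR. -/
theorem remove_long_LLFR (g : ℕ) (hg : 2 ≤ g) (X U : SG.Word g)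
    (hX : SG.IrreducibleWord g X) (hU : SG.IrreducibleWord g U)
    (hfr : SG.FreelyReduced g (SG.wordInv g X ++ U ++ X))
    (hcyc : SG.CyclicallyIrreducibleWord g U)
    (hU' : ¬ ∃ b : ℕ → SG.Letter g, SG.RelSeq g b ∧ ∃ t : ℕ, 1 ≤ t ∧
        U = SG.wpow g (SG.seg g b 1 (2*g-1)) t)
    (hLL : SG.HasLLFR g (4*g-1) (SG.wordInv g X ++ U ++ X)) :
    ∃ Y V : SG.Word g, SG.IrreducibleWord g Y ∧ SG.IrreducibleWord g V ∧
      List.IsRotated U V ∧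
      SG.eval g (SG.wordInv g X ++ U ++ X) = SG.eval g (SG.wordInv g Y ++ V ++ Y) ∧
      SG.FreelyReduced g (SG.wordInv g Y ++ V ++ Y) ∧
      ¬ SG.HasLLFR g (4*g-1) (SG.wordInv g Y ++ V ++ Y) := by
  classical
  obtain ⟨P0, F0, Q0, hW0, hFR0, -, -⟩ := hLL
  obtain ⟨hF0, hl0⟩ := FRw_of_IsFR hFR0
  -- `U` is nonempty
  have hUne : U ≠ [] := by
    rintro rfl
    cases X with
    | nil =>
      have := congrArg List.length hW0
      simp [wordInv] at this
      omega
    | cons x X =>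
      apply reduced_sub (g := g) (P := wordInv g X) (Q := X) (a := invLetter g x)
      rw [inv_inv_letter]
      simpa [wordInv] using hfr
  -- choose a shortest conjugator
  let Pn : ℕ → Prop := fun n => ∃ Y V : Word g, List.IsRotated U V ∧
    eval g (wordInv g X ++ U ++ X) = eval g (wordInv g Y ++ V ++ Y) ∧ Y.length = n
  have hP : ∃ n, Pn n := ⟨_, X, U, List.IsRotated.refl _, rfl, rfl⟩
  obtain ⟨Y0, V, hrot, he0, hYl0⟩ := Nat.find_spec hP
  obtain ⟨Y, hYe, hY⟩ := exists_irr Y0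
  have hV : IrreducibleWord g V := hcyc V hrot
  have he : eval g (wordInv g X ++ U ++ X) = eval g (wordInv g Y ++ V ++ Y) := by
    rw [he0, eval_conj, eval_conj, hYe]
  have hYl : Y.length ≤ Nat.find hP := by
    rw [← hYl0]; exact irr_length hY hYe.symm
  have hVne : V ≠ [] := by
    intro h
    rw [h] at hrot
    exact hUne (List.isRotated_nil_iff.1 hrot)
  have hmin : ¬ ∃ Y' V' : Word g, List.IsRotated V V' ∧
      eval g (wordInv g Y' ++ V' ++ Y') = eval g (wordInv g Y ++ V ++ Y) ∧
      Y'.length < Y.length := by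
    rintro ⟨Y', V', h1, h2, h3⟩
    have := Nat.find_min' hP ⟨Y', V', hrot.trans h1, he.trans h2.symm, rfl⟩
    omega
  refine ⟨Y, V, hY, hV, hrot, he, ?_, ?_⟩
  · by_contra hcon
    obtain ⟨P, a, Q, hW⟩ := not_reduced hcon
    rcases split3 hW with ⟨S, T, h⟩ | ⟨S, T, h⟩ | ⟨S, T, h⟩ | ⟨S, f1, f2, T, h1, h2, h3⟩ |
      ⟨S, f1, f2, T, h1, h2, h3⟩ | ⟨S, f1, f2, T, h1, h2, h3, h4, h5⟩
    · have := irr_subinv hY h (eval_cancel a); simp at this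
    · have := irr_sub hV h (eval_cancel a); simp at this
    · have := irr_sub hY h (eval_cancel a); simp at this
    · rcases List.eq_nil_or_concat f1 with h0 | ⟨f, z, h0⟩
      · subst h0
        have := irr_sub (P := []) (F := f2) hV (by simpa using h2)
          (by simpa [h3] using eval_cancel a)
        rw [List.nil_append] at h3
        rw [← h3] at this; simp at this
      · exact hmin (shrink_left (w := []) h1 h2 (by rw [← h3]; exact eval_cancel a)
          (by rw [h0]; simp))
    · rcases List.eq_nil_or_concat f2 with h0 | ⟨f, z, h0⟩
      · subst h0
        have := irr_sub (Q := []) (F := f1) hV (by simpa using h1)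
          (by simpa [h3] using eval_cancel a)
        rw [List.append_nil] at h3
        rw [← h3] at this; simp at this
      · exact hmin (shrink_right (w := []) h1 h2 (by rw [← h3]; exact eval_cancel a)
          (by rw [h0]; simp))
    · have := congrArg List.length h3
      have a1 := List.length_pos_iff.2 h4
      have a2 := List.length_pos_iff.2 h5
      have a3 := List.length_pos_iff.2 hVne
      simp at this
      omega
  · rintro ⟨P, F, Q, hW, hFR, -, -⟩
    obtain ⟨hF, hl⟩ := FRw_of_IsFR hFR
    obtain ⟨w, hwe, hwl⟩ := FRw_compl hF
    rcases long_FR hg hY hV hF hl hW with ⟨S, f1, f2, T, h1, h2, h3, h4, h5⟩ |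
      ⟨S, f1, f2, T, h1, h2, h3, h4, h5⟩ | ⟨S, f1, f2, T, h1, h2, h3, h4, h5⟩
    · exact hmin (shrink_left (w := w) h1 h2 (by rw [← h3]; exact hwe) (by omega))
    · exact hmin (shrink_right (w := w) h1 h2 (by rw [← h3]; exact hwe) (by omega))
    · have hVl := cover_length hg h1 h2 (by rw [← h3]; exact hF) h4 h5
      have hUl : U.length = 2 * g - 1 := by
        rw [hrot.perm.length_eq]; omega
      have hUF := short_U hg hX hU hF0 hl0 hW0 hUl
      obtain ⟨b, hb, hbU⟩ := FRw_seg hg hUF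
      rw [hUl] at hbU
      exact hU' ⟨b, hb, 1, le_rfl, by simpa [wpow] using hbU⟩
end
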